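/- Assume condition (L): p > 2, or p < 2 and α < δ; assume α < N and 1 < q < q*. Then there exists a > 0 such that the global solution w(·,a) is nonnegative on [0,∞) and L(a) = lim_{r→∞} r^α w(r,a) = 0. If p > 2 this solution has compact support; if p < 2 it is positive on [0,∞) and satisfies: lim_{r→∞} r^δ w(r,a) = ℓ if p₁ < p; lim_{r→∞} r^η w(r,a) = c for some c > 0 if p < p₁; lim_{r→∞} r^N (ln r)^{(N+1)/2} w(r,a) = (1/N)(N(N-1)/(2(N-α)))^{(N+1)/2} if p = p₁. -/

import Mathlib

open Set Filter Topology Asymptotics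

/-- The p-Laplacian nonlinearity φ_p(x) = |x|^{p-2} x. -/
noncomputable def phiP (p x : ℝ) : ℝ := |x| ^ (p - 2) * x

/-- `w` is a solution of equation (E) on the interval `I ⊆ (0,∞)`:
`w` is C¹ on `I`, `|w'|^{p-2} w'` is C¹ on `I`, and the equation
`(|w'|^{p-2}w')' + ((N-1)/r)|w'|^{p-2}w' + r w' + α w + |w|^{q-1} w = 0`
holds on `I` (derivatives taken within `I`). -/
def IsSolutionOn (N : ℕ) (p q α : ℝ) (w : ℝ → ℝ) (I : Set ℝ) : Prop :=
  ContDiffOn ℝ 1 w I ∧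
  ContDiffOn ℝ 1 (fun r => phiP p (derivWithin w I r)) I ∧
  ∀ r ∈ I,
    derivWithin (fun s => phiP p (derivWithin w I s)) I r
      + ((N : ℝ) - 1) / r * phiP p (derivWithin w I r)
      + r * derivWithin w I r + α * w r + |w r| ^ (q - 1) * w r = 0

/-- `w` is the global solution of (E) on `[0,∞)` with `w(0) = a`, `w'(0) = 0`:
`w ∈ C¹([0,∞))`, `|w'|^{p-2}w' ∈ C¹([0,∞))`, and (E) holds on `(0,∞)`. -/
def IsGlobalSolution (N : ℕ) (p q α a : ℝ) (w : ℝ → ℝ) : Prop :=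
  ContDiffOn ℝ 1 w (Ici 0) ∧
  ContDiffOn ℝ 1 (fun r => phiP p (derivWithin w (Ici 0) r)) (Ici 0) ∧
  (∀ r ∈ Ioi (0 : ℝ),
    derivWithin (fun s => phiP p (derivWithin w (Ici 0) s)) (Ici 0) r
      + ((N : ℝ) - 1) / r * phiP p (derivWithin w (Ici 0) r)
      + r * derivWithin w (Ici 0) r + α * w r + |w r| ^ (q - 1) * w r = 0) ∧
  w 0 = a ∧ derivWithin w (Ici 0) 0 = 0

/-- `r` is an isolated zero of `w` relative to the set `I`. -/
def IsIsolatedZeroOn (w : ℝ → ℝ) (I : Set ℝ) (r : ℝ) : Prop :=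
  r ∈ I ∧ w r = 0 ∧ ∀ᶠ s in 𝓝[I \ {r}] r, w s ≠ 0

/-- `w` has at least `n` isolated zeros in `(0,∞)`. -/
def HasAtLeastIsolatedZeros (w : ℝ → ℝ) (n : ℕ) : Prop :=
  ∃ z : Fin n → ℝ, StrictMono z ∧ ∀ i, 0 < z i ∧ IsIsolatedZeroOn w (Ici 0) (z i)

theorem integral_exp_weight_le {B M e s : ℝ} (hB : 0 ≤ B) (hM : 0 ≤ M) :
    ∫ t in (0:ℝ)..s, (B * M * Real.exp ((2 * B + 1) * t) + e)
      ≤ M / 2 * Real.exp ((2 * B + 1) * s) + e * s := by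
  have hl : (2 * B + 1) ≠ 0 := by positivity
  have h1 : ∀ t ∈ uIcc 0 s, HasDerivAt
      (fun t => B * M * (Real.exp ((2 * B + 1) * t) / (2 * B + 1)) + e * t)
      (B * M * Real.exp ((2 * B + 1) * t) + e) t := by
    intro t _
    have h2 : HasDerivAt (fun t : ℝ => (2 * B + 1) * t) (2 * B + 1) t := by
      simpa using (hasDerivAt_id t).const_mul (2 * B + 1)
    have h3 := ((h2.exp.div_const (2 * B + 1)).const_mul (B * M)).add
      ((hasDerivAt_id t).const_mul e)
    exact h3.congr_deriv (by field_simp)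
  rw [intervalIntegral.integral_eq_sub_of_hasDerivAt h1
    (Continuous.intervalIntegrable (by fun_prop) _ _)]
  have h4 : B / (2 * B + 1) ≤ 1 / 2 := by
    rw [div_le_div_iff₀ (by positivity) (by norm_num)]; linarith
  have h5 : 0 ≤ M * Real.exp ((2 * B + 1) * s) := by positivity
  have h6 : 0 ≤ B * M * (Real.exp ((2 * B + 1) * 0) / (2 * B + 1)) := by positivity
  have h7 : B * M * (Real.exp ((2 * B + 1) * s) / (2 * B + 1))
      = B / (2 * B + 1) * (M * Real.exp ((2 * B + 1) * s)) := by ring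
  nlinarith [mul_le_mul_of_nonneg_right h4 h5]

/-- Two solutions of Volterra equations with close causal Lipschitz kernels are close. -/
theorem volterra_dependence {R B e : ℝ} (hR : 0 ≤ R) (hB : 0 ≤ B) (he : 0 ≤ e)
    {x₁ x₂ k₁ k₂ : ℝ → ℝ} (hx₁ : ContinuousOn x₁ (Icc 0 R)) (hx₂ : ContinuousOn x₂ (Icc 0 R))
    (hk₁ : ContinuousOn k₁ (Icc 0 R)) (hk₂ : ContinuousOn k₂ (Icc 0 R))
    (e₁ : ∀ s ∈ Icc 0 R, x₁ s = 1 + ∫ t in (0:ℝ)..s, k₁ t)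
    (e₂ : ∀ s ∈ Icc 0 R, x₂ s = 1 + ∫ t in (0:ℝ)..s, k₂ t)
    (hk : ∀ s ∈ Icc 0 R, ∀ M, (∀ t ∈ Icc 0 s, |x₁ t - x₂ t| ≤ M) → |k₁ s - k₂ s| ≤ B * M + e) :
    ∀ s ∈ Icc 0 R, |x₁ s - x₂ s| ≤ 2 * e * R * Real.exp ((2 * B + 1) * R) := by
  set l := 2 * B + 1 with hl
  have hl0 : 0 < l := by positivity
  obtain ⟨s₀, hs₀, hmax⟩ := isCompact_Icc.exists_isMaxOn (nonempty_Icc.2 hR)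
    (f := fun s => Real.exp (-(l * s)) * |x₁ s - x₂ s|)
    (by fun_prop)
  set M₀ := Real.exp (-(l * s₀)) * |x₁ s₀ - x₂ s₀| with hM₀
  have hM₀0 : 0 ≤ M₀ := by positivity
  have hle : ∀ s ∈ Icc 0 R, |x₁ s - x₂ s| ≤ M₀ * Real.exp (l * s) := by
    intro s hs
    have h := hmax hs
    simp only [mem_ofPred_eq] at h
    calc |x₁ s - x₂ s| = (Real.exp (-(l * s)) * |x₁ s - x₂ s|) * Real.exp (l * s) := by
          rw [mul_right_comm, ← Real.exp_add]; simp
      _ ≤ _ := by gcongr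
  have hsub : Icc 0 s₀ ⊆ Icc 0 R := Icc_subset_Icc_right hs₀.2
  have i₁ : IntervalIntegrable k₁ MeasureTheory.volume 0 s₀ :=
    ContinuousOn.intervalIntegrable (by rw [uIcc_of_le hs₀.1]; exact hk₁.mono hsub)
  have i₂ : IntervalIntegrable k₂ MeasureTheory.volume 0 s₀ :=
    ContinuousOn.intervalIntegrable (by rw [uIcc_of_le hs₀.1]; exact hk₂.mono hsub)
  have key : |x₁ s₀ - x₂ s₀| ≤ M₀ / 2 * Real.exp (l * s₀) + e * s₀ := by
    rw [e₁ _ hs₀, e₂ _ hs₀, add_sub_add_left_eq_sub, ← intervalIntegral.integral_sub i₁ i₂]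
    refine le_trans ?_ (integral_exp_weight_le hB hM₀0)
    rw [← Real.norm_eq_abs]
    refine intervalIntegral.norm_integral_le_of_norm_le hs₀.1 ?_
      (Continuous.intervalIntegrable (by fun_prop) _ _)
    refine Filter.Eventually.of_forall fun t ht => ?_
    have htR : t ∈ Icc 0 R := ⟨ht.1.le, ht.2.trans hs₀.2⟩
    rw [Real.norm_eq_abs, mul_assoc]
    refine hk t htR _ fun u hu => (hle u ⟨hu.1, hu.2.trans htR.2⟩).trans ?_
    have := hu.2
    gcongr
  have hM : M₀ ≤ M₀ / 2 + e * R := by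
    calc M₀ ≤ Real.exp (-(l * s₀)) * (M₀ / 2 * Real.exp (l * s₀) + e * s₀) := by
          rw [hM₀]; gcongr
      _ = M₀ / 2 * (Real.exp (-(l * s₀)) * Real.exp (l * s₀))
          + Real.exp (-(l * s₀)) * (e * s₀) := by ring
      _ ≤ M₀ / 2 + 1 * (e * R) := by
          rw [← Real.exp_add]
          have h0 := hs₀.1
          have h1 : Real.exp (-(l * s₀)) ≤ 1 := Real.exp_le_one_iff.2 (by
            have := mul_nonneg hl0.le hs₀.1; linarith)
          simp only [neg_add_cancel, Real.exp_zero, mul_one]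
          have h2 := hs₀.2
          gcongr
      _ = _ := by ring
  intro s hs
  refine (hle s hs).trans ?_
  have := hs.2
  calc M₀ * Real.exp (l * s) ≤ (2 * e * R) * Real.exp (l * R) := by
        gcongr; linarith
    _ = _ := by ring

/-- Existence for Volterra equations with a causal Lipschitz kernel. -/
theorem volterra_exists {R B : ℝ} (hR : 0 ≤ R) (hB : 0 ≤ B) (K : (ℝ → ℝ) → ℝ → ℝ)
    (hc : ∀ x, ContinuousOn x (Icc 0 R) → ContinuousOn (K x) (Icc 0 R))
    (hK : ∀ x₁ x₂, ContinuousOn x₁ (Icc 0 R) → ContinuousOn x₂ (Icc 0 R) →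
      ∀ s ∈ Icc 0 R, ∀ M, (∀ t ∈ Icc 0 s, |x₁ t - x₂ t| ≤ M) → |K x₁ s - K x₂ s| ≤ B * M) :
    ∃ x, ContinuousOn x (Icc 0 R) ∧ ∀ s ∈ Icc 0 R, x s = 1 + ∫ t in (0:ℝ)..s, K x t := by
  set l := 2 * B + 1 with hl
  have hl0 : 0 < l := by positivity
  let V : C(Icc (0:ℝ) R, ℝ) → ℝ → ℝ := fun u s => Real.exp (l * s) * IccExtend hR u s
  have hV : ∀ u, Continuous (V u) := fun u =>
    (Real.continuous_exp.comp (continuous_const.mul continuous_id)).mul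
      (u.continuous.Icc_extend' )
  have hKV : ∀ u, ContinuousOn (K (V u)) (Icc 0 R) := fun u => hc _ (hV u).continuousOn
  have hII : ∀ u, ∀ s ∈ Icc 0 R,
      IntervalIntegrable (K (V u)) MeasureTheory.volume 0 s := fun u s hs =>
    ContinuousOn.intervalIntegrable (by
      rw [uIcc_of_le hs.1]; exact (hKV u).mono (Icc_subset_Icc_right hs.2))
  have hIc : ∀ u, ContinuousOn (fun s => ∫ t in (0:ℝ)..s, K (V u) t) (Icc 0 R) := fun u => by
    have := intervalIntegral.continuousOn_primitive_interval (μ := MeasureTheory.volume)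
      (f := K (V u)) (a := 0) (b := R)
      (by rw [uIcc_of_le hR]; exact (hKV u).integrableOn_Icc)
    rwa [uIcc_of_le hR] at this
  let Φ : C(Icc (0:ℝ) R, ℝ) → C(Icc (0:ℝ) R, ℝ) := fun u =>
    ⟨fun s => Real.exp (-(l * s)) * (1 + ∫ t in (0:ℝ)..s, K (V u) t), by
      have h : ContinuousOn (fun s : ℝ => Real.exp (-(l * s)) * (1 + ∫ t in (0:ℝ)..s, K (V u) t))
        (Icc 0 R) := ContinuousOn.mul (by fun_prop) (continuousOn_const.add (hIc u))
      exact continuousOn_iff_continuous_domRestrict.1 h⟩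
  have hΦ : ContractingWith (1 / 2 : NNReal) Φ := by
    refine ⟨by norm_num, LipschitzWith.of_dist_le_mul fun u v => ?_⟩
    rw [ContinuousMap.dist_le (by positivity)]
    rintro ⟨s, hs⟩
    have hd : 0 ≤ dist u v := dist_nonneg
    have hVd : ∀ t ∈ Icc 0 R, |V u t - V v t| ≤ dist u v * Real.exp (l * t) := by
      intro t ht
      simp only [V]
      rw [← mul_sub, abs_mul, Real.abs_exp, mul_comm]
      gcongr
      rw [IccExtend_of_mem _ _ ht, IccExtend_of_mem _ _ ht, ← Real.dist_eq]
      exact ContinuousMap.dist_apply_le_dist _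
    have key : |(∫ t in (0:ℝ)..s, K (V u) t) - ∫ t in (0:ℝ)..s, K (V v) t|
        ≤ dist u v / 2 * Real.exp (l * s) + 0 * s := by
      rw [← intervalIntegral.integral_sub (hII u s hs) (hII v s hs)]
      refine le_trans ?_ (integral_exp_weight_le hB hd)
      rw [← Real.norm_eq_abs]
      refine intervalIntegral.norm_integral_le_of_norm_le hs.1 ?_
        (Continuous.intervalIntegrable (by fun_prop) _ _)
      refine Filter.Eventually.of_forall fun t ht => ?_
      have htR : t ∈ Icc 0 R := ⟨ht.1.le, ht.2.trans hs.2⟩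
      rw [Real.norm_eq_abs, mul_assoc, add_zero]
      refine hK _ _ (hV u).continuousOn (hV v).continuousOn t htR _
        fun z hz => (hVd z ⟨hz.1, hz.2.trans htR.2⟩).trans ?_
      have := hz.2
      gcongr
    change dist (Real.exp (-(l * s)) * (1 + ∫ t in (0:ℝ)..s, K (V u) t))
      (Real.exp (-(l * s)) * (1 + ∫ t in (0:ℝ)..s, K (V v) t)) ≤ _
    rw [Real.dist_eq, ← mul_sub, abs_mul, Real.abs_exp, add_sub_add_left_eq_sub]
    calc _ ≤ Real.exp (-(l * s)) * (dist u v / 2 * Real.exp (l * s) + 0 * s) := by gcongr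
      _ = dist u v / 2 * (Real.exp (-(l * s)) * Real.exp (l * s)) := by ring
      _ = _ := by rw [← Real.exp_add]; simp; ring
  have hfix := hΦ.fixedPoint_isFixedPt
  set u := ContractingWith.fixedPoint Φ hΦ
  refine ⟨V u, (hV u).continuousOn, fun s hs => ?_⟩
  have h1 : (u ⟨s, hs⟩ : ℝ) = Real.exp (-(l * s)) * (1 + ∫ t in (0:ℝ)..s, K (V u) t) := by
    conv_lhs => rw [← hfix]
    rfl
  change Real.exp (l * s) * IccExtend hR u s = _
  rw [IccExtend_of_mem _ _ hs, h1, ← mul_assoc, ← Real.exp_add]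
  simp

/-- Truncation to the interval `[a, b]`. -/
noncomputable def trunc (a b v : ℝ) : ℝ := max a (min b v)

theorem trunc_mem {a b : ℝ} (h : a ≤ b) (v : ℝ) : trunc a b v ∈ Icc a b :=
  ⟨le_max_left _ _, max_le h (min_le_left _ _)⟩

theorem trunc_of_mem {a b v : ℝ} (h : v ∈ Icc a b) : trunc a b v = v := by
  rw [trunc, min_eq_right h.2, max_eq_right h.1]

theorem continuous_trunc (a b : ℝ) : Continuous (trunc a b) := by
  unfold trunc; fun_prop

theorem abs_trunc_sub_le (a b u v : ℝ) : |trunc a b u - trunc a b v| ≤ |u - v| :=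
  (abs_max_sub_max_le_max _ _ _ _).trans (by
    rw [sub_self, abs_zero]
    exact max_le (abs_nonneg _) ((abs_min_sub_min_le_max _ _ _ _).trans (by simp)))

/-- The reaction term of the rescaled equation. -/
noncomputable def reac (q α θ v : ℝ) : ℝ := v ^ q + θ * α * v

theorem continuous_reac {q α θ : ℝ} (hq : 0 ≤ q) : Continuous (reac q α θ) := by
  unfold reac
  exact (Real.continuous_rpow_const hq).add (by fun_prop)

theorem reac_mem {q α θ Θ ε v : ℝ} (hq : 1 < q) (hα : 0 < α) (hθ : θ ∈ Icc 0 Θ) (hε : 0 < ε)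
    (hv : v ∈ Icc ε 1) : reac q α θ v ∈ Icc (ε ^ q) (1 + Θ * α) := by
  have hv0 : 0 < v := hε.trans_le hv.1
  have h1 : ε ^ q ≤ v ^ q := Real.rpow_le_rpow hε.le hv.1 (by linarith)
  have h2 : v ^ q ≤ 1 := Real.rpow_le_one hv0.le hv.2 (by linarith)
  have h3 : 0 ≤ θ * α * v := mul_nonneg (mul_nonneg hθ.1 hα.le) hv0.le
  have h4 : θ * α * v ≤ Θ * α * 1 := by
    have := hθ.1
    have := hθ.2
    have := hv.2
    have : 0 ≤ Θ := hθ.1.trans hθ.2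
    gcongr
  constructor <;> unfold reac <;> linarith

theorem exists_rpow_lipschitz {c C : ℝ} (m : ℝ) (hc : 0 < c) :
    ∃ B, 0 ≤ B ∧ ∀ u ∈ Icc c C, ∀ v ∈ Icc c C, |u ^ m - v ^ m| ≤ B * |u - v| := by
  have hcont : ContinuousOn (fun t : ℝ => m * t ^ (m - 1)) (Icc c C) :=
    continuousOn_const.mul (continuousOn_id.rpow_const fun t ht => Or.inl (hc.trans_le ht.1).ne')
  obtain ⟨B, hB⟩ := isCompact_Icc.exists_bound_of_continuousOn hcont
  refine ⟨max B 0, le_max_right _ _, fun u hu v hv => ?_⟩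
  have := (convex_Icc c C).norm_image_sub_le_of_norm_hasDerivWithin_le
    (f := fun t : ℝ => t ^ m) (f' := fun t : ℝ => m * t ^ (m - 1)) (C := max B 0)
    (fun t ht => (Real.hasDerivAt_rpow_const (Or.inl (hc.trans_le ht.1).ne')).hasDerivWithinAt)
    (fun t ht => (hB t ht).trans (le_max_left _ _)) hv hu
  simpa [Real.norm_eq_abs] using this

theorem abs_rpow_sub_rpow_le {q u v : ℝ} (hq : 1 < q) (hu : u ∈ Icc (0 : ℝ) 1)
    (hv : v ∈ Icc (0 : ℝ) 1) : |u ^ q - v ^ q| ≤ q * |u - v| := by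
  have := (convex_Icc (0 : ℝ) 1).norm_image_sub_le_of_norm_hasDerivWithin_le
    (f := fun t : ℝ => t ^ q) (f' := fun t : ℝ => q * t ^ (q - 1)) (C := q)
    (fun t ht => (Real.hasDerivAt_rpow_const (Or.inr hq.le)).hasDerivWithinAt)
    (fun t ht => by
      have h1 : t ^ (q - 1) ≤ 1 := Real.rpow_le_one ht.1 ht.2 (by linarith)
      have h2 : 0 ≤ t ^ (q - 1) := Real.rpow_nonneg ht.1 _
      rw [Real.norm_eq_abs, abs_of_nonneg (by positivity)]
      nlinarith) hv hu
  simpa [Real.norm_eq_abs] using this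

/-- The reduced flux `y(s)/s` expressed as a causal functional of `x`
(with reaction truncated below the level `ε`). -/
noncomputable def redFlux (n : ℕ) (q α θ ε : ℝ) (x : ℝ → ℝ) (s : ℝ) : ℝ :=
  θ * x s + ∫ t in (0:ℝ)..1,
    t ^ n * (reac q α θ (trunc ε 1 (x (s * t))) - θ * (n + 1) * x (s * t))

/-- The slope `x'` expressed as a causal functional of `x`, with truncated reduced flux. -/
noncomputable def slopeOp (n : ℕ) (m q α θ ε c C : ℝ) (x : ℝ → ℝ) (s : ℝ) : ℝ :=
  -(s ^ m * trunc c C (redFlux n q α θ ε x s) ^ m)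

section
variable {n : ℕ} {m q α θ ε c C R Θ : ℝ}

theorem redFlux_congr {x x' : ℝ → ℝ} {s : ℝ} (hs : 0 ≤ s) (h : ∀ t ∈ Icc 0 s, x t = x' t) :
    redFlux n q α θ ε x s = redFlux n q α θ ε x' s := by
  unfold redFlux
  rw [h s ⟨hs, le_rfl⟩]
  congr 1
  refine intervalIntegral.integral_congr fun t ht => ?_
  rw [uIcc_of_le zero_le_one] at ht
  rw [h (s * t) ⟨mul_nonneg hs ht.1, mul_le_of_le_one_right hs ht.2⟩]

theorem continuous_redFlux (hq : 1 < q) {x : ℝ → ℝ} (hx : Continuous x) :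
    Continuous (redFlux n q α θ ε x) := by
  unfold redFlux
  refine (continuous_const.mul hx).add
    (intervalIntegral.continuous_parametric_intervalIntegral_of_continuous' ?_ 0 1)
  have h1 := continuous_reac (q := q) (α := α) (θ := θ) (by linarith)
  have h2 := continuous_trunc ε 1
  have h3 : Continuous fun p : ℝ × ℝ => x (p.1 * p.2) := hx.comp (by fun_prop)
  exact ((continuous_snd.pow n).mul ((h1.comp (h2.comp h3)).sub (continuous_const.mul h3)))

theorem continuousOn_redFlux (hq : 1 < q) {x : ℝ → ℝ} (hx : ContinuousOn x (Icc 0 R)) :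
    ContinuousOn (redFlux n q α θ ε x) (Icc 0 R) := by
  rcases lt_or_ge R 0 with hR | hR
  · simp [Icc_eq_empty_of_lt hR]
  refine (continuous_redFlux hq (x := IccExtend hR ((Icc 0 R).domRestrict x)) ?_).continuousOn.congr
    fun s hs => redFlux_congr hs.1 fun t ht => ?_
  · exact (continuousOn_iff_continuous_domRestrict.1 hx).Icc_extend'
  · rw [IccExtend_of_mem hR _ ⟨ht.1, ht.2.trans hs.2⟩]; rfl

theorem continuousOn_slopeOp (hm : 0 < m) (hq : 1 < q) {x : ℝ → ℝ}
    (hx : ContinuousOn x (Icc 0 R)) :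
    ContinuousOn (slopeOp n m q α θ ε c C x) (Icc 0 R) := by
  unfold slopeOp
  have h1 := Real.continuous_rpow_const hm.le
  exact (h1.continuousOn.mul (h1.comp_continuousOn
    ((continuous_trunc c C).comp_continuousOn (continuousOn_redFlux hq hx)))).neg

theorem continuousOn_redFlux_integrand (hq : 1 < q) {x : ℝ → ℝ} {s : ℝ} (hs : s ∈ Icc 0 R)
    (hx : ContinuousOn x (Icc 0 R)) :
    ContinuousOn (fun t : ℝ => t ^ n * (reac q α θ (trunc ε 1 (x (s * t)))
      - θ * (n + 1) * x (s * t))) (Icc 0 1) := by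
  have h1 := continuous_reac (q := q) (α := α) (θ := θ) (by linarith)
  have h2 := continuous_trunc ε 1
  have h3 : ContinuousOn (fun t : ℝ => x (s * t)) (Icc 0 1) :=
    hx.comp (by fun_prop) fun t ht =>
      ⟨mul_nonneg hs.1 ht.1, (mul_le_of_le_one_right hs.1 ht.2).trans hs.2⟩
  exact ((continuous_pow n).continuousOn.mul
    ((h1.comp_continuousOn (h2.comp_continuousOn h3)).sub (continuousOn_const.mul h3)))

theorem abs_mul_sub_mul_le {a a' u u' M D : ℝ} (ha : a ∈ Icc 0 Θ) (hu : |u - u'| ≤ M)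
    (hD : |u'| ≤ D) : |a * u - a' * u'| ≤ Θ * M + |a - a'| * D := by
  have h1 : a * u - a' * u' = a * (u - u') + (a - a') * u' := by ring
  have h2 : |a| ≤ Θ := by rw [abs_of_nonneg ha.1]; exact ha.2
  rw [h1]
  refine (abs_add_le _ _).trans ?_
  rw [abs_mul, abs_mul]
  have := (abs_nonneg a).trans h2
  gcongr

theorem redFlux_sub_le (hq : 1 < q) (hα : 0 < α) (hε : 0 < ε) (hε1 : ε ≤ 1) {θ₁ θ₂ : ℝ}
    (h₁ : θ₁ ∈ Icc 0 Θ) {x₁ x₂ : ℝ → ℝ} (hx₁ : ContinuousOn x₁ (Icc 0 R))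
    (hx₂ : ContinuousOn x₂ (Icc 0 R)) {s M D : ℝ} (hs : s ∈ Icc 0 R)
    (hM : ∀ t ∈ Icc 0 s, |x₁ t - x₂ t| ≤ M) (hD : ∀ t ∈ Icc 0 s, |x₂ t| ≤ D) :
    |redFlux n q α θ₁ ε x₁ s - redFlux n q α θ₂ ε x₂ s|
      ≤ (Θ + q + Θ * α + Θ * (n + 1)) * M + (D + α + (n + 1) * D) * |θ₁ - θ₂| := by
  have hss : s ∈ Icc 0 s := ⟨hs.1, le_rfl⟩
  have hM0 : 0 ≤ M := (abs_nonneg _).trans (hM s hss)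
  have hD0 : 0 ≤ D := (abs_nonneg _).trans (hD s hss)
  have hΘ : 0 ≤ Θ := h₁.1.trans h₁.2
  have i₁ := (continuousOn_redFlux_integrand (n := n) (α := α) (θ := θ₁) (ε := ε) hq hs hx₁)
  have i₂ := (continuousOn_redFlux_integrand (n := n) (α := α) (θ := θ₂) (ε := ε) hq hs hx₂)
  rw [← uIcc_of_le zero_le_one] at i₁ i₂
  unfold redFlux
  rw [add_sub_add_comm, ← intervalIntegral.integral_sub i₁.intervalIntegrable
    i₂.intervalIntegrable]
  refine (abs_add_le _ _).trans ?_
  have h1 := abs_mul_sub_mul_le (a' := θ₂) h₁ (hM s hss) (hD s hss)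
  have h2 : ‖∫ t in (0:ℝ)..1, (t ^ n * (reac q α θ₁ (trunc ε 1 (x₁ (s * t)))
      - θ₁ * (n + 1) * x₁ (s * t)) - t ^ n * (reac q α θ₂ (trunc ε 1 (x₂ (s * t)))
      - θ₂ * (n + 1) * x₂ (s * t)))‖
      ≤ (q * M + α * (Θ * M + |θ₁ - θ₂| * 1) + (n + 1) * (Θ * M + |θ₁ - θ₂| * D)) * |1 - 0| := by
    refine intervalIntegral.norm_integral_le_of_norm_le_const fun t ht => ?_
    rw [uIoc_of_le zero_le_one] at ht
    have hst : s * t ∈ Icc 0 s := ⟨mul_nonneg hs.1 ht.1.le, mul_le_of_le_one_right hs.1 ht.2⟩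
    have hm₁ := trunc_mem hε1 (x₁ (s * t))
    have hm₂ := trunc_mem hε1 (x₂ (s * t))
    have hT := (abs_trunc_sub_le ε 1 (x₁ (s * t)) (x₂ (s * t))).trans (hM _ hst)
    have a1 := (abs_rpow_sub_rpow_le hq ⟨hε.le.trans hm₁.1, hm₁.2⟩
      ⟨hε.le.trans hm₂.1, hm₂.2⟩).trans (mul_le_mul_of_nonneg_left hT (by linarith))
    have a2 := abs_mul_sub_mul_le (a' := θ₂) h₁ hT (D := 1)
      (by rw [abs_of_nonneg (hε.le.trans hm₂.1)]; exact hm₂.2)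
    have a3 := abs_mul_sub_mul_le (a' := θ₂) h₁ (hM _ hst) (hD _ hst)
    set u₁ := trunc ε 1 (x₁ (s * t))
    set u₂ := trunc ε 1 (x₂ (s * t))
    have e1 : t ^ n * (reac q α θ₁ u₁ - θ₁ * (n + 1) * x₁ (s * t))
        - t ^ n * (reac q α θ₂ u₂ - θ₂ * (n + 1) * x₂ (s * t))
        = t ^ n * ((u₁ ^ q - u₂ ^ q) + α * (θ₁ * u₁ - θ₂ * u₂)
          + -((n + 1) * (θ₁ * x₁ (s * t) - θ₂ * x₂ (s * t)))) := by
      unfold reac; ring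
    rw [e1, Real.norm_eq_abs, abs_mul, abs_of_nonneg (pow_nonneg ht.1.le n)]
    refine (mul_le_of_le_one_left (abs_nonneg _) (pow_le_one₀ ht.1.le ht.2)).trans ?_
    refine (abs_add_le _ _).trans (add_le_add ((abs_add_le _ _).trans (add_le_add a1 ?_)) ?_)
    · rw [abs_mul, abs_of_pos hα]; gcongr
    · have hn : (0 : ℝ) ≤ n + 1 := by positivity
      rw [abs_neg, abs_mul, abs_of_nonneg hn]; gcongr
  rw [Real.norm_eq_abs] at h2
  simp only [sub_zero, abs_one, mul_one] at h2
  refine (add_le_add h1 h2).trans (le_of_eq ?_)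
  ring

theorem pow_mul_redFlux {x : ℝ → ℝ} (s : ℝ) :
    s ^ (n + 1) * redFlux n q α θ ε x s = θ * (s ^ (n + 1) * x s)
      + ∫ t in (0:ℝ)..s, t ^ n * (reac q α θ (trunc ε 1 (x t)) - θ * (n + 1) * x t) := by
  have h := intervalIntegral.smul_integral_comp_mul_left (a := 0) (b := 1)
    (fun t => t ^ n * (reac q α θ (trunc ε 1 (x t)) - θ * (n + 1) * x t)) s
  rw [mul_zero, mul_one] at h
  rw [← h, smul_eq_mul, redFlux, mul_add]
  congr 1
  · ring
  · rw [← intervalIntegral.integral_const_mul, ← intervalIntegral.integral_const_mul]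
    congr 1
    ext t
    ring

theorem nonneg_of_hasDerivAt {z z' : ℝ → ℝ} (hc : ContinuousOn z (Icc 0 R)) (h0 : 0 ≤ z 0)
    (hd : ∀ s ∈ Ioo 0 R, HasDerivAt z (z' s) s) (hz : ∀ s ∈ Ioo 0 R, z s < 0 → 0 ≤ z' s) :
    ∀ s ∈ Icc 0 R, 0 ≤ z s := by
  intro s₁ hs₁
  by_contra! hneg
  have hsub : Icc 0 s₁ ⊆ Icc 0 R := Icc_subset_Icc_right hs₁.2
  have hK : IsCompact (Icc 0 s₁ ∩ z ⁻¹' Ici 0) :=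
    isCompact_Icc.of_isClosed_subset
      ((hc.mono hsub).preimage_isClosed_of_isClosed isClosed_Icc isClosed_Ici) inter_subset_left
  obtain ⟨s₀, ⟨hs₀, hs₀'⟩, hmax⟩ := hK.exists_isGreatest ⟨0, ⟨le_rfl, hs₁.1⟩, h0⟩
  have hmono : MonotoneOn z (Icc s₀ s₁) := by
    refine monotoneOn_of_hasDerivWithinAt_nonneg (f' := z') (convex_Icc _ _)
      (hc.mono fun t ht => ⟨hs₀.1.trans ht.1, ht.2.trans hs₁.2⟩) ?_ ?_
    · intro t ht
      rw [interior_Icc] at ht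
      exact (hd t ⟨hs₀.1.trans_lt ht.1, ht.2.trans_le hs₁.2⟩).hasDerivWithinAt
    · intro t ht
      rw [interior_Icc] at ht
      refine hz t ⟨hs₀.1.trans_lt ht.1, ht.2.trans_le hs₁.2⟩ ?_
      by_contra! h
      exact absurd (hmax ⟨⟨hs₀.1.trans ht.1.le, ht.2.le⟩, h⟩) (not_le.2 ht.1)
  have := hmono ⟨le_rfl, hs₀.2⟩ ⟨hs₀.2, le_rfl⟩ hs₀.2
  have h2 : 0 ≤ z s₀ := hs₀'
  linarith
end

theorem hasDerivAt_integral_of_continuousOn {g : ℝ → ℝ} {R s : ℝ}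
    (hg : ContinuousOn g (Icc 0 R)) (hs : s ∈ Ioo 0 R) :
    HasDerivAt (fun s => ∫ t in (0:ℝ)..s, g t) (g s) s := by
  refine intervalIntegral.integral_hasDerivAt_right ?_ ?_ (hg.continuousAt (Icc_mem_nhds hs.1 hs.2))
  · exact ContinuousOn.intervalIntegrable (by
      rw [uIcc_of_le hs.1.le]; exact hg.mono (Icc_subset_Icc_right hs.2.le))
  · exact (hg.mono Ioo_subset_Icc_self).stronglyMeasurableAtFilter isOpen_Ioo s hs

theorem continuousOn_primitive {g : ℝ → ℝ} {R : ℝ} (hg : ContinuousOn g (Icc 0 R)) :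
    ContinuousOn (fun s => ∫ t in (0:ℝ)..s, g t) (Icc 0 R) := by
  rcases lt_or_ge R 0 with hR | hR
  · simp [Icc_eq_empty_of_lt hR]
  have := intervalIntegral.continuousOn_primitive_interval (μ := MeasureTheory.volume)
    (f := g) (a := 0) (b := R) (by rw [uIcc_of_le hR]; exact hg.integrableOn_Icc)
  rwa [uIcc_of_le hR] at this

theorem eq_zero_of_hasDerivAt_zero {z : ℝ → ℝ} {R : ℝ} (hc : ContinuousOn z (Icc 0 R))
    (h0 : z 0 = 0) (hd : ∀ s ∈ Ioo 0 R, HasDerivAt z 0 s) : ∀ s ∈ Icc 0 R, z s = 0 := by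
  intro s hs
  have h1 := nonneg_of_hasDerivAt hc h0.ge (z' := fun _ => 0) hd (fun _ _ _ => le_rfl) s hs
  have h2 := nonneg_of_hasDerivAt hc.neg (by simp [h0]) (z' := fun _ => -0)
    (fun s hs => (hd s hs).neg) (fun _ _ _ => by simp) s hs
  simp at h2
  linarith

theorem HasDerivAt.pow_mul_flux {y : ℝ → ℝ} {F s : ℝ} {n : ℕ} (hs : 0 < s)
    (hy : HasDerivAt y (F - n / s * y s) s) :
    HasDerivAt (fun s => s ^ n * y s) (s ^ n * F) s := by
  refine ((hasDerivAt_pow n s).mul hy).congr_deriv ?_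
  rcases n with _ | k
  · simp
  · push_cast
    field_simp
    ring

/-- A positive decreasing solution of the rescaled problem on `(0, S)`;
`y` is the flux `|x'|^{p-1}` and `m = 1/(p-1)`. -/
structure PosSol (n : ℕ) (m q α θ S : ℝ) (x y : ℝ → ℝ) : Prop where
  x_zero : x 0 = 1
  y_zero : y 0 = 0
  cont_x : ContinuousWithinAt x (Ici 0) 0
  cont_y : ContinuousWithinAt y (Ici 0) 0
  x_pos : ∀ s ∈ Ioo 0 S, 0 < x s
  y_pos : ∀ s ∈ Ioo 0 S, 0 < y s
  dx : ∀ s ∈ Ioo 0 S, HasDerivAt x (-(y s ^ m)) s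
  dy : ∀ s ∈ Ioo 0 S, HasDerivAt y (reac q α θ (x s) - θ * (s * y s ^ m) - n / s * y s) s

/-- Admissible truncation levels. -/
structure Admissible (n : ℕ) (m q α Θ ε c R : ℝ) : Prop where
  m_pos : 0 < m
  q_gt : 1 < q
  α_pos : 0 < α
  Θ_nonneg : 0 ≤ Θ
  ε_pos : 0 < ε
  ε_le : ε ≤ 1
  c_pos : 0 < c
  R_pos : 0 < R
  bound : (n + 1) * c + Θ * (R * (R * c) ^ m) ≤ ε ^ q

theorem exists_admissible (n : ℕ) {m q α Θ ε R : ℝ} (hm : 0 < m) (hq : 1 < q) (hα : 0 < α)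
    (hΘ : 0 ≤ Θ) (hε : 0 < ε) (hε1 : ε ≤ 1) (hR : 0 < R) :
    ∃ c, Admissible n m q α Θ ε c R := by
  have hcont : Continuous fun c : ℝ => (n + 1) * c + Θ * (R * (R * c) ^ m) := by
    have : Continuous fun c : ℝ => (R * c) ^ m :=
      (Real.continuous_rpow_const hm.le).comp (continuous_const.mul continuous_id)
    exact (by fun_prop : Continuous fun c : ℝ => (n + 1) * c).add
      (continuous_const.mul (continuous_const.mul this))
  have h0 : Tendsto (fun c : ℝ => (n + 1) * c + Θ * (R * (R * c) ^ m)) (𝓝[>] 0) (𝓝 0) := by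
    have := hcont.tendsto 0
    simp only [mul_zero, Real.zero_rpow hm.ne', add_zero] at this
    exact this.mono_left nhdsWithin_le_nhds
  have h1 : 0 < ε ^ q := Real.rpow_pos_of_pos hε _
  obtain ⟨c, hc, hc0⟩ := ((h0.eventually (ge_mem_nhds h1)).and self_mem_nhdsWithin).exists
  exact ⟨c, hm, hq, hα, hΘ, hε, hε1, hc0, hR, hc⟩

/-- A solution of the truncated integral equation. -/
structure FixSol (n : ℕ) (m q α θ ε c C R : ℝ) (x : ℝ → ℝ) : Prop where
  cont : ContinuousOn x (Icc 0 R)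
  eq : ∀ s ∈ Icc 0 R, x s = 1 + ∫ t in (0:ℝ)..s, slopeOp n m q α θ ε c C x t

section
variable {n : ℕ} {m q α θ Θ ε c C R S : ℝ} {x y : ℝ → ℝ}

theorem Admissible.le (h : Admissible n m q α Θ ε c R) : c ≤ 1 + Θ * α := by
  have h1 : ε ^ q ≤ 1 := Real.rpow_le_one h.ε_pos.le h.ε_le (by linarith [h.q_gt])
  have h2 : 0 ≤ Θ * (R * (R * c) ^ m) := by
    have := h.Θ_nonneg
    have := h.R_pos
    have := h.c_pos
    positivity
  have h3 : 0 ≤ Θ * α := mul_nonneg h.Θ_nonneg h.α_pos.le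
  have h4 : 0 ≤ (n : ℝ) * c := mul_nonneg (Nat.cast_nonneg _) h.c_pos.le
  linarith [h.bound]

/-- The barrier inequality keeping the flux away from the lower truncation. -/
theorem Admissible.barrier (h : Admissible n m q α Θ ε c R) (hθ : θ ∈ Icc 0 Θ) {s r v : ℝ}
    (hs : s ∈ Ioo 0 R) (hr : ε ^ q ≤ r) (hv : v ≤ (s * c) ^ m) (hv0 : 0 ≤ v) :
    0 ≤ r - θ * (s * v) - (n + 1) * c := by
  have h1 : θ * (s * v) ≤ Θ * (R * (R * c) ^ m) := by
    have h0 := h.c_pos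
    have h2 := hs.2.le
    have h3 := hs.1.le
    have h4 := hθ.2
    have h5 := h.Θ_nonneg
    have h6 := h.m_pos.le
    have h8 := h.R_pos.le
    have h7 : v ≤ (R * c) ^ m := hv.trans (by gcongr)
    gcongr
  linarith [h.bound]

theorem FixSol.hasDerivAt (hA : Admissible n m q α Θ ε c R) (h : FixSol n m q α θ ε c C R x)
    {s : ℝ} (hs : s ∈ Ioo 0 R) : HasDerivAt x (slopeOp n m q α θ ε c C x s) s := by
  have h1 := (hasDerivAt_integral_of_continuousOn
    (continuousOn_slopeOp (n := n) (α := α) (θ := θ) (ε := ε) (c := c) (C := C)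
      hA.m_pos hA.q_gt h.cont) hs).const_add 1
  refine h1.congr_of_eventuallyEq ?_
  filter_upwards [Icc_mem_nhds hs.1 hs.2] with t ht using h.eq t ht

theorem continuousOn_reacInt (hq : 1 < q) (hx : ContinuousOn x (Icc 0 R)) :
    ContinuousOn (fun t : ℝ => t ^ n * (reac q α θ (trunc ε 1 (x t)) - θ * (n + 1) * x t))
      (Icc 0 R) := by
  have h1 := continuous_reac (q := q) (α := α) (θ := θ) (by linarith)
  exact (continuous_pow n).continuousOn.mul ((h1.comp_continuousOn
    ((continuous_trunc ε 1).comp_continuousOn hx)).sub (continuousOn_const.mul hx))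

theorem hasDerivAt_pow_mul_redFlux (hq : 1 < q) (hx : ContinuousOn x (Icc 0 R)) {s v : ℝ}
    (hs : s ∈ Ioo 0 R) (hd : HasDerivAt x (-v) s) :
    HasDerivAt (fun s => s ^ (n + 1) * redFlux n q α θ ε x s)
      (s ^ n * (reac q α θ (trunc ε 1 (x s)) - θ * (s * v))) s := by
  have h1 := (((hasDerivAt_pow (n + 1) s).mul hd).const_mul θ).add
    (hasDerivAt_integral_of_continuousOn (continuousOn_reacInt (n := n) (α := α) (θ := θ)
      (ε := ε) hq hx) hs)
  refine (h1.congr_of_eventuallyEq (Eventually.of_forall fun t => pow_mul_redFlux t)).congr_deriv ?_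
  push_cast
  ring

theorem FixSol.redFlux_mem (hA : Admissible n m q α Θ ε c R) (hθ : θ ∈ Icc 0 Θ)
    (h : FixSol n m q α θ ε c (1 + Θ * α) R x) {s : ℝ} (hs : s ∈ Ioc 0 R) :
    redFlux n q α θ ε x s ∈ Icc c (1 + Θ * α) := by
  have hcont : ContinuousOn (fun s => s ^ (n + 1) * redFlux n q α θ ε x s) (Icc 0 R) :=
    (continuous_pow _).continuousOn.mul (continuousOn_redFlux hA.q_gt h.cont)
  have hcp : ∀ a : ℝ, ContinuousOn (fun s : ℝ => a * s ^ (n + 1)) (Icc 0 R) := fun a => by fun_prop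
  have hdp : ∀ a s : ℝ, HasDerivAt (fun s : ℝ => a * s ^ (n + 1)) (s ^ n * (a * (n + 1))) s :=
    fun a s => ((hasDerivAt_pow (n + 1) s).const_mul a).congr_deriv (by push_cast; ring)
  have hd := fun s (hs : s ∈ Ioo 0 R) =>
    hasDerivAt_pow_mul_redFlux (n := n) (α := α) (θ := θ) (ε := ε) hA.q_gt h.cont hs
      (h.hasDerivAt hA hs)
  have hr : ∀ s, reac q α θ (trunc ε 1 (x s)) ∈ Icc (ε ^ q) (1 + Θ * α) := fun s =>
    reac_mem hA.q_gt hA.α_pos hθ hA.ε_pos (trunc_mem hA.ε_le _)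
  have hT : ∀ s, 0 < trunc c (1 + Θ * α) (redFlux n q α θ ε x s) := fun s =>
    hA.c_pos.trans_le (trunc_mem hA.le _).1
  have hpos : 0 < s ^ (n + 1) := pow_pos hs.1 _
  constructor
  · have := nonneg_of_hasDerivAt (hcont.sub (hcp c)) (by simp)
      (fun s hs => (hd s hs).sub (hdp c s)) (fun s hs hz => ?_) s ⟨hs.1.le, hs.2⟩
    · simp only [Pi.sub_apply] at this
      exact le_of_mul_le_mul_left (by linarith) hpos
    · rw [← mul_sub]
      have hp : 0 < s ^ (n + 1) := pow_pos hs.1 _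
      have hlt : redFlux n q α θ ε x s < c := by
        simp only [Pi.sub_apply] at hz
        exact lt_of_mul_lt_mul_left (by linarith) hp.le
      have ht : trunc c (1 + Θ * α) (redFlux n q α θ ε x s) = c := by
        rw [trunc, max_eq_left]; exact (min_le_right _ _).trans hlt.le
      rw [ht]
      refine mul_nonneg (pow_nonneg hs.1.le _) ?_
      rw [mul_comm c]
      exact hA.barrier hθ hs (hr s).1
        (by rw [Real.mul_rpow hs.1.le hA.c_pos.le]) (by have := hs.1; have := hA.c_pos; positivity)
  · have := nonneg_of_hasDerivAt ((hcp (1 + Θ * α)).sub hcont) (by simp)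
      (fun s hs => (hdp (1 + Θ * α) s).sub (hd s hs)) (fun s hs hz => ?_) s ⟨hs.1.le, hs.2⟩
    · simp only [Pi.sub_apply] at this
      exact le_of_mul_le_mul_left (by linarith) hpos
    · rw [← mul_sub]
      refine mul_nonneg (pow_nonneg hs.1.le _) ?_
      have h1 : 0 ≤ θ * (s * (s ^ m * trunc c (1 + Θ * α) (redFlux n q α θ ε x s) ^ m)) := by
        have := hθ.1
        have := hs.1
        have := hT s
        positivity
      have h2 : 0 ≤ (1 + Θ * α) * n := by
        have := hA.Θ_nonneg
        have := hA.α_pos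
        positivity
      linarith [(hr s).2]

theorem FixSol.slope_eq (hA : Admissible n m q α Θ ε c R) (hθ : θ ∈ Icc 0 Θ)
    (h : FixSol n m q α θ ε c (1 + Θ * α) R x) {s : ℝ} (hs : s ∈ Ioo 0 R) :
    slopeOp n m q α θ ε c (1 + Θ * α) x s = -((s * redFlux n q α θ ε x s) ^ m) := by
  have hu := h.redFlux_mem hA hθ ⟨hs.1, hs.2.le⟩
  rw [slopeOp, trunc_of_mem hu, Real.mul_rpow hs.1.le (hA.c_pos.le.trans hu.1)]

/-- Solutions of the truncated equation are genuine solutions while they stay above `ε`. -/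
theorem FixSol.posSol (hA : Admissible n m q α Θ ε c R) (hθ : θ ∈ Icc 0 Θ)
    (h : FixSol n m q α θ ε c (1 + Θ * α) R x) (hS0 : 0 < S) (hS : S ≤ R)
    (hx : ∀ s ∈ Ioo 0 S, ε ≤ x s) :
    PosSol n m q α θ S x (fun s => s * redFlux n q α θ ε x s) := by
  have h0 : (0 : ℝ) ∈ Icc 0 R := ⟨le_rfl, hA.R_pos.le⟩
  have hI : Icc 0 R ∈ 𝓝[≥] (0 : ℝ) := Icc_mem_nhdsGE hA.R_pos
  have hsub : ∀ s ∈ Ioo 0 S, s ∈ Ioo 0 R := fun s hs => ⟨hs.1, hs.2.trans_le hS⟩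
  have hdx : ∀ s ∈ Ioo 0 S, HasDerivAt x (-((s * redFlux n q α θ ε x s) ^ m)) s := fun s hs => by
    rw [← h.slope_eq hA hθ (hsub s hs)]; exact h.hasDerivAt hA (hsub s hs)
  have hcy : ContinuousOn (fun s => s * redFlux n q α θ ε x s) (Icc 0 R) :=
    continuousOn_id.mul (continuousOn_redFlux hA.q_gt h.cont)
  have hx0 : x 0 = 1 := by rw [h.eq 0 h0]; simp
  have hanti : AntitoneOn x (Ico 0 S) := by
    refine antitoneOn_of_hasDerivWithinAt_nonpos (convex_Ico _ _)
      (h.cont.mono fun s hs => ⟨hs.1, hs.2.le.trans hS⟩)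
      (f' := fun s => -((s * redFlux n q α θ ε x s) ^ m)) ?_ ?_
    · intro s hs
      rw [interior_Ico] at hs
      exact (hdx s hs).hasDerivWithinAt
    · intro s hs
      rw [interior_Ico] at hs
      have hu := h.redFlux_mem hA hθ ⟨hs.1, (hsub s hs).2.le⟩
      have : 0 < s * redFlux n q α θ ε x s := mul_pos hs.1 (hA.c_pos.trans_le hu.1)
      exact neg_nonpos.2 (by positivity)
  refine ⟨hx0, by simp, (h.cont 0 h0).mono_of_mem_nhdsWithin hI,
    (hcy 0 h0).mono_of_mem_nhdsWithin hI, fun s hs => hA.ε_pos.trans_le (hx s hs), ?_, hdx, ?_⟩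
  · intro s hs
    have hu := h.redFlux_mem hA hθ ⟨hs.1, (hsub s hs).2.le⟩
    exact mul_pos hs.1 (hA.c_pos.trans_le hu.1)
  · intro s hs
    have hP := hasDerivAt_pow_mul_redFlux (n := n) (α := α) (θ := θ) (ε := ε) hA.q_gt h.cont
      (hsub s hs) (hdx s hs)
    have hx1 : x s ≤ 1 := hx0 ▸ hanti ⟨le_rfl, hS0⟩ ⟨hs.1.le, hs.2⟩ hs.1.le
    rw [trunc_of_mem ⟨hx s hs, hx1⟩] at hP
    have hi : HasDerivAt (fun s : ℝ => (s ^ n)⁻¹) (-(n * s ^ (n - 1)) / (s ^ n) ^ 2) s :=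
      (hasDerivAt_pow n s).inv (pow_pos hs.1 n).ne'
    have hs0 := hs.1.ne'
    refine ((hi.mul hP).congr_of_eventuallyEq ?_).congr_deriv ?_
    · filter_upwards [lt_mem_nhds hs.1] with t ht
      have := ht.ne'
      simp only [Pi.mul_apply]
      field_simp
      ring
    · rcases n with _ | k
      · simp
      · push_cast
        field_simp
        ring
theorem PosSol.continuousOn_x (h : PosSol n m q α θ S x y) : ContinuousOn x (Ico 0 S) := by
  intro s hs
  rcases hs.1.eq_or_lt with rfl | h0
  · exact h.cont_x.mono Ico_subset_Ici_self
  · exact (h.dx s ⟨h0, hs.2⟩).continuousAt.continuousWithinAt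

theorem PosSol.continuousOn_y (h : PosSol n m q α θ S x y) : ContinuousOn y (Ico 0 S) := by
  intro s hs
  rcases hs.1.eq_or_lt with rfl | h0
  · exact h.cont_y.mono Ico_subset_Ici_self
  · exact (h.dy s ⟨h0, hs.2⟩).continuousAt.continuousWithinAt

theorem PosSol.antitoneOn (h : PosSol n m q α θ S x y) : AntitoneOn x (Ico 0 S) := by
  refine antitoneOn_of_hasDerivWithinAt_nonpos (convex_Ico _ _) h.continuousOn_x
    (f' := fun s => -(y s ^ m)) (fun s hs => ?_) (fun s hs => ?_) <;> rw [interior_Ico] at hs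
  · exact (h.dx s hs).hasDerivWithinAt
  · exact neg_nonpos.2 (Real.rpow_nonneg (h.y_pos s hs).le _)

theorem PosSol.x_le_one (h : PosSol n m q α θ S x y) {s : ℝ} (hs : s ∈ Ico 0 S) : x s ≤ 1 :=
  h.x_zero ▸ h.antitoneOn ⟨le_rfl, hs.1.trans_lt hs.2⟩ hs hs.1

theorem PosSol.hasDerivAt_pow_mul (h : PosSol n m q α θ S x y) {s : ℝ} (hs : s ∈ Ioo 0 S) :
    HasDerivAt (fun s => s ^ n * y s) (s ^ n * (reac q α θ (x s) - θ * (s * y s ^ m))) s :=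
  (h.dy s hs).pow_mul_flux hs.1

theorem PosSol.mono (h : PosSol n m q α θ S x y) {T : ℝ} (hT : T ≤ S) :
    PosSol n m q α θ T x y :=
  ⟨h.x_zero, h.y_zero, h.cont_x, h.cont_y, fun s hs => h.x_pos s ⟨hs.1, hs.2.trans_le hT⟩,
    fun s hs => h.y_pos s ⟨hs.1, hs.2.trans_le hT⟩, fun s hs => h.dx s ⟨hs.1, hs.2.trans_le hT⟩,
    fun s hs => h.dy s ⟨hs.1, hs.2.trans_le hT⟩⟩

/-- Genuine solutions solve the truncated equation while they stay above `ε`. -/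
theorem PosSol.fixSol (h : PosSol n m q α θ S x y) (hA : Admissible n m q α Θ ε c R)
    (hθ : θ ∈ Icc 0 Θ) (hRS : R < S) (hε : ε ≤ x R) :
    FixSol n m q α θ ε c (1 + Θ * α) R x ∧
      ∀ s ∈ Icc 0 R, y s = s * redFlux n q α θ ε x s := by
  have hsub : Icc 0 R ⊆ Ico 0 S := fun s hs => ⟨hs.1, hs.2.trans_lt hRS⟩
  have hsub' : ∀ s ∈ Ioo 0 R, s ∈ Ioo 0 S := fun s hs => ⟨hs.1, hs.2.trans hRS⟩
  have hcx := h.continuousOn_x.mono hsub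
  have hcy := h.continuousOn_y.mono hsub
  have hR := hA.R_pos
  have hmem : ∀ s ∈ Icc 0 R, x s ∈ Icc ε 1 := fun s hs =>
    ⟨hε.trans (h.antitoneOn (hsub hs) ⟨hR.le, hRS⟩ hs.2), h.x_le_one (hsub hs)⟩
  have hcV : ContinuousOn (fun s => s ^ n * y s) (Icc 0 R) :=
    (continuous_pow n).continuousOn.mul hcy
  have hV0 : (fun s => s ^ n * y s) 0 = 0 := by simp [h.y_zero]
  have hVW : ∀ s ∈ Icc 0 R, s ^ n * y s - s ^ (n + 1) * redFlux n q α θ ε x s = 0 := by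
    refine eq_zero_of_hasDerivAt_zero (hcV.sub ((continuous_pow _).continuousOn.mul
      (continuousOn_redFlux hA.q_gt hcx))) (by simp [h.y_zero]) fun s hs => ?_
    refine ((h.hasDerivAt_pow_mul (hsub' s hs)).sub (hasDerivAt_pow_mul_redFlux (n := n) (α := α)
      (θ := θ) (ε := ε) hA.q_gt hcx hs (h.dx s (hsub' s hs)))).congr_deriv ?_
    rw [trunc_of_mem (hmem s ⟨hs.1.le, hs.2.le⟩), sub_self]
  have hy : ∀ s ∈ Icc 0 R, y s = s * redFlux n q α θ ε x s := fun s hs => by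
    rcases hs.1.eq_or_lt with rfl | h0
    · simp [h.y_zero]
    · have h1 := hVW s hs
      have h2 : s ^ n * (y s - s * redFlux n q α θ ε x s) = 0 := by rw [← h1]; ring
      have h3 := (mul_eq_zero.1 h2).resolve_left (pow_pos h0 n).ne'
      linarith
  have hcp : ∀ a : ℝ, ContinuousOn (fun s : ℝ => a * s ^ (n + 1)) (Icc 0 R) := fun a => by fun_prop
  have hdp : ∀ a s : ℝ, HasDerivAt (fun s : ℝ => a * s ^ (n + 1)) (s ^ n * (a * (n + 1))) s :=
    fun a s => ((hasDerivAt_pow (n + 1) s).const_mul a).congr_deriv (by push_cast; ring)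
  have hr : ∀ s ∈ Ioo 0 R, reac q α θ (x s) ∈ Icc (ε ^ q) (1 + Θ * α) := fun s hs =>
    reac_mem hA.q_gt hA.α_pos hθ hA.ε_pos (hmem s ⟨hs.1.le, hs.2.le⟩)
  have hlow : ∀ s ∈ Icc 0 R, 0 ≤ s ^ n * y s - c * s ^ (n + 1) := by
    refine nonneg_of_hasDerivAt (hcV.sub (hcp c)) (by simp [h.y_zero])
      (fun s hs => (h.hasDerivAt_pow_mul (hsub' s hs)).sub (hdp c s)) (fun s hs hz => ?_)
    rw [← mul_sub]
    have hlt : y s < s * c := by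
      have : s ^ n * y s < s ^ n * (s * c) := by
        linarith [pow_succ s n, mul_comm c (s ^ (n + 1)), mul_assoc (s ^ n) s c,
          congrArg (· * c) (pow_succ s n)]
      exact lt_of_mul_lt_mul_left this (pow_nonneg hs.1.le _)
    have hy0 := (h.y_pos s (hsub' s hs)).le
    refine mul_nonneg (pow_nonneg hs.1.le _) ?_
    rw [mul_comm c]
    exact hA.barrier hθ hs (hr s hs).1 (Real.rpow_le_rpow hy0 hlt.le hA.m_pos.le)
      (Real.rpow_nonneg hy0 _)
  have hup : ∀ s ∈ Icc 0 R, 0 ≤ (1 + Θ * α) * s ^ (n + 1) - s ^ n * y s := by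
    refine nonneg_of_hasDerivAt ((hcp _).sub hcV) (by simp [h.y_zero])
      (fun s hs => (hdp _ s).sub (h.hasDerivAt_pow_mul (hsub' s hs))) (fun s hs _ => ?_)
    rw [← mul_sub]
    refine mul_nonneg (pow_nonneg hs.1.le _) ?_
    have h1 : 0 ≤ θ * (s * y s ^ m) := by
      have := hθ.1
      have := hs.1
      have := h.y_pos s (hsub' s hs)
      positivity
    have h2 : 0 ≤ (1 + Θ * α) * n := by
      have := hA.Θ_nonneg
      have := hA.α_pos
      positivity
    linarith [(hr s hs).2]
  have hu : ∀ s ∈ Ioo 0 R, redFlux n q α θ ε x s ∈ Icc c (1 + Θ * α) := fun s hs => by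
    have hs' := Ioo_subset_Icc_self hs
    have h0 := hVW s hs'
    have h1 := hlow s hs'
    have h2 := hup s hs'
    have hp : 0 < s ^ (n + 1) := pow_pos hs.1 _
    constructor
    · exact le_of_mul_le_mul_left (by linarith) hp
    · exact le_of_mul_le_mul_left (by linarith) hp
  refine ⟨⟨hcx, fun s hs => ?_⟩, hy⟩
  have hcs := continuousOn_slopeOp (n := n) (α := α) (θ := θ) (ε := ε) (c := c) (C := 1 + Θ * α)
    hA.m_pos hA.q_gt hcx
  have := eq_zero_of_hasDerivAt_zero (hcx.sub ((continuousOn_const (c := (1 : ℝ))).add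
    (continuousOn_primitive hcs))) (by simp [h.x_zero]) (fun s hs => ?_) s hs
  · simp only [Pi.sub_apply, Pi.add_apply] at this
    linarith
  · refine ((h.dx s (hsub' s hs)).sub
      ((hasDerivAt_integral_of_continuousOn hcs hs).const_add 1)).congr_deriv ?_
    rw [slopeOp, trunc_of_mem (hu s hs), hy s (Ioo_subset_Icc_self hs),
      Real.mul_rpow hs.1.le (hA.c_pos.le.trans (hu s hs).1)]
    ring

theorem abs_slopeOp_sub_le (hm : 0 < m) {B : ℝ} (hB0 : 0 ≤ B) (hcC : c ≤ C)
    (hB : ∀ u ∈ Icc c C, ∀ v ∈ Icc c C, |u ^ m - v ^ m| ≤ B * |u - v|) {θ₁ θ₂ : ℝ}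
    {x₁ x₂ : ℝ → ℝ} {s K : ℝ} (hs : s ∈ Icc 0 R)
    (hK : |redFlux n q α θ₁ ε x₁ s - redFlux n q α θ₂ ε x₂ s| ≤ K) :
    |slopeOp n m q α θ₁ ε c C x₁ s - slopeOp n m q α θ₂ ε c C x₂ s| ≤ R ^ m * (B * K) := by
  have h1 : s ^ m ≤ R ^ m := Real.rpow_le_rpow hs.1 hs.2 hm.le
  have h0 : 0 ≤ s ^ m := Real.rpow_nonneg hs.1 _
  have h2 := (hB _ (trunc_mem hcC (redFlux n q α θ₁ ε x₁ s)) _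
    (trunc_mem hcC (redFlux n q α θ₂ ε x₂ s)))
  have h3 := (abs_trunc_sub_le c C (redFlux n q α θ₁ ε x₁ s) (redFlux n q α θ₂ ε x₂ s)).trans hK
  have h4 := h2.trans (mul_le_mul_of_nonneg_left h3 hB0)
  have : slopeOp n m q α θ₁ ε c C x₁ s - slopeOp n m q α θ₂ ε c C x₂ s
      = -(s ^ m * (trunc c C (redFlux n q α θ₁ ε x₁ s) ^ m
        - trunc c C (redFlux n q α θ₂ ε x₂ s) ^ m)) := by
    unfold slopeOp; ring
  rw [this, abs_neg, abs_mul, abs_of_nonneg h0]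
  exact mul_le_mul h1 h4 (abs_nonneg _) (h0.trans h1)

theorem exists_fixSol (hA : Admissible n m q α Θ ε c R) (hθ : θ ∈ Icc 0 Θ) :
    ∃ x, FixSol n m q α θ ε c (1 + Θ * α) R x := by
  obtain ⟨B, hB0, hB⟩ := exists_rpow_lipschitz (c := c) (C := 1 + Θ * α) m hA.c_pos
  have hR := hA.R_pos.le
  have hΘ := hA.Θ_nonneg
  have hα := hA.α_pos.le
  have hq := hA.q_gt
  have hK : ∀ x₁ x₂, ContinuousOn x₁ (Icc 0 R) → ContinuousOn x₂ (Icc 0 R) →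
      ∀ s ∈ Icc 0 R, ∀ M, (∀ t ∈ Icc 0 s, |x₁ t - x₂ t| ≤ M) →
      |slopeOp n m q α θ ε c (1 + Θ * α) x₁ s - slopeOp n m q α θ ε c (1 + Θ * α) x₂ s|
        ≤ R ^ m * (B * (Θ + q + Θ * α + Θ * (n + 1))) * M := by
    intro x₁ x₂ hx₁ hx₂ s hs M hM
    obtain ⟨D, hD⟩ := isCompact_Icc.exists_bound_of_continuousOn hx₂
    have h1 := redFlux_sub_le (n := n) hq hA.α_pos hA.ε_pos hA.ε_le hθ (θ₂ := θ) hx₁ hx₂ hs hM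
      (fun t ht => hD t ⟨ht.1, ht.2.trans hs.2⟩)
    rw [sub_self, abs_zero, mul_zero, add_zero] at h1
    rw [mul_assoc, mul_assoc]
    exact abs_slopeOp_sub_le hA.m_pos hB0 hA.le hB hs h1
  obtain ⟨x, hx, he⟩ := volterra_exists hR (by positivity) (slopeOp n m q α θ ε c (1 + Θ * α))
    (fun x hx => continuousOn_slopeOp hA.m_pos hq hx) hK
  exact ⟨x, hx, he⟩

/-- Lipschitz dependence of the truncated solutions on the parameter. -/
theorem FixSol.dependence (hA : Admissible n m q α Θ ε c R) {θ₀ : ℝ} {x₀ : ℝ → ℝ}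
    (h₀ : FixSol n m q α θ₀ ε c (1 + Θ * α) R x₀) :
    ∃ B, ∀ θ ∈ Icc 0 Θ, ∀ x, FixSol n m q α θ ε c (1 + Θ * α) R x → ∀ s ∈ Icc 0 R,
      |x s - x₀ s| ≤ B * |θ - θ₀| ∧
      |s * redFlux n q α θ ε x s - s * redFlux n q α θ₀ ε x₀ s| ≤ B * |θ - θ₀| := by
  obtain ⟨B, hB0, hB⟩ := exists_rpow_lipschitz (c := c) (C := 1 + Θ * α) m hA.c_pos
  have hR := hA.R_pos.le
  have hΘ := hA.Θ_nonneg
  have hα := hA.α_pos.le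
  have hq := hA.q_gt
  obtain ⟨D, hD⟩ := isCompact_Icc.exists_bound_of_continuousOn h₀.cont
  have hD0 : 0 ≤ D := (norm_nonneg _).trans (hD 0 ⟨le_rfl, hR⟩)
  set L := Θ + q + Θ * α + Θ * (n + 1) with hL
  set E := D + α + (n + 1) * D with hE
  have hL0 : 0 ≤ L := by positivity
  have hE0 : 0 ≤ E := by positivity
  set G := R ^ m * (B * L) with hG
  have hG0 : 0 ≤ G := by positivity
  have hRm : 0 ≤ R ^ m := by positivity
  set B₁ := 2 * (R ^ m * (B * E)) * R * Real.exp ((2 * G + 1) * R) with hB₁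
  have hB₁0 : 0 ≤ B₁ := by positivity
  refine ⟨max B₁ (R * (L * B₁ + E)), fun θ hθ x hx s hs => ?_⟩
  have key : ∀ s ∈ Icc 0 R, ∀ M, (∀ t ∈ Icc 0 s, |x t - x₀ t| ≤ M) →
      |redFlux n q α θ ε x s - redFlux n q α θ₀ ε x₀ s| ≤ L * M + E * |θ - θ₀| :=
    fun s hs M hM => redFlux_sub_le hq hA.α_pos hA.ε_pos hA.ε_le hθ hx.cont h₀.cont hs hM
      (fun t ht => hD t ⟨ht.1, ht.2.trans hs.2⟩)
  have h1 : ∀ s ∈ Icc 0 R, |x s - x₀ s| ≤ B₁ * |θ - θ₀| := by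
    have := volterra_dependence (R := R) (B := G) (e := R ^ m * (B * (E * |θ - θ₀|))) hR hG0
      (by positivity) hx.cont h₀.cont
      (continuousOn_slopeOp (n := n) (α := α) (θ := θ) (ε := ε) (c := c) (C := 1 + Θ * α)
        hA.m_pos hq hx.cont)
      (continuousOn_slopeOp (n := n) (α := α) (θ := θ₀) (ε := ε) (c := c) (C := 1 + Θ * α)
        hA.m_pos hq h₀.cont) hx.eq h₀.eq
      (fun s hs M hM => (abs_slopeOp_sub_le hA.m_pos hB0 hA.le hB hs (key s hs M hM)).trans
        (by rw [hG]; exact le_of_eq (by ring)))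
    intro s hs
    refine (this s hs).trans (le_of_eq ?_)
    rw [hB₁]; ring
  refine ⟨(h1 s hs).trans (mul_le_mul_of_nonneg_right (le_max_left _ _) (abs_nonneg _)), ?_⟩
  refine le_trans ?_ (mul_le_mul_of_nonneg_right (le_max_right _ _) (abs_nonneg _))
  rw [← mul_sub, abs_mul, abs_of_nonneg hs.1]
  have h2 := key s hs (B₁ * |θ - θ₀|) (fun t ht => h1 t ⟨ht.1, ht.2.trans hs.2⟩)
  calc s * |redFlux n q α θ ε x s - redFlux n q α θ₀ ε x₀ s|
      ≤ R * (L * (B₁ * |θ - θ₀|) + E * |θ - θ₀|) :=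
        mul_le_mul hs.2 h2 (abs_nonneg _) hR
    _ = _ := by ring

theorem Admissible.mono (h : Admissible n m q α Θ ε c R) {R' : ℝ} (h0 : 0 < R') (hR : R' ≤ R) :
    Admissible n m q α Θ ε c R' := by
  refine ⟨h.m_pos, h.q_gt, h.α_pos, h.Θ_nonneg, h.ε_pos, h.ε_le, h.c_pos, h0, ?_⟩
  have h1 := h.Θ_nonneg
  have h2 := h.c_pos
  have h3 := h.m_pos
  have h4 := h.R_pos
  have : Θ * (R' * (R' * c) ^ m) ≤ Θ * (R * (R * c) ^ m) := by gcongr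
  linarith [h.bound]

theorem FixSol.mono (h : FixSol n m q α θ ε c C R x) {R' : ℝ} (hR : R' ≤ R) :
    FixSol n m q α θ ε c C R' x :=
  ⟨h.cont.mono (Icc_subset_Icc_right hR), fun s hs => h.eq s ⟨hs.1, hs.2.trans hR⟩⟩

theorem FixSol.unique (hA : Admissible n m q α Θ ε c R) (hθ : θ ∈ Icc 0 Θ) {x' : ℝ → ℝ}
    (h : FixSol n m q α θ ε c (1 + Θ * α) R x) (h' : FixSol n m q α θ ε c (1 + Θ * α) R x') :
    ∀ s ∈ Icc 0 R, x s = x' s ∧ s * redFlux n q α θ ε x s = s * redFlux n q α θ ε x' s := by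
  intro s hs
  obtain ⟨B, hB⟩ := h'.dependence hA
  have := hB θ hθ x h s hs
  rw [sub_self, abs_zero, mul_zero] at this
  exact ⟨sub_eq_zero.1 (abs_nonpos_iff.1 this.1), sub_eq_zero.1 (abs_nonpos_iff.1 this.2)⟩

theorem PosSol.unique (hm : 0 < m) (hq : 1 < q) (hα : 0 < α) (hθ : 0 ≤ θ) {S' : ℝ}
    {x' y' : ℝ → ℝ} (h : PosSol n m q α θ S x y) (h' : PosSol n m q α θ S' x' y') {s : ℝ}
    (hs0 : 0 ≤ s) (hs : s < S) (hs' : s < S') : x s = x' s ∧ y s = y' s := by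
  obtain ⟨R, hsR, hR⟩ := exists_between (lt_min hs hs')
  have hR0 : 0 < R := hs0.trans_lt hsR
  have hRS : R < S := hR.trans_le (min_le_left _ _)
  have hRS' : R < S' := hR.trans_le (min_le_right _ _)
  have hx1 := h.x_le_one ⟨hR0.le, hRS⟩
  have hε : 0 < min (x R) (x' R) := lt_min (h.x_pos R ⟨hR0, hRS⟩) (h'.x_pos R ⟨hR0, hRS'⟩)
  obtain ⟨c, hA⟩ := exists_admissible n hm hq hα hθ hε ((min_le_left _ _).trans hx1) hR0
  have hθ' : θ ∈ Icc 0 θ := ⟨hθ, le_rfl⟩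
  obtain ⟨f, hy⟩ := h.fixSol hA hθ' hRS (min_le_left _ _)
  obtain ⟨f', hy'⟩ := h'.fixSol hA hθ' hRS' (min_le_right _ _)
  have := FixSol.unique hA hθ' f f' s ⟨hs0, hsR.le⟩
  rw [hy s ⟨hs0, hsR.le⟩, hy' s ⟨hs0, hsR.le⟩]
  exact this

theorem PosSol.stable (hm : 0 < m) (hq : 1 < q) (hα : 0 < α) (hθ : 0 ≤ θ)
    (h : PosSol n m q α θ S x y) {s₀ : ℝ} (hs : s₀ ∈ Ioo 0 S) {U : Set (ℝ × ℝ × ℝ)}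
    (hU : U ∈ 𝓝 (θ, x s₀, y s₀)) :
    ∀ᶠ ϑ in 𝓝[Ici 0] θ, ∃ S' > s₀, ∃ X Y, PosSol n m q α ϑ S' X Y ∧ (ϑ, X s₀, Y s₀) ∈ U := by
  obtain ⟨R, hsR, hRS⟩ := exists_between hs.2
  have hR0 : 0 < R := hs.1.trans hsR
  have hxR := h.x_pos R ⟨hR0, hRS⟩
  have hx1 := h.x_le_one ⟨hR0.le, hRS⟩
  have hε : 0 < x R / 2 := by positivity
  obtain ⟨c, hA⟩ := exists_admissible n hm hq hα (Θ := θ + 1) (by linarith) hε (by linarith) hR0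
  obtain ⟨f, hy⟩ := h.fixSol hA ⟨hθ, by linarith⟩ hRS (by linarith)
  obtain ⟨B, hB⟩ := f.dependence hA
  obtain ⟨r, hr, hrU⟩ := Metric.mem_nhds_iff.1 hU
  have ht : Tendsto (fun ϑ => (|B| + 1) * |ϑ - θ|) (𝓝[Ici 0] θ) (𝓝 0) := by
    have : Continuous fun ϑ => (|B| + 1) * |ϑ - θ| := by fun_prop
    have := this.tendsto θ
    simp only [sub_self, abs_zero, mul_zero] at this
    exact this.mono_left nhdsWithin_le_nhds
  have ht1 : ∀ᶠ ϑ in 𝓝[Ici 0] θ, ϑ < θ + 1 :=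
    (eventually_lt_nhds (by linarith)).filter_mono nhdsWithin_le_nhds
  filter_upwards [ht.eventually_lt_const hr, ht.eventually_lt_const hε, ht1,
    self_mem_nhdsWithin] with ϑ h1 h2 h3 h4
  have hϑ : ϑ ∈ Icc 0 (θ + 1) := ⟨h4, h3.le⟩
  have hle1 : B * |ϑ - θ| ≤ (|B| + 1) * |ϑ - θ| :=
    mul_le_mul_of_nonneg_right (by linarith [le_abs_self B]) (abs_nonneg _)
  have hle2 : |ϑ - θ| ≤ (|B| + 1) * |ϑ - θ| :=
    le_mul_of_one_le_left (abs_nonneg _) (by linarith [abs_nonneg B])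
  obtain ⟨X, hX⟩ := exists_fixSol hA hϑ
  have hd := hB ϑ hϑ X hX
  refine ⟨R, hsR, X, _, hX.posSol hA hϑ hR0 le_rfl fun s hs => ?_, hrU ?_⟩
  · have h5 := (abs_le.1 (hd s ⟨hs.1.le, hs.2.le⟩).1).1
    have h6 := h.antitoneOn ⟨hs.1.le, hs.2.trans hRS⟩ ⟨hR0.le, hRS⟩ hs.2.le
    linarith
  · have h5 := hd s₀ ⟨hs.1.le, hsR.le⟩
    rw [Metric.mem_ball, Prod.dist_eq, Prod.dist_eq]
    simp only [Real.dist_eq]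
    rw [hy s₀ ⟨hs.1.le, hsR.le⟩]
    exact max_lt (by linarith) (max_lt (by linarith [h5.1]) (by linarith [h5.2]))

theorem exists_posSol (n : ℕ) (hm : 0 < m) (hq : 1 < q) (hα : 0 < α) (hθ : 0 ≤ θ) :
    ∃ S > 0, ∃ x y, PosSol n m q α θ S x y := by
  obtain ⟨c, hA⟩ := exists_admissible n hm hq hα hθ (ε := 1 / 2) (by norm_num) (by norm_num)
    one_pos
  have hθ' : θ ∈ Icc 0 θ := ⟨hθ, le_rfl⟩
  obtain ⟨X, hX⟩ := exists_fixSol hA hθ'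
  have h0 : X 0 = 1 := by rw [hX.eq 0 ⟨le_rfl, zero_le_one⟩]; simp
  have hc : ContinuousWithinAt X (Ici 0) 0 :=
    (hX.cont 0 ⟨le_rfl, zero_le_one⟩).mono_of_mem_nhdsWithin (Icc_mem_nhdsGE one_pos)
  have : ∀ᶠ s in 𝓝[≥] (0 : ℝ), 1 / 2 < X s :=
    hc.eventually (lt_mem_nhds (by rw [h0]; norm_num))
  obtain ⟨u, hu, hu'⟩ := mem_nhdsGE_iff_exists_Ico_subset.1 this
  refine ⟨min u 1, lt_min hu one_pos, X, _, hX.posSol hA hθ' (lt_min hu one_pos)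
    (min_le_right _ _) fun s hs => ?_⟩
  exact (hu' ⟨hs.1.le, hs.2.trans_le (min_le_left _ _)⟩ : 1 / 2 < X s).le

open Classical in
/-- The union of all positive solutions. -/
theorem exists_common_posSol (n : ℕ) (hm : 0 < m) (hq : 1 < q) (hα : 0 < α) (hθ : 0 ≤ θ) :
    ∃ x y, ∀ S X Y, 0 < S → PosSol n m q α θ S X Y → PosSol n m q α θ S x y := by
  let x : ℝ → ℝ := fun s => if h : ∃ X Y S, PosSol n m q α θ S X Y ∧ s < S then h.choose s else 0
  let y : ℝ → ℝ := fun s => if h : ∃ Y X S, PosSol n m q α θ S X Y ∧ s < S then h.choose s else 0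
  refine ⟨x, y, fun S X Y hS h => ?_⟩
  have hx : ∀ s ∈ Ico 0 S, x s = X s := fun s hs => by
    have hex : ∃ X Y S, PosSol n m q α θ S X Y ∧ s < S := ⟨X, Y, S, h, hs.2⟩
    obtain ⟨Y', S', h', hs'⟩ := hex.choose_spec
    simp only [x, dif_pos hex]
    exact (h'.unique hm hq hα hθ h hs.1 hs' hs.2).1
  have hy : ∀ s ∈ Ico 0 S, y s = Y s := fun s hs => by
    have hex : ∃ Y X S, PosSol n m q α θ S X Y ∧ s < S := ⟨Y, X, S, h, hs.2⟩
    obtain ⟨X', S', h', hs'⟩ := hex.choose_spec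
    simp only [y, dif_pos hex]
    exact (h'.unique hm hq hα hθ h hs.1 hs' hs.2).2
  have hxI : ∀ s ∈ Ioo 0 S, x s = X s := fun s hs => hx s ⟨hs.1.le, hs.2⟩
  have hyI : ∀ s ∈ Ioo 0 S, y s = Y s := fun s hs => hy s ⟨hs.1.le, hs.2⟩
  have h0 : (0 : ℝ) ∈ Ico 0 S := ⟨le_rfl, hS⟩
  have hxe : ∀ s ∈ Ioo 0 S, x =ᶠ[𝓝 s] X := fun s hs => by
    filter_upwards [Ioo_mem_nhds hs.1 hs.2] with t ht using hxI t ht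
  have hye : ∀ s ∈ Ioo 0 S, y =ᶠ[𝓝 s] Y := fun s hs => by
    filter_upwards [Ioo_mem_nhds hs.1 hs.2] with t ht using hyI t ht
  refine ⟨by rw [hx 0 h0, h.x_zero], by rw [hy 0 h0, h.y_zero],
    h.cont_x.congr_of_eventuallyEq ?_ (hx 0 h0), h.cont_y.congr_of_eventuallyEq ?_ (hy 0 h0),
    fun s hs => hxI s hs ▸ h.x_pos s hs, fun s hs => hyI s hs ▸ h.y_pos s hs,
    fun s hs => ?_, fun s hs => ?_⟩
  · filter_upwards [Ico_mem_nhdsGE hS] with t ht using hx t ht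
  · filter_upwards [Ico_mem_nhdsGE hS] with t ht using hy t ht
  · rw [hyI s hs]
    exact (h.dx s hs).congr_of_eventuallyEq (hxe s hs)
  · rw [hyI s hs, hxI s hs]
    exact (h.dy s hs).congr_of_eventuallyEq (hye s hs)

/-- A solution bounded away from zero on a bounded interval can be continued. -/
theorem PosSol.extend (hm : 0 < m) (hq : 1 < q) (hα : 0 < α) (hθ : 0 ≤ θ) (hS : 0 < S)
    (h : PosSol n m q α θ S x y) {l : ℝ} (hl : 0 < l) (hx : ∀ s ∈ Ioo 0 S, l ≤ x s) :
    ∃ S' > S, ∃ X Y, PosSol n m q α θ S' X Y := by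
  have hl1 : l ≤ 1 := (hx (S / 2) ⟨by linarith, by linarith⟩).trans
    (h.x_le_one ⟨by linarith, by linarith⟩)
  obtain ⟨c, hA⟩ := exists_admissible n hm hq hα hθ (ε := l / 2) (R := S + 1) (by linarith)
    (by linarith) (by linarith)
  have hθ' : θ ∈ Icc 0 θ := ⟨hθ, le_rfl⟩
  obtain ⟨X, hX⟩ := exists_fixSol hA hθ'
  have hXl : ∀ s ∈ Ioo 0 S, l ≤ X s := fun s hs => by
    have hA' := hA.mono hs.1 (by linarith [hs.2])
    have f := (h.fixSol hA' hθ' hs.2 (by linarith [hx s hs])).1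
    rw [← (FixSol.unique hA' hθ' f (hX.mono (by linarith [hs.2])) s ⟨hs.1.le, le_rfl⟩).1]
    exact hx s hs
  have hcS : ContinuousAt X S := hX.cont.continuousAt (Icc_mem_nhds hS (by linarith))
  have hXS : l ≤ X S := by
    refine ge_of_tendsto (hcS.tendsto.mono_left (nhdsWithin_le_nhds (s := Iio S))) ?_
    filter_upwards [Ioo_mem_nhdsLT hS] with s hs using hXl s hs
  obtain ⟨u, hu, hu'⟩ := mem_nhdsGE_iff_exists_Ico_subset.1
    ((hcS.tendsto.mono_left (nhdsWithin_le_nhds (s := Ici S))).eventually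
      (lt_mem_nhds (by linarith : l / 2 < X S)))
  refine ⟨min u (S + 1), lt_min hu (by linarith), X, _,
    hX.posSol hA hθ' (lt_min (hS.trans hu) (by linarith)) (min_le_right _ _) fun s hs => ?_⟩
  rcases lt_or_ge s S with hs' | hs'
  · linarith [hXl s ⟨hs.1, hs'⟩]
  · exact (hu' ⟨hs', hs.2.trans_le (min_le_left _ _)⟩ : l / 2 < X s).le

/-- Maximal positive solutions: either global, or reaching zero in finite time. -/
theorem exists_maximal_posSol (n : ℕ) (hm : 0 < m) (hq : 1 < q) (hα : 0 < α) (hθ : 0 ≤ θ) :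
    ∃ x y, (∀ S X Y, 0 < S → PosSol n m q α θ S X Y → PosSol n m q α θ S x y) ∧
      ((∀ S > 0, PosSol n m q α θ S x y) ∨
        ∃ S > 0, PosSol n m q α θ S x y ∧ Tendsto x (𝓝[<] S) (𝓝 0)) := by
  obtain ⟨x, y, hxy⟩ := exists_common_posSol n hm hq hα hθ
  refine ⟨x, y, hxy, ?_⟩
  let G : Set ℝ := {S | 0 < S ∧ ∃ X Y, PosSol n m q α θ S X Y}
  have hG : G.Nonempty := by
    obtain ⟨S, hS, X, Y, h⟩ := exists_posSol n hm hq hα hθ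
    exact ⟨S, hS, X, Y, h⟩
  by_cases hb : BddAbove G
  · right
    set S := sSup G with hSdef
    have hS : 0 < S := hG.some_mem.1.trans_le (le_csSup hb hG.some_mem)
    have hlt : ∀ s < S, ∃ S' > s, 0 < S' ∧ PosSol n m q α θ S' x y := fun s hs => by
      obtain ⟨S', ⟨h0, X, Y, h⟩, hs'⟩ := exists_lt_of_lt_csSup hG hs
      exact ⟨S', hs', h0, hxy S' X Y h0 h⟩
    have h : PosSol n m q α θ S x y := by
      obtain ⟨S₁, -, -, h₁⟩ := hlt 0 hS
      refine ⟨h₁.x_zero, h₁.y_zero, h₁.cont_x, h₁.cont_y, fun s hs => ?_, fun s hs => ?_,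
        fun s hs => ?_, fun s hs => ?_⟩ <;> obtain ⟨S', h', -, h''⟩ := hlt s hs.2
      · exact h''.x_pos s ⟨hs.1, h'⟩
      · exact h''.y_pos s ⟨hs.1, h'⟩
      · exact h''.dx s ⟨hs.1, h'⟩
      · exact h''.dy s ⟨hs.1, h'⟩
    refine ⟨S, hS, h, ?_⟩
    rw [tendsto_order]
    constructor
    · intro a ha
      filter_upwards [Ioo_mem_nhdsLT hS] with s hs using ha.trans (h.x_pos s hs)
    · intro a ha
      obtain ⟨s, hs, hsa⟩ : ∃ s ∈ Ioo 0 S, x s < a := by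
        by_contra! hcon
        obtain ⟨S', hS', X, Y, h'⟩ := h.extend hm hq hα hθ hS ha hcon
        exact absurd (le_csSup hb (show S' ∈ G from ⟨hS.trans hS', X, Y, h'⟩)) (not_le.2 hS')
      filter_upwards [Ioo_mem_nhdsLT hs.2] with t ht
      exact (h.antitoneOn ⟨hs.1.le, hs.2⟩ ⟨hs.1.le.trans ht.1.le, ht.2⟩ ht.1.le).trans_lt hsa
  · left
    intro S hS
    obtain ⟨S', ⟨h0, X, Y, h⟩, hs'⟩ := not_bddAbove_iff.1 hb S
    exact (hxy S' X Y h0 h).mono hs'.le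

end

theorem monotoneOn_of_hasDerivAt_nonneg {D : Set ℝ} (hD : Convex ℝ D) {f f' : ℝ → ℝ}
    (h : ∀ s ∈ D, HasDerivAt f (f' s) s) (h0 : ∀ s ∈ D, 0 ≤ f' s) : MonotoneOn f D :=
  monotoneOn_of_hasDerivWithinAt_nonneg hD (fun s hs => (h s hs).continuousAt.continuousWithinAt)
    (fun s hs => (h s (interior_subset hs)).hasDerivWithinAt) fun s hs => h0 s (interior_subset hs)

theorem antitoneOn_of_hasDerivAt_nonpos {D : Set ℝ} (hD : Convex ℝ D) {f f' : ℝ → ℝ}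
    (h : ∀ s ∈ D, HasDerivAt f (f' s) s) (h0 : ∀ s ∈ D, f' s ≤ 0) : AntitoneOn f D :=
  antitoneOn_of_hasDerivWithinAt_nonpos hD (fun s hs => (h s hs).continuousAt.continuousWithinAt)
    (fun s hs => (h s (interior_subset hs)).hasDerivWithinAt) fun s hs => h0 s (interior_subset hs)

/-- The slow-decay alternative of the shooting argument. -/
def SlowDecay (n : ℕ) (m q α θ : ℝ) : Prop :=
  ∃ S x y s₀, PosSol n m q α θ S x y ∧ s₀ ∈ Ioo 0 S ∧
    x s₀ ^ (q - 1) < θ * (n + 1 - α) ∧ y s₀ < θ * s₀ * x s₀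

/-- The transversal crossing alternative of the shooting argument. -/
def Crossing (n : ℕ) (m q α θ : ℝ) : Prop :=
  ∃ S x y s₀, PosSol n m q α θ S x y ∧ s₀ ∈ Ioo 0 S ∧
    (s₀ + 1) ^ n * x s₀ ^ (1 / m) < s₀ ^ n * y s₀ - θ * (s₀ + 1) ^ (n + 1) * x s₀

section
variable {n : ℕ} {m q α θ S : ℝ} {x y : ℝ → ℝ}

theorem SlowDecay.eventually (hm : 0 < m) (hq : 1 < q) (hα : 0 < α) (hθ : 0 ≤ θ)
    (h : SlowDecay n m q α θ) : ∀ᶠ ϑ in 𝓝[Ici 0] θ, SlowDecay n m q α ϑ := by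
  obtain ⟨S, x, y, s₀, hP, hs, h1, h2⟩ := h
  have hU : IsOpen {u : ℝ × ℝ × ℝ | u.2.1 ^ (q - 1) < u.1 * (n + 1 - α) ∧
      u.2.2 < u.1 * s₀ * u.2.1} := by
    have hc : Continuous fun u : ℝ × ℝ × ℝ => u.2.1 ^ (q - 1) :=
      (Real.continuous_rpow_const (by linarith)).comp (by fun_prop)
    have hc₁ : Continuous fun u : ℝ × ℝ × ℝ => u.1 * (n + 1 - α) := by fun_prop
    have hc₂ : Continuous fun u : ℝ × ℝ × ℝ => u.1 * s₀ * u.2.1 := by fun_prop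
    exact (isOpen_lt hc hc₁).inter (isOpen_lt (by fun_prop) hc₂)
  filter_upwards [hP.stable hm hq hα hθ hs (hU.mem_nhds ⟨h1, h2⟩)] with ϑ hϑ
  obtain ⟨S', hS', X, Y, hX, h3, h4⟩ := hϑ
  exact ⟨S', X, Y, s₀, hX, ⟨hs.1, hS'⟩, h3, h4⟩

theorem Crossing.eventually (hm : 0 < m) (hq : 1 < q) (hα : 0 < α) (hθ : 0 ≤ θ)
    (h : Crossing n m q α θ) : ∀ᶠ ϑ in 𝓝[Ici 0] θ, Crossing n m q α ϑ := by
  obtain ⟨S, x, y, s₀, hP, hs, h1⟩ := h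
  have hU : IsOpen {u : ℝ × ℝ × ℝ | (s₀ + 1) ^ n * u.2.1 ^ (1 / m)
      < s₀ ^ n * u.2.2 - u.1 * (s₀ + 1) ^ (n + 1) * u.2.1} := by
    have hc : Continuous fun u : ℝ × ℝ × ℝ => u.2.1 ^ (1 / m) :=
      (Real.continuous_rpow_const (by positivity)).comp (by fun_prop)
    exact isOpen_lt (continuous_const.mul hc) (by fun_prop)
  filter_upwards [hP.stable hm hq hα hθ hs (hU.mem_nhds h1)] with ϑ hϑ
  obtain ⟨S', hS', X, Y, hX, h3⟩ := hϑ
  exact ⟨S', X, Y, s₀, hX, ⟨hs.1, hS'⟩, h3⟩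

theorem PosSol.hasDerivAt_J (h : PosSol n m q α θ S x y) {s : ℝ} (hs : s ∈ Ioo 0 S) :
    HasDerivAt (fun s => θ * (s ^ (n + 1) * x s) - s ^ n * y s)
      (s ^ n * x s * (θ * (n + 1 - α) - x s ^ (q - 1))) s := by
  refine ((((hasDerivAt_pow (n + 1) s).mul (h.dx s hs)).const_mul θ).sub
    (h.hasDerivAt_pow_mul hs)).congr_deriv ?_
  have : x s ^ q = x s ^ (q - 1) * x s := by
    rw [← Real.rpow_add_one (h.x_pos s hs).ne']; ring_nf
  rw [reac, this]
  push_cast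
  ring

theorem PosSol.lt_of_slowDecay (hq : 1 < q) (h : PosSol n m q α θ S x y) {s₀ : ℝ}
    (hs₀ : s₀ ∈ Ioo 0 S) (h1 : x s₀ ^ (q - 1) < θ * (n + 1 - α)) (h2 : y s₀ < θ * s₀ * x s₀) :
    ∀ s ∈ Ico s₀ S, y s < θ * s * x s := by
  have hm : MonotoneOn (fun s => θ * (s ^ (n + 1) * x s) - s ^ n * y s) (Ico s₀ S) := by
    refine monotoneOn_of_hasDerivAt_nonneg (convex_Ico _ _)
      (fun s hs => h.hasDerivAt_J ⟨hs₀.1.trans_le hs.1, hs.2⟩) fun s hs => ?_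
    have hs0 : 0 < s := hs₀.1.trans_le hs.1
    have hx := h.x_pos s ⟨hs0, hs.2⟩
    have : x s ^ (q - 1) ≤ x s₀ ^ (q - 1) := Real.rpow_le_rpow hx.le
      (h.antitoneOn ⟨hs₀.1.le, hs₀.2⟩ ⟨hs0.le, hs.2⟩ hs.1) (by linarith)
    have : 0 ≤ θ * (n + 1 - α) - x s ^ (q - 1) := by linarith
    positivity
  intro s hs
  have h3 := hm ⟨le_rfl, hs₀.2⟩ hs hs.1
  have hs0 : 0 < s := hs₀.1.trans_le hs.1
  have h4 : 0 < s₀ ^ n * (θ * s₀ * x s₀ - y s₀) := mul_pos (pow_pos hs₀.1 n) (by linarith)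
  have h5 : 0 < s ^ n * (θ * s * x s - y s) := by
    calc 0 < _ := h4
      _ = θ * (s₀ ^ (n + 1) * x s₀) - s₀ ^ n * y s₀ := by ring
      _ ≤ _ := h3
      _ = _ := by ring
  linarith [pos_of_mul_pos_right h5 (pow_pos hs0 n).le]

theorem PosSol.of_crossing (hm : 0 < m) (hα : 0 < α) (hθ : 0 ≤ θ)
    (h : PosSol n m q α θ S x y) {s₀ : ℝ} (hs₀ : s₀ ∈ Ioo 0 S)
    (hc : (s₀ + 1) ^ n * x s₀ ^ (1 / m) < s₀ ^ n * y s₀ - θ * (s₀ + 1) ^ (n + 1) * x s₀) :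
    S ≤ s₀ + 1 ∧ ∃ κ > 0, ∀ s ∈ Ico s₀ S, κ ≤ y s := by
  have hx0 := h.x_pos s₀ hs₀
  have hs1 : 0 < s₀ + 1 := by linarith [hs₀.1]
  set T := min S (s₀ + 1) with hT
  have hsT : s₀ < T := lt_min hs₀.2 (by linarith)
  have hTS : ∀ s ∈ Ico s₀ T, s ∈ Ioo 0 S := fun s hs =>
    ⟨hs₀.1.trans_le hs.1, hs.2.trans_le (min_le_left _ _)⟩
  set K := θ * (s₀ + 1) ^ (n + 1) with hK
  set κ := (s₀ ^ n * y s₀ - K * x s₀) / (s₀ + 1) ^ n with hκ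
  have hκ1 : x s₀ ^ (1 / m) < κ := by
    rw [hκ, lt_div_iff₀ (by positivity)]; linarith
  have hκ0 : 0 < κ := (Real.rpow_pos_of_pos hx0 _).trans hκ1
  have hκm : x s₀ < κ ^ m := by
    have := Real.rpow_lt_rpow (Real.rpow_nonneg hx0.le _) hκ1 hm
    rwa [← Real.rpow_mul hx0.le, one_div_mul_cancel hm.ne', Real.rpow_one] at this
  have hmono : MonotoneOn (fun s => s ^ n * y s - K * x s) (Ico s₀ T) := by
    refine monotoneOn_of_hasDerivAt_nonneg (convex_Ico _ _) (fun s hs =>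
      (h.hasDerivAt_pow_mul (hTS s hs)).sub ((h.dx s (hTS s hs)).const_mul K)) fun s hs => ?_
    have hS := hTS s hs
    have hx := h.x_pos s hS
    have hy := Real.rpow_nonneg (h.y_pos s hS).le m
    have hs' : s ≤ s₀ + 1 := hs.2.le.trans (min_le_right _ _)
    have h1 : s ^ (n + 1) ≤ (s₀ + 1) ^ (n + 1) := pow_le_pow_left₀ hS.1.le hs' _
    have h2 : θ * s ^ (n + 1) * y s ^ m ≤ K * y s ^ m := by
      rw [hK]; gcongr
    have h3 : 0 ≤ s ^ n * reac q α θ (x s) := by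
      have := hS.1
      unfold reac
      positivity
    calc 0 ≤ s ^ n * reac q α θ (x s) + (K * y s ^ m - θ * s ^ (n + 1) * y s ^ m) := by linarith
      _ = _ := by ring
  have hyκ : ∀ s ∈ Ico s₀ T, κ ≤ y s := fun s hs => by
    have h1 := hmono ⟨le_rfl, hsT⟩ hs hs.1
    have hS := hTS s hs
    have h2 : 0 ≤ K * x s := by
      have := (h.x_pos s hS).le
      positivity
    have h3 : s ^ n ≤ (s₀ + 1) ^ n :=
      pow_le_pow_left₀ hS.1.le (hs.2.le.trans (min_le_right _ _)) _
    rw [hκ, div_le_iff₀ (by positivity)]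
    have h4 := mul_le_mul_of_nonneg_right h3 (h.y_pos s hS).le
    simp only at h1
    linarith
  have hST : S ≤ s₀ + 1 := by
    by_contra! hlt
    have hTe : T = s₀ + 1 := min_eq_right hlt.le
    have hanti : AntitoneOn (fun s => x s + κ ^ m * s) (Ico s₀ T) := by
      refine antitoneOn_of_hasDerivAt_nonpos (convex_Ico _ _) (fun s hs =>
        (h.dx s (hTS s hs)).add ((hasDerivAt_id s).const_mul _)) fun s hs => ?_
      have := Real.rpow_le_rpow hκ0.le (hyκ s hs) hm.le
      linarith
    have h1 : x (s₀ + 1) + κ ^ m * (s₀ + 1) ≤ x s₀ + κ ^ m * s₀ := by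
      have hcont : ContinuousAt (fun s => x s + κ ^ m * s) (s₀ + 1) :=
        (h.dx _ ⟨hs1, hlt⟩).continuousAt.add (by fun_prop)
      refine le_of_tendsto (hcont.tendsto.mono_left (nhdsWithin_le_nhds (s := Iio (s₀ + 1)))) ?_
      filter_upwards [Ioo_mem_nhdsLT (show s₀ < s₀ + 1 by linarith)] with s hs
      exact hanti ⟨le_rfl, hsT⟩ ⟨hs.1.le, hTe ▸ hs.2⟩ hs.1.le
    linarith [h.x_pos _ ⟨hs1, hlt⟩]
  exact ⟨hST, κ, hκ0, by rwa [hT, min_eq_left hST] at hyκ⟩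

theorem PosSol.le_of_tendsto_zero {S' : ℝ} (h : PosSol n m q α θ S' x y) (hS : 0 < S)
    (hx : Tendsto x (𝓝[<] S) (𝓝 0)) : S' ≤ S := by
  by_contra! hlt
  have h1 := (h.dx S ⟨hS, hlt⟩).continuousAt.tendsto.mono_left (nhdsWithin_le_nhds (s := Iio S))
  exact (h.x_pos S ⟨hS, hlt⟩).ne' (tendsto_nhds_unique h1 hx)

theorem not_slowDecay_and_crossing (hm : 0 < m) (hq : 1 < q) (hα : 0 < α) (hθ : 0 ≤ θ) :
    ¬ (SlowDecay n m q α θ ∧ Crossing n m q α θ) := by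
  rintro ⟨⟨S₁, X₁, Y₁, s₁, hP₁, hs₁, h₁, h₁'⟩, ⟨S₂, X₂, Y₂, s₂, hP₂, hs₂, h₂⟩⟩
  obtain ⟨x, y, hxy, hmax⟩ := exists_maximal_posSol n hm hq hα hθ
  have hQ₁ := hxy _ _ _ (hs₁.1.trans hs₁.2) hP₁
  have hQ₂ := hxy _ _ _ (hs₂.1.trans hs₂.2) hP₂
  obtain ⟨e₁, e₁'⟩ := hP₁.unique hm hq hα hθ hQ₁ hs₁.1.le hs₁.2 hs₁.2
  obtain ⟨e₂, e₂'⟩ := hP₂.unique hm hq hα hθ hQ₂ hs₂.1.le hs₂.2 hs₂.2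
  rw [e₁] at h₁ h₁'
  rw [e₁'] at h₁'
  rw [e₂, e₂'] at h₂
  rcases hmax with hG | ⟨S, hS, hP, hx⟩
  · have := ((hG (s₂ + 2) (by linarith [hs₂.1])).of_crossing hm hα hθ
      ⟨hs₂.1, by linarith⟩ h₂).1
    linarith
  · have hS₁ : s₁ < S := hs₁.2.trans_le (hQ₁.le_of_tendsto_zero hS hx)
    have hS₂ : s₂ < S := hs₂.2.trans_le (hQ₂.le_of_tendsto_zero hS hx)
    obtain ⟨-, κ, hκ, hκy⟩ := hP.of_crossing hm hα hθ ⟨hs₂.1, hS₂⟩ h₂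
    have hlt := hP.lt_of_slowDecay hq ⟨hs₁.1, hS₁⟩ h₁ h₁'
    have ht : Tendsto (fun s => θ * s * x s) (𝓝[<] S) (𝓝 (θ * S * 0)) :=
      ((continuous_const.mul continuous_id).continuousAt.tendsto.mono_left
        nhdsWithin_le_nhds).mul hx
    rw [mul_zero] at ht
    have : κ ≤ 0 := by
      refine ge_of_tendsto ht ?_
      filter_upwards [Ioo_mem_nhdsLT hS₁, Ioo_mem_nhdsLT hS₂] with s h1 h2
      exact (hκy s ⟨h2.1.le, h2.2⟩).trans (hlt s ⟨h1.1.le, h1.2⟩).le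
    linarith

theorem slowDecay_of_large (hm : 0 < m) (hq : 1 < q) (hα : 0 < α) (hθ : 0 ≤ θ)
    (h : 1 < θ * (n + 1 - α)) : SlowDecay n m q α θ := by
  obtain ⟨S, hS, x, y, hP⟩ := exists_posSol n hm hq hα hθ
  have hx : ∀ s ∈ Ioo 0 S, x s ^ (q - 1) < θ * (n + 1 - α) := fun s hs =>
    (Real.rpow_le_one (hP.x_pos s hs).le (hP.x_le_one ⟨hs.1.le, hs.2⟩) (by linarith)).trans_lt h
  have hs : S / 2 ∈ Ioo 0 S := ⟨by linarith, by linarith⟩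
  refine ⟨S, x, y, S / 2, hP, hs, hx _ hs, ?_⟩
  have hsm : StrictMonoOn (fun s => θ * (s ^ (n + 1) * x s) - s ^ n * y s) (Ico 0 S) := by
    refine strictMonoOn_of_hasDerivWithinAt_pos (convex_Ico _ _)
      ((continuousOn_const.mul ((continuous_pow _).continuousOn.mul hP.continuousOn_x)).sub
        ((continuous_pow _).continuousOn.mul hP.continuousOn_y))
      (f' := fun s => s ^ n * x s * (θ * (n + 1 - α) - x s ^ (q - 1))) ?_ ?_ <;>
      rw [interior_Ico] <;> intro s hs
    · exact (hP.hasDerivAt_J hs).hasDerivWithinAt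
    · have h1 := hx s hs
      have h2 := hP.x_pos s hs
      have h3 := hs.1
      exact mul_pos (by positivity) (by linarith)
  have h1 := hsm ⟨le_rfl, hS⟩ ⟨hs.1.le, hs.2⟩ hs.1
  simp only [hP.y_zero, mul_zero, sub_zero] at h1
  rw [zero_pow (by lia), zero_mul, mul_zero] at h1
  have h2 : 0 < (S / 2) ^ n * (θ * (S / 2) * x (S / 2) - y (S / 2)) := by
    refine h1.trans_eq ?_; ring
  linarith [pos_of_mul_pos_right h2 (pow_pos hs.1 n).le]

/-- The shooting parameter. -/
theorem exists_shooting (hm : 0 < m) (hq : 1 < q) (hα : 0 < α) (hαn : α < n + 1)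
    (h0 : Crossing n m q α 0) :
    ∃ θ > 0, ¬ SlowDecay n m q α θ ∧ ¬ Crossing n m q α θ := by
  have hopen : ∀ P : ℝ → Prop, (∀ θ, 0 ≤ θ → P θ → ∀ᶠ ϑ in 𝓝[Ici 0] θ, P ϑ) →
      IsOpen {θ : ℝ | P (max θ 0)} := fun P hP => by
    rw [isOpen_iff_mem_nhds]
    intro θ hθ
    have hc : Tendsto (fun θ : ℝ => max θ 0) (𝓝 θ) (𝓝[Ici 0] (max θ 0)) :=
      tendsto_nhdsWithin_iff.2 ⟨(by fun_prop : Continuous fun θ : ℝ => max θ 0).tendsto θ,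
        Eventually.of_forall fun _ => mem_Ici.2 (le_max_right _ _)⟩
    exact hc.eventually (hP _ (le_max_right _ _) hθ)
  by_contra! hcon
  have hcov : ∀ θ ≥ 0, SlowDecay n m q α θ ∨ Crossing n m q α θ := fun θ hθ => by
    rcases hθ.eq_or_lt with rfl | hθ
    · exact Or.inr h0
    · by_cases h : SlowDecay n m q α θ
      · exact Or.inl h
      · exact Or.inr (hcon θ hθ h)
  have hpos : 0 < (n : ℝ) + 1 - α := by linarith
  obtain ⟨θ, -, h1, h2⟩ := isPreconnected_univ _ _
    (hopen (SlowDecay n m q α) fun θ hθ h => h.eventually hm hq hα hθ)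
    (hopen (Crossing n m q α) fun θ hθ h => h.eventually hm hq hα hθ)
    (fun θ _ => hcov (max θ 0) (le_max_right _ _))
    ⟨2 / (n + 1 - α), mem_univ _, by
      rw [Set.mem_ofPred_eq, max_eq_left (by positivity)]
      exact slowDecay_of_large hm hq hα (by positivity) (by
        rw [div_mul_cancel₀ _ hpos.ne']; norm_num)⟩
    ⟨0, mem_univ _, by rw [Set.mem_ofPred_eq, max_self]; exact h0⟩
  exact not_slowDecay_and_crossing hm hq hα (le_max_right _ _) ⟨h1, h2⟩

theorem PosSol.tendsto_flux_of_not_crossing (hm : 0 < m)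
    (h : PosSol n m q α θ S x y) (hS : 0 < S) (hx : Tendsto x (𝓝[<] S) (𝓝 0))
    (hc : ¬ Crossing n m q α θ) : Tendsto y (𝓝[<] S) (𝓝 0) := by
  have hev : ∀ᶠ s in 𝓝[<] S, s ∈ Ioo 0 S := Ioo_mem_nhdsLT hS
  have hpow : ∀ k : ℕ, Tendsto (fun s : ℝ => (s + 1) ^ k) (𝓝[<] S) (𝓝 ((S + 1) ^ k)) := fun k =>
    ((by fun_prop : Continuous fun s : ℝ => (s + 1) ^ k).tendsto S).mono_left nhdsWithin_le_nhds
  have hpow' : Tendsto (fun s : ℝ => s ^ n) (𝓝[<] S) (𝓝 (S ^ n)) :=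
    ((continuous_pow n).tendsto S).mono_left nhdsWithin_le_nhds
  have hxm : Tendsto (fun s => x s ^ (1 / m)) (𝓝[<] S) (𝓝 0) := by
    have := hx.rpow_const (p := 1 / m) (Or.inr (by positivity))
    rwa [Real.zero_rpow (by positivity)] at this
  have ht : Tendsto (fun s => ((s + 1) ^ n * x s ^ (1 / m) + θ * (s + 1) ^ (n + 1) * x s) / s ^ n)
      (𝓝[<] S) (𝓝 0) := by
    have := ((((hpow n).mul hxm).add (((hpow (n + 1)).const_mul θ).mul hx))).div hpow'
      (pow_pos hS n).ne'
    simp only [mul_zero, add_zero, zero_div] at this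
    exact this
  refine tendsto_of_tendsto_of_tendsto_of_le_of_le' tendsto_const_nhds ht ?_ ?_
  · filter_upwards [hev] with s hs using (h.y_pos s hs).le
  · filter_upwards [hev] with s hs
    rw [le_div_iff₀ (pow_pos hs.1 n)]
    by_contra! hlt
    exact hc ⟨S, x, y, s, h, hs, by linarith⟩

/-- The Pohozaev functional increases in the subcritical range. -/
theorem PosSol.hasDerivAt_pohozaev (hq : 1 < q) (h : PosSol n m q α 0 S x y) (hm : 0 < m) {s : ℝ}
    (hs : s ∈ Ioo 0 S) :
    HasDerivAt (fun s => s ^ (n + 1) * (y s ^ (m + 1) / (m + 1) + x s ^ (q + 1) / (q + 1))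
        - (n * m - 1) / (m + 1) * (s ^ n * y s * x s))
      (s ^ n * x s ^ (q + 1) * ((n + 1) / (q + 1) - (n * m - 1) / (m + 1))) s := by
  have hx := h.x_pos s hs
  have hy := h.y_pos s hs
  have hx' := (h.dx s hs).rpow_const (p := q + 1) (Or.inl hx.ne')
  have hy' := (h.dy s hs).rpow_const (p := m + 1) (Or.inl hy.ne')
  refine (((hasDerivAt_pow (n + 1) s).mul ((hy'.div_const (m + 1)).add
    (hx'.div_const (q + 1)))).sub (((h.hasDerivAt_pow_mul hs).mul (h.dx s hs)).const_mul
      ((n * m - 1) / (m + 1)))).congr_deriv ?_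
  have e1 : x s ^ (q + 1) = x s ^ q * x s := Real.rpow_add_one hx.ne' q
  have e2 : y s ^ (m + 1) = y s ^ m * y s := Real.rpow_add_one hy.ne' m
  have e3 : q + 1 - 1 = q := by ring
  have e4 : m + 1 - 1 = m := by ring
  have hs0 := hs.1.ne'
  rw [e3, e4, reac]
  simp only [Pi.add_apply]
  rw [e1, e2]
  have h1 : m + 1 ≠ 0 := by positivity
  have h2 : q + 1 ≠ 0 := by positivity
  push_cast
  field_simp
  ring

theorem PosSol.flux_ge (hq : 1 < q) (h : PosSol n m q α 0 S x y) {s : ℝ} (hs : s ∈ Ioo 0 S) :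
    s * x s ^ q / (n + 1) ≤ y s := by
  have hmono : MonotoneOn (fun t => t ^ n * y t - x s ^ q / (n + 1) * t ^ (n + 1)) (Icc 0 s) := by
    have hsub : Icc 0 s ⊆ Ico 0 S := fun t ht => ⟨ht.1, ht.2.trans_lt hs.2⟩
    have hsub' : ∀ t ∈ Ioo 0 s, t ∈ Ioo 0 S := fun t ht => ⟨ht.1, ht.2.trans hs.2⟩
    refine monotoneOn_of_hasDerivWithinAt_nonneg (convex_Icc _ _)
      (((continuous_pow _).continuousOn.mul (h.continuousOn_y.mono hsub)).sub
        (by fun_prop)) (f' := fun t => t ^ n * (x t ^ q - x s ^ q)) ?_ ?_ <;>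
      rw [interior_Icc] <;> intro t ht
    · refine (((h.hasDerivAt_pow_mul (hsub' t ht)).sub
        ((hasDerivAt_pow (n + 1) t).const_mul (x s ^ q / (n + 1)))).congr_deriv
          ?_).hasDerivWithinAt
      have : (n : ℝ) + 1 ≠ 0 := by positivity
      rw [reac]
      push_cast
      field_simp
      ring
    · have := Real.rpow_le_rpow (h.x_pos s hs).le
        (h.antitoneOn ⟨ht.1.le, ht.2.trans hs.2⟩ ⟨hs.1.le, hs.2⟩ ht.2.le) (by linarith : 0 ≤ q)
      exact mul_nonneg (pow_nonneg ht.1.le _) (by linarith)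
  have h1 := hmono ⟨le_rfl, hs.1.le⟩ ⟨hs.1.le, le_rfl⟩ hs.1.le
  simp only [h.y_zero, mul_zero] at h1
  rw [zero_pow (by lia), mul_zero, sub_zero] at h1
  have h2 : 0 ≤ s ^ n * (y s - s * x s ^ q / (n + 1)) := by
    refine h1.trans_eq ?_
    ring
  linarith [nonneg_of_mul_nonneg_right h2 (pow_pos hs.1 n)]

theorem PosSol.monotoneOn_pow_mul (h : PosSol n m q α 0 S x y) :
    MonotoneOn (fun s => s ^ n * y s) (Ioo 0 S) := by
  refine monotoneOn_of_hasDerivAt_nonneg (convex_Ioo _ _) (fun s hs => h.hasDerivAt_pow_mul hs)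
    fun s hs => ?_
  have := h.x_pos s hs
  have := hs.1
  rw [reac, zero_mul, zero_mul, zero_mul, add_zero, sub_zero]
  positivity

theorem not_global_of_low_dim (hm : 0 < m) (hn : n * m ≤ 1)
    (h : ∀ S > 0, PosSol n m q α 0 S x y) : False := by
  have hP : ∀ s > 0, PosSol n m q α 0 (s + 1) x y := fun s hs => h _ (by linarith)
  have hmem : ∀ s : ℝ, 0 < s → s ∈ Ioo 0 (s + 1) := fun s hs => ⟨hs, by linarith⟩
  have hy1 : 0 < y 1 := (hP 1 one_pos).y_pos 1 (hmem 1 one_pos)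
  have hanti : AntitoneOn (fun s => x s + y 1 ^ m * Real.log s) (Ici 1) := by
    refine antitoneOn_of_hasDerivAt_nonpos (convex_Ici 1) (f' := fun s => -(y s ^ m) +
      y 1 ^ m * s⁻¹) (fun s hs => ?_) fun s hs => ?_
    · have hs0 : 0 < s := one_pos.trans_le hs
      exact ((hP s hs0).dx s (hmem s hs0)).add ((Real.hasDerivAt_log hs0.ne').const_mul _)
    · have hs0 : 0 < s := one_pos.trans_le hs
      have hs1 : 1 ≤ s := hs
      have h1 := (hP s hs0).monotoneOn_pow_mul ⟨one_pos, by linarith⟩ (hmem s hs0) hs1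
      simp only [one_pow, one_mul] at h1
      have h2 : y 1 ^ m ≤ s * y s ^ m := by
        have h3 : (s ^ n) ^ m ≤ s := by
          rw [← Real.rpow_natCast, ← Real.rpow_mul hs0.le]
          simpa using Real.rpow_le_rpow_of_exponent_le hs1 hn
        have hy := ((hP s hs0).y_pos s (hmem s hs0)).le
        calc y 1 ^ m ≤ (s ^ n * y s) ^ m := Real.rpow_le_rpow hy1.le h1 hm.le
          _ = (s ^ n) ^ m * y s ^ m := Real.mul_rpow (by positivity) hy
          _ ≤ _ := by gcongr
      have h3 : y 1 ^ m * s⁻¹ ≤ y s ^ m := by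
        rw [← div_eq_mul_inv, div_le_iff₀ hs0]; linarith
      linarith
  have ht := (Real.tendsto_log_atTop.const_mul_atTop (Real.rpow_pos_of_pos hy1 m)
    ).eventually_gt_atTop (x 1)
  obtain ⟨s, hs, hs1⟩ := (ht.and (eventually_ge_atTop 1)).exists
  have h1 := hanti (mem_Ici.2 le_rfl) hs1 hs1
  have h2 := (hP s (by linarith)).x_pos s (hmem s (by linarith))
  simp only [Real.log_one, mul_zero, add_zero] at h1
  linarith

theorem not_global_of_subcritical (hm : 0 < m) (hq : 1 < q) (hn : 1 < n * m)
    (hsub : q * (n * m - 1) < n + m + 2)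
    (h : ∀ S > 0, PosSol n m q α 0 S x y) : False := by
  have hP : ∀ s > 0, PosSol n m q α 0 (s + 1) x y := fun s hs => h _ (by linarith)
  have hmem : ∀ s : ℝ, 0 < s → s ∈ Ioo 0 (s + 1) := fun s hs => ⟨hs, by linarith⟩
  have hxp : ∀ s > 0, 0 < x s := fun s hs => (hP s hs).x_pos s (hmem s hs)
  have hyp : ∀ s > 0, 0 < y s := fun s hs => (hP s hs).y_pos s (hmem s hs)
  have hx1 : ∀ s > 0, x s ≤ 1 := fun s hs => (hP s hs).x_le_one ⟨hs.le, by linarith⟩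
  have hn0 : (0 : ℝ) ≤ n := Nat.cast_nonneg n
  -- an exponent for the decay rate
  obtain ⟨e, he1, he2⟩ : ∃ e, max 0 (q - 1 / m) < e ∧
      e < (m + 1) * (q + 1) / (m * (n + 1)) := by
    refine exists_between (max_lt (by positivity) ?_)
    have : q - 1 / m = (q * m - 1) / m := by field_simp
    rw [this, div_lt_div_iff₀ hm (by positivity)]
    nlinarith
  obtain ⟨he0, heq⟩ := max_lt_iff.1 he1
  rw [lt_div_iff₀ (by positivity)] at he2
  have hem : q * m ≤ e * m + 1 := by
    have : (q - 1 / m) * m < e * m := mul_lt_mul_of_pos_right heq hm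
    rw [sub_mul, one_div_mul_cancel hm.ne'] at this
    linarith
  have hem0 : 0 < e * m := mul_pos he0 hm
  set g := (m + 1) / (e * m) with hg
  set k := (n * m - 1) / (m + 1) with hk
  have hk0 : 0 < k := div_pos (by linarith) (by linarith)
  have hgq : (n : ℝ) + 1 < g * (q + 1) := by
    rw [hg, div_mul_eq_mul_div, lt_div_iff₀ hem0]
    linarith
  have hkq : k * (q + 1) < n + 1 := by
    rw [hk, div_mul_eq_mul_div, div_lt_iff₀ (by linarith)]
    linarith
  have hgk : k < g := lt_of_mul_lt_mul_right (hkq.trans hgq) (by linarith)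
  -- decay of `x`
  obtain ⟨c, hc, hdec⟩ : ∃ c > 0, ∀ s > 0, c * s ^ (m + 1) ≤ x s ^ (-(e * m)) := by
    refine ⟨e * m / ((n + 1) ^ m * (m + 1)), by positivity, fun s₀ hs₀ => ?_⟩
    set c := e * m / (((n : ℝ) + 1) ^ m * (m + 1)) with hc
    have hmono : MonotoneOn (fun s => x s ^ (-(e * m)) - c * s ^ (m + 1)) (Ioi 0) := by
      refine monotoneOn_of_hasDerivAt_nonneg (convex_Ioi 0) (f' := fun s =>
        -(y s ^ m) * (-(e * m)) * x s ^ (-(e * m) - 1) - c * ((m + 1) * s ^ (m + 1 - 1)))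
        (fun s hs => ?_) fun s hs => ?_
      · exact (((hP s hs).dx s (hmem s hs)).rpow_const (Or.inl (hxp s hs).ne')).sub
          ((Real.hasDerivAt_rpow_const (Or.inl (ne_of_gt hs))).const_mul c)
      · have hs0 : 0 < s := hs
        have h1 := (hP s hs).flux_ge hq (hmem s hs)
        have hx := hxp s hs
        have h2 : s ^ m * x s ^ (e * m + 1) / (n + 1) ^ m ≤ y s ^ m := by
          calc s ^ m * x s ^ (e * m + 1) / (n + 1) ^ m ≤ s ^ m * x s ^ (q * m) / (n + 1) ^ m := by
                gcongr 1
                exact mul_le_mul_of_nonneg_left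
                  (Real.rpow_le_rpow_of_exponent_ge hx (hx1 s hs) hem) (by positivity)
            _ = (s * x s ^ q / (n + 1)) ^ m := by
                rw [Real.div_rpow (by positivity) (by positivity),
                  Real.mul_rpow hs0.le (by positivity), ← Real.rpow_mul hx.le]
            _ ≤ _ := Real.rpow_le_rpow (by positivity) h1 hm.le
        have h3 : x s ^ (e * m + 1) * x s ^ (-(e * m) - 1) = 1 := by
          rw [← Real.rpow_add hx]; ring_nf; exact Real.rpow_zero _
        have h4 : s ^ m / (n + 1) ^ m ≤ y s ^ m * x s ^ (-(e * m) - 1) := by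
          calc s ^ m / (n + 1) ^ m
              = s ^ m * x s ^ (e * m + 1) / (n + 1) ^ m * x s ^ (-(e * m) - 1) := by
                rw [div_mul_eq_mul_div, mul_assoc, h3, mul_one]
            _ ≤ _ := by gcongr
        have h5 : c * ((m + 1) * s ^ (m + 1 - 1)) = e * m * (s ^ m / (n + 1) ^ m) := by
          rw [hc, add_sub_cancel_right]; field_simp
        rw [h5]
        have := mul_le_mul_of_nonneg_left h4 hem0.le
        linarith
    have hlim : Tendsto (fun s : ℝ => -(c * s ^ (m + 1))) (𝓝[>] 0) (𝓝 0) := by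
      have := ((Real.continuous_rpow_const (by positivity : 0 ≤ m + 1)).const_mul c).neg.tendsto 0
      rw [Pi.neg_apply, Real.zero_rpow (by positivity : m + 1 ≠ 0), mul_zero, neg_zero] at this
      exact this.mono_left nhdsWithin_le_nhds
    have : 0 ≤ x s₀ ^ (-(e * m)) - c * s₀ ^ (m + 1) := by
      refine le_of_tendsto hlim ?_
      filter_upwards [Ioo_mem_nhdsGT hs₀] with s hs
      refine le_trans ?_ (hmono hs.1 hs₀ hs.2.le)
      have := Real.rpow_nonneg (hxp s hs.1).le (-(e * m))
      linarith
    linarith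
  obtain ⟨C, hC, hxC⟩ : ∃ C > 0, ∀ s > 0, x s ≤ C * s ^ (-g) := by
    refine ⟨c ^ (-(1 / (e * m))), by positivity, fun s hs => ?_⟩
    have h1 := Real.rpow_le_rpow_of_nonpos (by positivity) (hdec s hs)
      (by rw [neg_nonpos]; positivity : -(1 / (e * m)) ≤ 0)
    rw [← Real.rpow_mul (hxp s hs).le, Real.mul_rpow hc.le (by positivity),
      ← Real.rpow_mul hs.le] at h1
    have e1 : -(e * m) * -(1 / (e * m)) = 1 := by field_simp
    have e2 : (m + 1) * -(1 / (e * m)) = -g := by rw [hg]; ring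
    rwa [e1, e2, Real.rpow_one] at h1
  -- the Pohozaev functional is bounded below
  set P := fun s => s ^ (n + 1) * (y s ^ (m + 1) / (m + 1) + x s ^ (q + 1) / (q + 1))
        - k * (s ^ n * y s * x s) with hPdef
  have hPm : StrictMonoOn P (Icc 0 1) ∧ MonotoneOn P (Ioi 0) := by
    have hd : ∀ s ∈ Ioi (0 : ℝ), HasDerivAt P (s ^ n * x s ^ (q + 1) * ((n + 1) / (q + 1) - k)) s :=
      fun s hs => (hP s hs).hasDerivAt_pohozaev hq hm (hmem s hs)
    have hp : ∀ s ∈ Ioi (0 : ℝ), 0 < s ^ n * x s ^ (q + 1) * ((n + 1) / (q + 1) - k) := by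
      intro s hs
      have h1 := hxp s hs
      have h2 : (0 : ℝ) < s := hs
      have : k < (n + 1) / (q + 1) := by rw [lt_div_iff₀ (by linarith)]; exact hkq
      exact mul_pos (by positivity) (by linarith)
    refine ⟨strictMonoOn_of_hasDerivWithinAt_pos (convex_Icc _ _) ?_ (fun s hs => ?_)
      fun s hs => hp s ?_, monotoneOn_of_hasDerivAt_nonneg (convex_Ioi 0) hd
      fun s hs => (hp s hs).le⟩
    · have hsub : Icc (0 : ℝ) 1 ⊆ Ico 0 (1 + 1) := fun s hs => ⟨hs.1, by linarith [hs.2]⟩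
      have hx := (hP 1 one_pos).continuousOn_x.mono hsub
      have hy := (hP 1 one_pos).continuousOn_y.mono hsub
      exact ((continuous_pow _).continuousOn.mul
        (((hy.rpow_const fun s _ => Or.inr (by linarith)).div_const _).add
        ((hx.rpow_const fun s _ => Or.inr (by linarith)).div_const _))).sub
        (continuousOn_const.mul (((continuous_pow _).continuousOn.mul hy).mul hx))
    · rw [interior_Icc] at hs
      exact (hd s hs.1).hasDerivWithinAt
    · rw [interior_Icc] at hs
      exact hs.1
  have hP1 : 0 < P 1 := by
    have h0 : P 0 = 0 := by simp [hPdef, (hP 1 one_pos).y_zero]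
    exact h0 ▸ hPm.1 ⟨le_rfl, zero_le_one⟩ ⟨zero_le_one, le_rfl⟩ one_pos
  -- lower bound for the flux
  have hsmall : Tendsto (fun s : ℝ => C ^ (q + 1) / (q + 1) * s ^ (-(g * (q + 1) - (n + 1)))) atTop
      (𝓝 0) := by
    have := (tendsto_rpow_neg_atTop (by linarith : 0 < g * (q + 1) - (n + 1))).const_mul
      (C ^ (q + 1) / (q + 1))
    rwa [mul_zero] at this
  obtain ⟨s₁, hs₁⟩ := eventually_atTop.1 ((hsmall.eventually_lt_const (half_pos hP1)).and
    (eventually_ge_atTop 1))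
  have hs₁1 : 1 ≤ s₁ := (hs₁ s₁ le_rfl).2
  set b := ((m + 1) * (P 1 / 2)) ^ (m / (m + 1)) with hb
  have hb0 : 0 < b := by positivity
  have hflux : ∀ s ≥ s₁, b * s ^ (-k - 1) ≤ y s ^ m := fun s hs => by
    have hs1 : 1 ≤ s := (hs₁ s hs).2
    have hs0 : 0 < s := by linarith
    have h1 : P 1 ≤ P s := hPm.2 (mem_Ioi.2 one_pos) hs0 hs1
    have h2 : s ^ (n + 1) * (x s ^ (q + 1) / (q + 1)) ≤ P 1 / 2 := by
      refine le_trans ?_ (hs₁ s hs).1.le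
      have h3 : x s ^ (q + 1) ≤ C ^ (q + 1) * s ^ (-(g * (q + 1))) := by
        refine (Real.rpow_le_rpow (hxp s hs0).le (hxC s hs0) (by linarith)).trans_eq ?_
        rw [Real.mul_rpow hC.le (by positivity), ← Real.rpow_mul hs0.le]
        ring_nf
      have h4 : s ^ (-(g * (q + 1) - (n + 1))) = s ^ (n + 1) * s ^ (-(g * (q + 1))) := by
        rw [← Real.rpow_natCast, ← Real.rpow_add hs0]
        push_cast
        ring_nf
      rw [h4]
      calc s ^ (n + 1) * (x s ^ (q + 1) / (q + 1))
          ≤ s ^ (n + 1) * (C ^ (q + 1) * s ^ (-(g * (q + 1))) / (q + 1)) := by gcongr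
        _ = _ := by ring
    have hy := hyp s hs0
    have h3 : 0 ≤ k * (s ^ n * y s * x s) := by
      have := hxp s hs0
      positivity
    have h4 : (m + 1) * (P 1 / 2) ≤ s ^ (n + 1) * y s ^ (m + 1) := by
      have : P 1 / 2 ≤ s ^ (n + 1) * (y s ^ (m + 1) / (m + 1)) := by
        simp only [hPdef] at h1 h2 ⊢
        linarith
      rw [mul_div_assoc', le_div_iff₀ (by linarith)] at this
      linarith
    have h5 := Real.rpow_le_rpow (by positivity) h4 (by positivity : 0 ≤ m / (m + 1))
    rw [Real.mul_rpow (x := s ^ (n + 1)) (by positivity) (by positivity), ← Real.rpow_mul hy.le,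
      ← Real.rpow_natCast, ← Real.rpow_mul hs0.le] at h5
    have e1 : (m + 1) * (m / (m + 1)) = m := by field_simp
    have e2 : ((n + 1 : ℕ) : ℝ) * (m / (m + 1)) = k + 1 := by
      rw [hk]; push_cast; field_simp; ring
    rw [e1, e2] at h5
    have h6 : s ^ (-k - 1) = (s ^ (k + 1))⁻¹ := by rw [← Real.rpow_neg hs0.le]; ring_nf
    rw [h6, ← div_eq_mul_inv, div_le_iff₀ (by positivity)]
    linarith
  have hanti : AntitoneOn (fun s => x s - b / k * s ^ (-k)) (Ici s₁) := by
    refine antitoneOn_of_hasDerivAt_nonpos (convex_Ici _) (f' := fun s =>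
      -(y s ^ m) - b / k * (-k * s ^ (-k - 1))) (fun s hs => ?_) fun s hs => ?_ <;>
      have hs0 : 0 < s := by linarith [show s₁ ≤ s from hs]
    · exact ((hP s hs0).dx s (hmem s hs0)).sub
        ((Real.hasDerivAt_rpow_const (Or.inl hs0.ne')).const_mul _)
    · have h1 := hflux s hs
      have : b / k * (-k * s ^ (-k - 1)) = - (b * s ^ (-k - 1)) := by field_simp
      linarith
  have hx0 : Tendsto x atTop (𝓝 0) := by
    have h1 := (tendsto_rpow_neg_atTop (by linarith : 0 < g)).const_mul C
    rw [mul_zero] at h1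
    refine tendsto_of_tendsto_of_tendsto_of_le_of_le' tendsto_const_nhds h1 ?_ ?_
    · filter_upwards [eventually_gt_atTop 0] with s hs using (hxp s hs).le
    · filter_upwards [eventually_gt_atTop 0] with s hs using hxC s hs
  have hlim : Tendsto (fun s => x s - b / k * s ^ (-k)) atTop (𝓝 0) := by
    have := hx0.sub ((tendsto_rpow_neg_atTop hk0).const_mul (b / k))
    simpa using this
  have hge : ∀ s ≥ s₁, b / k * s ^ (-k) ≤ x s := fun s hs => by
    have : 0 ≤ x s - b / k * s ^ (-k) := by
      refine le_of_tendsto hlim ?_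
      filter_upwards [eventually_ge_atTop s] with t ht
      exact hanti hs (hs.trans ht) ht
    linarith
  have hfin : Tendsto (fun s : ℝ => C * s ^ (-(g - k))) atTop (𝓝 0) := by
    have := (tendsto_rpow_neg_atTop (by linarith : 0 < g - k)).const_mul C
    rwa [mul_zero] at this
  obtain ⟨s, hs, hs'⟩ := ((hfin.eventually_lt_const (div_pos hb0 hk0)).and
    (eventually_ge_atTop s₁)).exists
  have hs0 : 0 < s := by linarith
  have h1 := (hge s hs').trans (hxC s hs0)
  have h2 : s ^ (-g) = s ^ (-(g - k)) * s ^ (-k) := by rw [← Real.rpow_add hs0]; ring_nf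
  rw [h2, ← mul_assoc] at h1
  exact absurd (le_of_mul_le_mul_right h1 (by positivity)) (not_le.2 hs)

theorem crossing_zero (hm : 0 < m) (hq : 1 < q) (hα : 0 < α)
    (hsub : 1 < n * m → q * (n * m - 1) < n + m + 2) : Crossing n m q α 0 := by
  obtain ⟨x, y, -, hG | ⟨S, hS, hP, hx⟩⟩ := exists_maximal_posSol n hm hq hα le_rfl
  · rcases le_or_gt (n * m) 1 with h | h
    · exact (not_global_of_low_dim hm h hG).elim
    · exact (not_global_of_subcritical hm hq h (hsub h) hG).elim
  · by_contra hc
    have h1 := hP.tendsto_flux_of_not_crossing hm hS hx hc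
    have h2 : Tendsto (fun s => s ^ n * y s) (𝓝[<] S) (𝓝 0) := by
      have := (((continuous_pow n).tendsto S).mono_left (nhdsWithin_le_nhds (s := Iio S))).mul h1
      rwa [mul_zero] at this
    have hS2 : S / 2 ∈ Ioo 0 S := ⟨by linarith, by linarith⟩
    have h3 : (S / 2) ^ n * y (S / 2) ≤ 0 := by
      refine ge_of_tendsto h2 ?_
      filter_upwards [Ioo_mem_nhdsLT hS2.2] with s hs
      exact hP.monotoneOn_pow_mul hS2 ⟨hS2.1.trans hs.1, hs.2⟩ hs.1.le
    have := hP.y_pos _ hS2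
    have := hS2.1
    have : 0 < (S / 2) ^ n * y (S / 2) := by positivity
    linarith

end

theorem AntitoneOn.exists_tendsto_atTop {f : ℝ → ℝ} {a b : ℝ} (hf : AntitoneOn f (Ici a))
    (hb : ∀ s ≥ a, b ≤ f s) : ∃ l ≥ b, Tendsto f atTop (𝓝 l) ∧ ∀ s ≥ a, l ≤ f s := by
  have hanti : Antitone fun s => f (max s a) := fun s t hst =>
    hf (mem_Ici.2 (le_max_right _ _)) (mem_Ici.2 (le_max_right _ _)) (max_le_max hst le_rfl)
  have hlim := tendsto_atTop_ciInf hanti ⟨b, by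
    rintro _ ⟨s, rfl⟩; exact hb _ (le_max_right _ _)⟩
  have hlim' : Tendsto f atTop (𝓝 (⨅ s, f (max s a))) := by
    refine hlim.congr' ?_
    filter_upwards [eventually_ge_atTop a] with s hs
    rw [max_eq_left hs]
  refine ⟨_, ge_of_tendsto hlim' ?_, hlim', fun s hs => le_of_tendsto hlim' ?_⟩
  · filter_upwards [eventually_ge_atTop a] with s hs using hb s hs
  · filter_upwards [eventually_ge_atTop s] with t ht using hf hs (hs.trans ht) ht

theorem hasDerivAt_extend_zero {f f' : ℝ → ℝ} {S : ℝ} (hS : 0 < S)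
    (hd : ∀ s ∈ Ioo 0 S, HasDerivAt f (f' s) s) (hf : Tendsto f (𝓝[<] S) (𝓝 0))
    (hf' : Tendsto f' (𝓝[<] S) (𝓝 0)) {s : ℝ} (hs : 0 < s) :
    HasDerivAt (fun s => if s < S then f s else 0) (if s < S then f' s else 0) s := by
  have hlt : ∀ t < S, (fun s => if s < S then f s else 0) =ᶠ[𝓝 t] f := fun t ht => by
    filter_upwards [Iio_mem_nhds ht] with u hu using if_pos hu
  rcases lt_trichotomy s S with h | rfl | h
  · rw [if_pos h]
    exact (hd s ⟨hs, h⟩).congr_of_eventuallyEq (hlt s h)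
  · rw [if_neg (lt_irrefl s)]
    have hl : HasDerivWithinAt (fun t => if t < s then f t else 0) 0 (Iic s) s := by
      have hd' : ∀ t ∈ Ioo 0 s, HasDerivAt (fun t => if t < s then f t else 0) (f' t) t :=
        fun t ht => (hd t ht).congr_of_eventuallyEq (hlt t ht.2)
      refine hasDerivWithinAt_Iic_of_tendsto_deriv (s := Ioo 0 s)
        (fun t ht => (hd' t ht).differentiableAt.differentiableWithinAt) ?_ (Ioo_mem_nhdsLT hS) ?_
      · have : Tendsto (fun t => if t < s then f t else 0) (𝓝[<] s) (𝓝 0) := by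
          refine hf.congr' ?_
          filter_upwards [self_mem_nhdsWithin] with t ht using (if_pos ht).symm
        have h2 : ContinuousWithinAt (fun t => if t < s then f t else 0) (Iio s) s := by
          rw [ContinuousWithinAt, if_neg (lt_irrefl s)]; exact this
        exact h2.mono Ioo_subset_Iio_self
      · refine hf'.congr' ?_
        filter_upwards [Ioo_mem_nhdsLT hS] with t ht using (hd' t ht).deriv.symm
    have hr : HasDerivWithinAt (fun t => if t < s then f t else 0) 0 (Ici s) s :=
      (hasDerivWithinAt_const s (Ici s) (0 : ℝ)).congr (fun t ht => if_neg (not_lt.2 ht))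
        (if_neg (lt_irrefl s))
    have := hl.union hr
    rwa [Iic_union_Ici, hasDerivWithinAt_univ] at this
  · rw [if_neg h.not_gt]
    refine (hasDerivAt_const s (0 : ℝ)).congr_of_eventuallyEq ?_
    filter_upwards [Ioi_mem_nhds h] with u hu using if_neg (not_lt.2 (le_of_lt hu))

/-- A nonnegative nonincreasing global solution, together with its flux. -/
structure RadSol (n : ℕ) (m q α θ : ℝ) (x y : ℝ → ℝ) : Prop where
  y_zero : y 0 = 0
  cont_x : ContinuousWithinAt x (Ici 0) 0
  cont_y : ContinuousWithinAt y (Ici 0) 0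
  x_nonneg : ∀ s > 0, 0 ≤ x s
  y_nonneg : ∀ s > 0, 0 ≤ y s
  dx : ∀ s > 0, HasDerivAt x (-(y s ^ m)) s
  dy : ∀ s > 0, HasDerivAt y (reac q α θ (x s) - θ * (s * y s ^ m) - n / s * y s) s

section
variable {n : ℕ} {m q α θ S : ℝ} {x y : ℝ → ℝ}

theorem RadSol.of_posSol (h : ∀ S > 0, PosSol n m q α θ S x y) : RadSol n m q α θ x y := by
  have hmem : ∀ s : ℝ, 0 < s → s ∈ Ioo 0 (s + 1) := fun s hs => ⟨hs, by linarith⟩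
  have h1 : ∀ s : ℝ, 0 < s → PosSol n m q α θ (s + 1) x y := fun s hs => h _ (by linarith)
  have h0 := h 1 one_pos
  exact ⟨h0.y_zero, h0.cont_x, h0.cont_y, fun s hs => ((h1 s hs).x_pos s (hmem s hs)).le,
    fun s hs => ((h1 s hs).y_pos s (hmem s hs)).le, fun s hs => (h1 s hs).dx s (hmem s hs),
    fun s hs => (h1 s hs).dy s (hmem s hs)⟩

theorem RadSol.antitoneOn (h : RadSol n m q α θ x y) : AntitoneOn x (Ioi 0) :=
  antitoneOn_of_hasDerivAt_nonpos (convex_Ioi 0) h.dx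
    fun s hs => neg_nonpos.2 (Real.rpow_nonneg (h.y_nonneg s hs) _)

theorem RadSol.hasDerivAt_pow_mul (h : RadSol n m q α θ x y) {s : ℝ} (hs : 0 < s) :
    HasDerivAt (fun s => s ^ n * y s) (s ^ n * (reac q α θ (x s) - θ * (s * y s ^ m))) s :=
  (h.dy s hs).pow_mul_flux hs

/-- A global nonnegative solution tends to zero. -/
theorem RadSol.tendsto_zero (hq : 1 < q) (hα : 0 < α) (hθ : 0 < θ) (hm : 0 < m)
    (h : RadSol n m q α θ x y) : Tendsto x atTop (𝓝 0) := by
  obtain ⟨l, hl0, hl, hle⟩ := (h.antitoneOn.mono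
    (fun s hs => mem_Ioi.2 (one_pos.trans_le hs) : Ici (1 : ℝ) ⊆ Ioi 0)).exists_tendsto_atTop
    (b := 0) fun s hs => h.x_nonneg s (one_pos.trans_le hs)
  rcases hl0.eq_or_lt with rfl | hlp
  · exact hl
  exfalso
  have hlq : 0 < l ^ q := Real.rpow_pos_of_pos hlp q
  have hsmall : Tendsto (fun s => θ * (n + 1) * (x s - l)) atTop (𝓝 0) := by
    have := (hl.sub_const l).const_mul (θ * (n + 1))
    rwa [sub_self, mul_zero] at this
  obtain ⟨s₁, hs₁⟩ := eventually_atTop.1 ((hsmall.eventually_lt_const (half_pos hlq)).and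
    (eventually_ge_atTop 1))
  have hs₁1 : 1 ≤ s₁ := (hs₁ s₁ le_rfl).2
  set c := l ^ q / 2 / (n + 1) with hc
  have hn : (0 : ℝ) < n + 1 := by positivity
  have hc0 : 0 < c := by positivity
  have hmono : MonotoneOn (fun s => s ^ n * y s - θ * (s ^ (n + 1) * (x s - l)) - c * s ^ (n + 1))
      (Ici s₁) := by
    refine monotoneOn_of_hasDerivAt_nonneg (convex_Ici _) (f' := fun s =>
      s ^ n * (reac q α θ (x s) - θ * (s * y s ^ m)) - θ * ((n + 1 : ℕ) * s ^ n * (x s - l)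
        + s ^ (n + 1) * (-(y s ^ m))) - c * ((n + 1 : ℕ) * s ^ n)) (fun s hs => ?_) fun s hs => ?_
    · have hs0 : 0 < s := by linarith [show s₁ ≤ s from hs]
      exact ((h.hasDerivAt_pow_mul hs0).sub
        (((hasDerivAt_pow (n + 1) s).mul ((h.dx s hs0).sub_const l)).const_mul θ)).sub
          ((hasDerivAt_pow (n + 1) s).const_mul c)
    · have hs0 : 0 < s := by linarith [show s₁ ≤ s from hs]
      obtain ⟨h1, h2⟩ := hs₁ s hs
      have h3 : l ^ q ≤ x s ^ q := Real.rpow_le_rpow hlp.le (hle s h2) (by linarith)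
      have h4 : 0 ≤ θ * α * x s := by have := h.x_nonneg s hs0; positivity
      have h5 : 0 ≤ reac q α θ (x s) - θ * (n + 1) * (x s - l) - l ^ q / 2 := by
        rw [reac]; linarith
      have h6 : c * (n + 1) = l ^ q / 2 := by rw [hc]; field_simp
      have := mul_nonneg (pow_nonneg hs0.le n) h5
      push_cast
      rw [← h6] at this
      rw [pow_succ]
      linarith
  set K := s₁ ^ n * y s₁ - θ * (s₁ ^ (n + 1) * (x s₁ - l)) - c * s₁ ^ (n + 1) with hK
  have hY : ∀ s ≥ s₁, c * s - |K| ≤ y s := fun s hs => by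
    have hs0 : 0 < s := by linarith
    have h1 : K ≤ s ^ n * y s - θ * (s ^ (n + 1) * (x s - l)) - c * s ^ (n + 1) :=
      hmono (mem_Ici.2 le_rfl) hs hs
    have h2 : 0 ≤ θ * (s ^ (n + 1) * (x s - l)) := by
      have := sub_nonneg.2 (hle s (hs₁1.trans hs))
      positivity
    have h3 : (1 : ℝ) ≤ s ^ n := one_le_pow₀ (hs₁1.trans hs)
    have h4 : s ^ n * (c * s - |K|) ≤ s ^ n * y s := by
      have := mul_le_mul_of_nonneg_right h3 (abs_nonneg K)
      rw [mul_sub]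
      have := neg_abs_le K
      have : s ^ n * (c * s) = c * s ^ (n + 1) := by ring
      linarith
    exact le_of_mul_le_mul_left h4 (by positivity)
  set s₂ := max s₁ ((1 + |K|) / c) with hs₂
  have hs₂1 : 1 ≤ s₂ := hs₁1.trans (le_max_left _ _)
  have hanti : AntitoneOn (fun s => x s + s) (Ici s₂) := by
    refine antitoneOn_of_hasDerivAt_nonpos (convex_Ici _) (f' := fun s => -(y s ^ m) + 1)
      (fun s hs => ?_) fun s hs => ?_ <;> have hs' : s₂ ≤ s := hs
    · exact (h.dx s (by linarith)).add (hasDerivAt_id s)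
    · have h1 : (1 + |K|) / c ≤ s := (le_max_right _ _).trans hs'
      rw [div_le_iff₀ hc0] at h1
      have h2 : 1 ≤ y s := by linarith [hY s ((le_max_left _ _).trans hs')]
      linarith [Real.one_le_rpow h2 hm.le]
  have h1 := hanti (mem_Ici.2 le_rfl) (mem_Ici.2 (by have := h.x_nonneg s₂ (by linarith); linarith :
    s₂ ≤ s₂ + x s₂ + 1)) (by have := h.x_nonneg s₂ (by linarith); linarith)
  have h2 := h.x_nonneg (s₂ + x s₂ + 1) (by have := h.x_nonneg s₂ (by linarith); linarith)
  simp only at h1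
  linarith

/-- Outside the slow-decay regime the flux eventually dominates the drift. -/
theorem eventually_le_flux_of_not_slowDecay (hq : 1 < q) (hα : 0 < α) (hθ : 0 < θ) (hm : 0 < m)
    (hαn : α < n + 1) (h : ∀ S > 0, PosSol n m q α θ S x y) (hs : ¬ SlowDecay n m q α θ) :
    ∀ᶠ s in atTop, θ * s * x s ≤ y s := by
  have hx := (RadSol.of_posSol h).tendsto_zero hq hα hθ hm
  have hx' : Tendsto (fun s => x s ^ (q - 1)) atTop (𝓝 0) := by
    have := hx.rpow_const (p := q - 1) (Or.inr (by linarith))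
    rwa [Real.zero_rpow (by linarith)] at this
  filter_upwards [hx'.eventually_lt_const (mul_pos hθ (by linarith : 0 < n + 1 - α)),
    eventually_gt_atTop 0] with s h1 h2
  by_contra! hlt
  exact hs ⟨s + 1, x, y, s, h _ (by linarith), ⟨h2, by linarith⟩, h1, hlt⟩

theorem not_global_of_m_lt_one (hθ : 0 < θ) (hm : 0 < m) (hm1 : m < 1)
    (h : ∀ S > 0, PosSol n m q α θ S x y) (hy : ∀ᶠ s in atTop, θ * s * x s ≤ y s) : False := by
  have hR := RadSol.of_posSol h
  have hxp : ∀ s > 0, 0 < x s := fun s hs => (h (s + 1) (by linarith)).x_pos s ⟨hs, by linarith⟩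
  obtain ⟨s₁, hs₁⟩ := eventually_atTop.1 (hy.and (eventually_ge_atTop (max 1 (1 / θ))))
  have hs₁1 : 1 ≤ s₁ := (le_max_left _ _).trans (hs₁ s₁ le_rfl).2
  have hanti : AntitoneOn (fun s => x s ^ (1 - m) + (1 - m) * s) (Ici s₁) := by
    refine antitoneOn_of_hasDerivAt_nonpos (convex_Ici _) (f' := fun s =>
      -(y s ^ m) * (1 - m) * x s ^ (1 - m - 1) + (1 - m) * 1) (fun s hs => ?_) fun s hs => ?_ <;>
      have hs0 : 0 < s := by linarith [show s₁ ≤ s from hs]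
    · exact ((hR.dx s hs0).rpow_const (Or.inl (hxp s hs0).ne')).add
        ((hasDerivAt_id s).const_mul _)
    · obtain ⟨h1, h2⟩ := hs₁ s hs
      have hx := hxp s hs0
      have h3 : 1 ≤ θ * s := by
        have := (le_max_right _ _).trans h2
        rw [div_le_iff₀ hθ] at this
        linarith
      have h4 : x s ≤ y s := le_trans (le_mul_of_one_le_left hx.le h3) h1
      have h5 : x s ^ m ≤ y s ^ m := Real.rpow_le_rpow hx.le h4 hm.le
      have h6 : x s ^ m * x s ^ (1 - m - 1) = 1 := by
        rw [← Real.rpow_add hx]; ring_nf; exact Real.rpow_zero _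
      have h7 : x s ^ m * x s ^ (1 - m - 1) ≤ y s ^ m * x s ^ (1 - m - 1) := by gcongr
      rw [h6] at h7
      have := mul_le_mul_of_nonneg_left h7 (by linarith : 0 ≤ 1 - m)
      linarith
  have hpos : 0 < x s₁ ^ (1 - m) / (1 - m) :=
    div_pos (Real.rpow_pos_of_pos (hxp s₁ (by linarith)) _) (by linarith)
  have h1 := hanti (mem_Ici.2 le_rfl) (mem_Ici.2 (by linarith :
    s₁ ≤ s₁ + x s₁ ^ (1 - m) / (1 - m))) (by linarith)
  have h2 := Real.rpow_pos_of_pos (hxp (s₁ + x s₁ ^ (1 - m) / (1 - m)) (by linarith)) (1 - m)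
  have h3 : (1 - m) * (x s₁ ^ (1 - m) / (1 - m)) = x s₁ ^ (1 - m) :=
    mul_div_cancel₀ _ (by linarith)
  simp only at h1
  linarith

theorem not_touch_of_one_lt_m (hα : 0 < α) (hθ : 0 < θ) (hm1 : 1 < m) (hS : 0 < S)
    (h : PosSol n m q α θ S x y) (hx : Tendsto x (𝓝[<] S) (𝓝 0))
    (hy : Tendsto y (𝓝[<] S) (𝓝 0)) : False := by
  obtain ⟨s₁, hs₁S, hs₁⟩ := mem_nhdsLT_iff_exists_Ioo_subset.1
    ((hy.eventually_lt_const one_pos).and (Ioo_mem_nhdsLT (half_lt_self hS)))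
  set K := 1 + θ * S + 2 * n / S with hK
  have hmem : ∀ s ∈ Ioo s₁ S, s ∈ Ioo 0 S := fun s hs => by
    have := (hs₁ hs).2.1
    exact ⟨by linarith, hs.2⟩
  have hmono : MonotoneOn (fun s => Real.exp (K * s) * (x s + y s)) (Ioo s₁ S) := by
    refine monotoneOn_of_hasDerivAt_nonneg (convex_Ioo _ _) (f' := fun s =>
      Real.exp (K * s) * (K * 1) * (x s + y s) + Real.exp (K * s) * (-(y s ^ m) +
        (reac q α θ (x s) - θ * (s * y s ^ m) - n / s * y s))) (fun s hs => ?_) fun s hs => ?_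
    · exact (((hasDerivAt_id s).const_mul K).exp).mul
        ((h.dx s (hmem s hs)).add (h.dy s (hmem s hs)))
    · have hx0 := h.x_pos s (hmem s hs)
      have hy0 := h.y_pos s (hmem s hs)
      have h0 := (hmem s hs).1
      have h1 : y s ^ m ≤ y s := by
        have := Real.rpow_le_rpow_of_exponent_ge hy0 (hs₁ hs).1.le hm1.le
        rwa [Real.rpow_one] at this
      have h2 : 0 ≤ reac q α θ (x s) := by rw [reac]; positivity
      have h3 : θ * (s * y s ^ m) ≤ θ * (S * y s) := by
        have := hs.2.le
        gcongr
      have h4 : (n : ℝ) / s ≤ 2 * n / S := by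
        rw [div_le_div_iff₀ h0 hS]
        have := (hs₁ hs).2.1
        have hn : (0 : ℝ) ≤ n := n.cast_nonneg
        nlinarith
      have h5 : (n : ℝ) / s * y s ≤ 2 * n / S * y s := by gcongr
      have h6 : 0 ≤ K * x s := by rw [hK]; positivity
      have h7 : 0 ≤ K * (x s + y s) + (-(y s ^ m) +
        (reac q α θ (x s) - θ * (s * y s ^ m) - n / s * y s)) := by
        have : K * y s = y s + θ * (S * y s) + 2 * n / S * y s := by rw [hK]; ring
        linarith
      have := mul_nonneg (Real.exp_pos (K * s)).le h7
      linarith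
  have hlim : Tendsto (fun s => Real.exp (K * s) * (x s + y s)) (𝓝[<] S) (𝓝 0) := by
    have h1 : Tendsto (fun s => Real.exp (K * s)) (𝓝[<] S) (𝓝 (Real.exp (K * S))) :=
      ((by fun_prop : Continuous fun s => Real.exp (K * s)).tendsto S).mono_left nhdsWithin_le_nhds
    have := h1.mul (hx.add hy)
    rwa [add_zero, mul_zero] at this
  obtain ⟨s, hs⟩ := exists_between (show s₁ < S from hs₁S)
  have hle : Real.exp (K * s) * (x s + y s) ≤ 0 := by
    refine ge_of_tendsto hlim ?_
    filter_upwards [Ioo_mem_nhdsLT hs.2] with t ht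
    exact hmono hs ⟨hs.1.trans ht.1, ht.2⟩ ht.1.le
  have := h.x_pos s (hmem s hs)
  have := h.y_pos s (hmem s hs)
  have := Real.exp_pos (K * s)
  have : 0 < Real.exp (K * s) * (x s + y s) := by positivity
  linarith

theorem PosSol.radSol_extend_zero (hm : 0 < m) (hq : 1 < q) (hS : 0 < S)
    (h : PosSol n m q α θ S x y)
    (hx : Tendsto x (𝓝[<] S) (𝓝 0)) (hy : Tendsto y (𝓝[<] S) (𝓝 0)) :
    RadSol n m q α θ (fun s => if s < S then x s else 0) (fun s => if s < S then y s else 0) := by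
  have hev : ∀ f : ℝ → ℝ, f =ᶠ[𝓝[Ici 0] 0] fun s => if s < S then f s else 0 := fun f => by
    filter_upwards [mem_nhdsWithin_of_mem_nhds (Iio_mem_nhds hS)] with s hs using (if_pos hs).symm
  have hym : Tendsto (fun s => y s ^ m) (𝓝[<] S) (𝓝 0) := by
    have := hy.rpow_const (p := m) (Or.inr hm.le)
    rwa [Real.zero_rpow hm.ne'] at this
  have hxq : Tendsto (fun s => x s ^ q) (𝓝[<] S) (𝓝 0) := by
    have := hx.rpow_const (p := q) (Or.inr (by linarith))
    rwa [Real.zero_rpow (by linarith)] at this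
  have hid : Tendsto (fun s : ℝ => s) (𝓝[<] S) (𝓝 S) := tendsto_nhdsWithin_of_tendsto_nhds tendsto_id
  refine ⟨by simp [hS, h.y_zero], h.cont_x.congr_of_eventuallyEq (hev x).symm (by simp [hS]),
    h.cont_y.congr_of_eventuallyEq (hev y).symm (by simp [hS]), fun s hs => ?_, fun s hs => ?_,
    fun s hs => ?_, fun s hs => ?_⟩
  · split_ifs with h1
    exacts [(h.x_pos s ⟨hs, h1⟩).le, le_rfl]
  · split_ifs with h1
    exacts [(h.y_pos s ⟨hs, h1⟩).le, le_rfl]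
  · refine (hasDerivAt_extend_zero hS h.dx hx (by simpa using hym.neg) hs).congr_deriv ?_
    split_ifs <;> simp [Real.zero_rpow hm.ne']
  · refine (hasDerivAt_extend_zero hS h.dy hy ?_ hs).congr_deriv ?_
    · unfold reac
      have := ((hxq.add (hx.const_mul (θ * α))).sub ((hid.mul hym).const_mul θ)).sub
        ((tendsto_const_nhds (x := (n : ℝ))).div hid hS.ne' |>.mul hy)
      simpa using this
    · split_ifs <;> simp [reac, Real.zero_rpow hm.ne', Real.zero_rpow (by linarith : q ≠ 0)]

/-- The shooting alternative that yields the connecting profile. -/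
theorem exists_scaled_profile (hm : 0 < m) (hq : 1 < q) (hα : 0 < α)
    (hαn : α < n + 1) (hsub : 1 < n * m → q * (n * m - 1) < n + m + 2) :
    ∃ θ > 0, ∃ x y, x 0 = 1 ∧ RadSol n m q α θ x y ∧
      (m < 1 → ∃ R > 0, ∀ s ≥ R, x s = 0) ∧
      (1 < m → (∀ s > 0, 0 < x s ∧ 0 < y s) ∧ Tendsto x atTop (𝓝 0) ∧
        ∀ᶠ s in atTop, θ * s * x s ≤ y s) := by
  obtain ⟨θ, hθ, hsl, hcr⟩ := exists_shooting hm hq hα hαn (crossing_zero hm hq hα hsub)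
  refine ⟨θ, hθ, ?_⟩
  obtain ⟨x, y, -, hG | ⟨S, hS, hP, hx⟩⟩ := exists_maximal_posSol n hm hq hα hθ.le
  · have hy := eventually_le_flux_of_not_slowDecay hq hα hθ hm hαn hG hsl
    have hR := RadSol.of_posSol hG
    refine ⟨x, y, (hG 1 one_pos).x_zero, hR,
      fun h => (not_global_of_m_lt_one hθ hm h hG hy).elim, fun _ => ⟨fun s hs => ?_,
        hR.tendsto_zero hq hα hθ hm, hy⟩⟩
    have hs' : s ∈ Ioo 0 (s + 1) := ⟨hs, by linarith⟩
    exact ⟨(hG _ (by linarith)).x_pos s hs', (hG _ (by linarith)).y_pos s hs'⟩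
  · have hy := hP.tendsto_flux_of_not_crossing hm hS hx hcr
    refine ⟨_, _, by simp [hS, hP.x_zero], hP.radSol_extend_zero hm hq hS hx hy,
      fun _ => ⟨S, hS, fun s hs => if_neg (not_lt.2 hs)⟩,
      fun h => (not_touch_of_one_lt_m hα hθ h hS hP hx hy).elim⟩

/-- Undoing the normalisation of the initial value. -/
theorem RadSol.scale (hθ : 0 < θ) (hm : 0 < m) (hq : 1 < q) (h : RadSol n m q α θ x y) :
    ∃ a > 0, ∃ b > 0, ∃ c > 0, b * (θ * c) = a ∧
      RadSol n m q α 1 (fun r => a * x (c * r)) (fun r => b * y (c * r)) := by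
  set a := θ ^ (-(1 / (q - 1))) with ha
  have hq1 : 0 < q - 1 := by linarith
  have ha0 : 0 < a := Real.rpow_pos_of_pos hθ _
  have haq : a ^ (q - 1) * θ = 1 := by
    rw [ha, ← Real.rpow_mul hθ.le, ← Real.rpow_add_one hθ.ne']
    have : -(1 / (q - 1)) * (q - 1) + 1 = 0 := by field_simp; ring
    rw [this, Real.rpow_zero]
  set b := a ^ ((q + 1) / (m + 1)) with hb
  set c := a ^ ((q * m - 1) / (m + 1)) with hc
  have hb0 : 0 < b := Real.rpow_pos_of_pos ha0 _
  have hc0 : 0 < c := Real.rpow_pos_of_pos ha0 _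
  have hbc : b * c = a ^ q := by
    rw [hb, hc, ← Real.rpow_add ha0]; congr 1; field_simp; ring
  have hac : a * c = b ^ m := by
    rw [hb, hc, ← Real.rpow_one_add' ha0.le, ← Real.rpow_mul ha0.le]
    · congr 1; field_simp; ring
    · have : 1 + (q * m - 1) / (m + 1) = (m * (1 + q)) / (m + 1) := by field_simp; ring
      rw [this]; positivity
  have hbθ : b * (θ * c) = a := by
    have : a ^ q = a ^ (q - 1) * a := by rw [← Real.rpow_add_one ha0.ne']; ring_nf
    calc b * (θ * c) = b * c * θ := by ring
      _ = a ^ (q - 1) * θ * a := by rw [hbc, this]; ring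
      _ = a := by rw [haq, one_mul]
  have hcont : ∀ f : ℝ → ℝ, ContinuousWithinAt f (Ici 0) 0 →
      ContinuousWithinAt (fun r => f (c * r)) (Ici 0) 0 := fun f hf => by
    have hf' : ContinuousWithinAt f (Ici 0) (c * 0) := by rwa [mul_zero]
    exact hf'.comp (f := fun r : ℝ => c * r) (by fun_prop) fun r hr => mul_nonneg hc0.le hr
  have hder : ∀ f f' r, HasDerivAt f f' (c * r) → HasDerivAt (fun r => f (c * r)) (f' * c) r :=
    fun f f' r hf => by
      have := hf.comp r ((hasDerivAt_id r).const_mul c)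
      rwa [mul_one] at this
  refine ⟨a, ha0, b, hb0, c, hc0, hbθ, by simp [h.y_zero], (hcont x h.cont_x).const_mul a,
    (hcont y h.cont_y).const_mul b, fun r hr => mul_nonneg ha0.le (h.x_nonneg _ (by positivity)),
    fun r hr => mul_nonneg hb0.le (h.y_nonneg _ (by positivity)), fun r hr => ?_, fun r hr => ?_⟩ <;>
    have hcr : 0 < c * r := mul_pos hc0 hr <;> have hy := h.y_nonneg _ hcr <;>
    have hx := h.x_nonneg _ hcr
  · refine ((hder _ _ r (h.dx _ hcr)).const_mul a).congr_deriv ?_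
    rw [Real.mul_rpow hb0.le hy, ← hac]; ring
  · refine ((hder _ _ r (h.dy _ hcr)).const_mul b).congr_deriv ?_
    rw [Real.mul_rpow hb0.le hy, ← hac, reac, reac, Real.mul_rpow ha0.le hx, ← hbc]
    have e : b * ((n : ℝ) / (c * r) * y (c * r) * c) = n / r * (b * y (c * r)) := by
      field_simp
    have e1 : b * (θ * α * x (c * r) * c) = 1 * α * (a * x (c * r)) := by
      rw [← hbθ]; ring
    have e2 : b * (θ * (c * r * y (c * r) ^ m) * c) = 1 * (r * (a * c * y (c * r) ^ m)) := by
      rw [← hbθ]; ring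
    linear_combination e1 - e2 - e

end

theorem phiP_neg_rpow {p m Y : ℝ} (hm : 0 < m) (hmp : m * (p - 1) = 1) (hY : 0 ≤ Y) :
    phiP p (-(Y ^ m)) = -Y := by
  rcases hY.eq_or_lt with rfl | hY
  · simp [phiP, Real.zero_rpow hm.ne']
  · have h0 : 0 < Y ^ m := Real.rpow_pos_of_pos hY m
    rw [phiP, abs_neg, abs_of_pos h0, mul_neg, ← Real.rpow_add_one h0.ne', ← Real.rpow_mul hY.le,
      show m * (p - 2 + 1) = 1 by linarith, Real.rpow_one]

theorem contDiffOn_one_Ici_of_hasDerivAt {f f' : ℝ → ℝ} (hf : ∀ r > 0, HasDerivAt f (f' r) r)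
    (h0 : ContinuousWithinAt f (Ici 0) 0) (hc : ContinuousOn f' (Ioi 0))
    (hl : Tendsto f' (𝓝[>] 0) (𝓝 (f' 0))) :
    ContDiffOn ℝ 1 f (Ici 0) ∧ ∀ r ∈ Ici 0, derivWithin f (Ici 0) r = f' r := by
  have hd : ∀ r ∈ Ici (0 : ℝ), HasDerivWithinAt f (f' r) (Ici 0) r := fun r hr => by
    rcases (show (0 : ℝ) ≤ r from hr).eq_or_lt with rfl | hr
    · refine hasDerivWithinAt_Ici_of_tendsto_deriv (s := Ioi 0)
        (fun t ht => (hf t ht).differentiableAt.differentiableWithinAt)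
        (h0.mono Ioi_subset_Ici_self) self_mem_nhdsWithin ?_
      refine hl.congr' ?_
      filter_upwards [self_mem_nhdsWithin] with t ht using (hf t ht).deriv.symm
    · exact (hf r hr).hasDerivWithinAt
  have he : ∀ r ∈ Ici (0 : ℝ), derivWithin f (Ici 0) r = f' r := fun r hr =>
    (hd r hr).derivWithin (uniqueDiffOn_Ici 0 r hr)
  refine ⟨(contDiffOn_one_iff_derivWithin (uniqueDiffOn_Ici 0)).2
    ⟨fun r hr => (hd r hr).differentiableWithinAt, ContinuousOn.congr (fun r hr => ?_) he⟩, he⟩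
  rcases (show (0 : ℝ) ≤ r from hr).eq_or_lt with rfl | hr
  · rw [← Ioi_insert, continuousWithinAt_insert_self]
    exact hl
  · exact (hc.continuousAt (Ioi_mem_nhds hr)).continuousWithinAt

section
variable {n : ℕ} {m q α θ : ℝ} {x y : ℝ → ℝ}

theorem RadSol.isGlobalSolution {p : ℝ} (hm : 0 < m) (hmp : m * (p - 1) = 1) (hq : 1 < q)
    (h : RadSol n m q α 1 x y) : IsGlobalSolution (n + 1) p q α (x 0) x := by
  have hy0 : Tendsto y (𝓝[>] 0) (𝓝 0) := by
    have := h.cont_y.mono Ioi_subset_Ici_self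
    rwa [ContinuousWithinAt, h.y_zero] at this
  have hx0 : Tendsto x (𝓝[>] 0) (𝓝 (x 0)) := h.cont_x.mono Ioi_subset_Ici_self
  have hcy : ContinuousOn y (Ioi 0) := fun s hs => (h.dy s hs).continuousAt.continuousWithinAt
  have hcx : ContinuousOn x (Ioi 0) := fun s hs => (h.dx s hs).continuousAt.continuousWithinAt
  have hym0 : Tendsto (fun s => y s ^ m) (𝓝[>] 0) (𝓝 0) := by
    have := hy0.rpow_const (p := m) (Or.inr hm.le)
    rwa [Real.zero_rpow hm.ne'] at this
  have hcym : ContinuousOn (fun s => y s ^ m) (Ioi 0) := hcy.rpow_const fun _ _ => Or.inr hm.le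
  have hid : Tendsto (fun s : ℝ => s) (𝓝[>] 0) (𝓝 0) :=
    tendsto_nhdsWithin_of_tendsto_nhds tendsto_id
  obtain ⟨hC, hC'⟩ := contDiffOn_one_Ici_of_hasDerivAt h.dx h.cont_x hcym.neg (by
    have := hym0.neg
    simpa [h.y_zero, Real.zero_rpow hm.ne'] using this)
  have hphi : ∀ r ∈ Ici (0 : ℝ), phiP p (derivWithin x (Ici 0) r) = -y r := fun r hr => by
    rw [hC' r hr]
    rcases (show (0 : ℝ) ≤ r from hr).eq_or_lt with rfl | hr
    · exact phiP_neg_rpow hm hmp h.y_zero.ge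
    · exact phiP_neg_rpow hm hmp (h.y_nonneg r hr)
  set G : ℝ → ℝ := fun s => reac q α 1 (x s) - 1 * (s * y s ^ m) with hG
  have hrc := continuous_reac (q := q) (α := α) (θ := 1) (by linarith)
  have hGl : Tendsto G (𝓝[>] 0) (𝓝 (reac q α 1 (x 0))) := by
    have := ((hrc.tendsto _).comp hx0).sub ((hid.mul hym0).const_mul 1)
    simpa [hG] using this
  have hGc : ContinuousOn G (Ioi 0) :=
    (hrc.comp_continuousOn hcx).sub ((continuousOn_id.mul hcym).const_mul 1)
  have hn : (0 : ℝ) < n + 1 := by positivity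
  have hquot : Tendsto (fun s => s ^ n * y s / s ^ (n + 1)) (𝓝[>] 0)
      (𝓝 (reac q α 1 (x 0) / (n + 1))) := by
    have hpow : ∀ k : ℕ, Tendsto (fun s : ℝ => s ^ k) (𝓝[>] 0) (𝓝 (0 ^ k)) := fun k =>
      hid.pow k
    refine HasDerivAt.lhopital_zero_nhdsGT (f' := fun s => s ^ n * G s)
      (g' := fun s => ((n + 1 : ℕ) : ℝ) * s ^ n) ?_ ?_ ?_ ?_ ?_ ?_
    · filter_upwards [self_mem_nhdsWithin] with s hs using h.hasDerivAt_pow_mul hs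
    · filter_upwards with s using hasDerivAt_pow (n + 1) s
    · filter_upwards [self_mem_nhdsWithin] with s hs
      have : (0 : ℝ) < s := hs
      positivity
    · have := (hpow n).mul hy0
      rwa [mul_zero] at this
    · have := hpow (n + 1)
      rwa [zero_pow (Nat.succ_ne_zero n)] at this
    · refine (hGl.div_const ((n : ℝ) + 1)).congr' ?_
      filter_upwards [self_mem_nhdsWithin] with s hs
      have : s ^ n ≠ 0 := (pow_pos hs n).ne'
      push_cast
      rw [mul_comm ((n : ℝ) + 1), mul_div_mul_left _ _ this]
  set D : ℝ → ℝ := fun s => if s = 0 then reac q α 1 (x 0) / (n + 1) else G s - n / s * y s with hD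
  have hDe : ∀ s > 0, D s = G s - n / s * y s := fun s hs => if_neg (ne_of_gt hs)
  obtain ⟨hF, hF'⟩ := contDiffOn_one_Ici_of_hasDerivAt (f := fun s => -y s) (f' := fun s => -D s)
    (fun s hs => by rw [hDe s hs]; exact (h.dy s hs).neg) h.cont_y.neg
    ((hGc.sub ((continuousOn_const.div continuousOn_id fun s hs => ne_of_gt hs).mul hcy)).congr
      hDe).neg (by
      have h1 := hGl.sub (hquot.const_mul (n : ℝ))
      have h2 : reac q α 1 (x 0) - n * (reac q α 1 (x 0) / (n + 1)) = D 0 := by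
        simp only [hD, if_true]; field_simp; ring
      rw [h2] at h1
      refine (h1.congr' ?_).neg
      filter_upwards [self_mem_nhdsWithin] with s hs
      have hs0 : (0 : ℝ) < s := hs
      rw [hDe s hs]
      field_simp
      ring)
  refine ⟨hC, hF.congr hphi, fun r hr => ?_, rfl, ?_⟩
  · have hr' : r ∈ Ici (0 : ℝ) := (show (0 : ℝ) < r from hr).le
    rw [derivWithin_congr hphi (hphi r hr'), hF' r hr', hphi r hr', hC' r hr', hDe r hr]
    have hx := h.x_nonneg r hr
    have e : |x r| ^ (q - 1) * x r = x r ^ q := by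
      rw [abs_of_nonneg hx]
      rcases hx.eq_or_lt with h0 | h0
      · rw [← h0, mul_zero, Real.zero_rpow (by linarith)]
      · rw [← Real.rpow_add_one h0.ne']; ring_nf
    rw [e]
    simp only [hG, reac]
    push_cast
    ring
  · rw [hC' 0 (mem_Ici.2 le_rfl), h.y_zero, Real.zero_rpow hm.ne', neg_zero]

end

/-- A nonpositive function that can only leave through zero with negative slope stays nonpositive. -/
theorem nonpos_of_barrier {f f' : ℝ → ℝ} {a : ℝ} (hd : ∀ t ≥ a, HasDerivAt f (f' t) t)
    (ha : f a ≤ 0) (hb : ∀ t ≥ a, (∀ s ∈ Icc a t, f s ≤ 0) → f t = 0 → f' t < 0) :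
    ∀ t ≥ a, f t ≤ 0 := by
  by_contra! hcon
  obtain ⟨b, hab, hfb⟩ := hcon
  set A : Set ℝ := {t | a ≤ t ∧ 0 < f t} with hA
  have hbdd : BddBelow A := ⟨a, fun t ht => ht.1⟩
  have hne : A.Nonempty := ⟨b, hab, hfb⟩
  have hτ : a ≤ sInf A := le_csInf hne fun t ht => ht.1
  have hlt : ∀ s, a ≤ s → s < sInf A → f s ≤ 0 := fun s hs hsA => by
    by_contra! h
    exact absurd (csInf_le hbdd ⟨hs, h⟩) (not_le.2 hsA)
  have hτ0 : f (sInf A) ≤ 0 := by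
    rcases hτ.eq_or_lt with h | h
    · rw [← h]; exact ha
    · refine le_of_tendsto ((hd _ hτ).continuousAt.tendsto.mono_left nhdsWithin_le_nhds :
        Tendsto f (𝓝[<] (sInf A)) _) ?_
      filter_upwards [Ioo_mem_nhdsLT h] with s hs using hlt s hs.1.le hs.2
  have hev : ∀ᶠ t in 𝓝[>] (sInf A), f t ≤ 0 := by
    rcases hτ0.lt_or_eq with h | h
    · exact ((hd _ hτ).continuousAt.eventually_lt_const h).filter_mono nhdsWithin_le_nhds |>.mono
        fun t ht => le_of_lt ht
    · have hneg := hb _ hτ (fun s hs => by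
        rcases hs.2.lt_or_eq with h' | h'
        exacts [hlt s hs.1 h', h' ▸ hτ0]) h
      have hs := (hasDerivAt_iff_tendsto_slope.1 (hd _ hτ)).eventually_lt_const hneg
      have hs' := hs.filter_mono (nhdsWithin_mono _ (fun t ht => ne_of_gt ht :
        Ioi (sInf A) ⊆ {sInf A}ᶜ))
      filter_upwards [hs', self_mem_nhdsWithin] with t ht htA
      have htA' : 0 < t - sInf A := sub_pos.2 htA
      rw [slope_def_field, h, sub_zero, div_lt_iff₀ htA', zero_mul] at ht
      exact ht.le
  obtain ⟨c, hc, hc'⟩ := mem_nhdsGT_iff_exists_Ioo_subset.1 hev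
  obtain ⟨t, htA, htc⟩ := exists_lt_of_csInf_lt hne hc
  rcases (csInf_le hbdd htA).eq_or_lt with h | h
  · exact absurd (h ▸ hτ0) (not_le.2 htA.2)
  · exact absurd (hc' ⟨h, htc⟩) (not_le.2 htA.2)

/-- A function bounded below cannot decrease at a uniform rate forever. -/
theorem not_bddBelow_of_deriv_le {f f' : ℝ → ℝ} {b c : ℝ} (hc : 0 < c)
    (hd : ∀ᶠ t in atTop, HasDerivAt f (f' t) t) (hf' : ∀ᶠ t in atTop, f' t ≤ -c)
    (hb : ∀ᶠ t in atTop, b ≤ f t) : False := by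
  obtain ⟨T, hT⟩ := eventually_atTop.1 (hd.and (hf'.and hb))
  have hanti : AntitoneOn (fun t => f t + c * t) (Ici T) :=
    antitoneOn_of_hasDerivAt_nonpos (convex_Ici T) (f' := fun t => f' t + c * 1)
      (fun t ht => (hT t ht).1.add ((hasDerivAt_id t).const_mul c))
      fun t ht => by have := (hT t ht).2.1; linarith
  have hT0 := (hT T le_rfl).2.2
  set s := T + (f T - b + 1) / c with hs
  have h0 : 0 < (f T - b + 1) / c := div_pos (by linarith) hc
  have hTs : T ≤ s := by linarith
  have h1 : f s + c * s ≤ f T + c * T := hanti (mem_Ici.2 le_rfl) hTs hTs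
  have h2 : c * s = c * T + (f T - b + 1) := by rw [hs, mul_add, mul_div_cancel₀ _ hc.ne']
  have h3 := (hT s hTs).2.2
  linarith

theorem deriv_limit_eq_zero {f f' : ℝ → ℝ} {l L : ℝ} (hd : ∀ᶠ t in atTop, HasDerivAt f (f' t) t)
    (hf : Tendsto f atTop (𝓝 l)) (hf' : Tendsto f' atTop (𝓝 L)) : L = 0 := by
  by_contra hL
  rcases lt_or_gt_of_ne hL with h | h
  · exact not_bddBelow_of_deriv_le (c := -L / 2) (b := l - 1) (by linarith) hd
      ((hf'.eventually_lt_const (by linarith : L < -(-L / 2))).mono fun t ht => ht.le)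
      ((hf.eventually_const_lt (by linarith : l - 1 < l)).mono fun t ht => ht.le)
  · exact not_bddBelow_of_deriv_le (c := L / 2) (b := -l - 1) (by linarith)
      (hd.mono fun t ht => ht.neg)
      ((hf'.eventually_const_lt (by linarith : L / 2 < L)).mono fun t ht => by
        simp only [neg_le_neg_iff]; exact ht.le)
      ((hf.eventually_lt_const (by linarith : l < l + 1)).mono fun t ht => by
        simp only [Pi.neg_apply]; linarith)

/-- Subexponential solutions of an unstable linear equation follow the forcing. -/
theorem tendsto_of_unstable_linear {f ψ : ℝ → ℝ} {κ l : ℝ} (hκ : 0 < κ)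
    (hd : ∀ᶠ t in atTop, HasDerivAt f (κ * f t - ψ t) t) (hψ : Tendsto ψ atTop (𝓝 l))
    (hf : Tendsto (fun t => f t * Real.exp (-κ * t)) atTop (𝓝 0)) :
    Tendsto f atTop (𝓝 (l / κ)) := by
  have hexp : ∀ t, HasDerivAt (fun t => Real.exp (-κ * t)) (Real.exp (-κ * t) * (-κ * 1)) t :=
    fun t => ((hasDerivAt_id t).const_mul (-κ)).exp
  have h0 : Tendsto (fun t => Real.exp (-κ * t)) atTop (𝓝 0) :=
    Real.tendsto_exp_atBot.comp (tendsto_id.const_mul_atTop_of_neg (by linarith))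
  have := HasDerivAt.lhopital_zero_atTop (l := 𝓝 (l / κ))
    (f' := fun t => (κ * f t - ψ t) * Real.exp (-κ * t) + f t * (Real.exp (-κ * t) * (-κ * 1)))
    (hd.mono fun t ht => ht.mul (hexp t)) (Eventually.of_forall hexp)
    (Eventually.of_forall fun t => by simp [hκ.ne'])
    hf h0 ((hψ.div_const κ).congr fun t => by
      have := (Real.exp_pos (-κ * t)).ne'
      field_simp
      ring)
  refine this.congr fun t => ?_
  rw [Pi.mul_apply, mul_div_assoc, div_self (Real.exp_pos _).ne', mul_one]

/-- If the derivative converges, so does the mean slope. -/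
theorem tendsto_div_of_deriv {f f' : ℝ → ℝ} {c : ℝ} (hd : ∀ᶠ t in atTop, HasDerivAt f (f' t) t)
    (hf' : Tendsto f' atTop (𝓝 c)) : Tendsto (fun t => f t / t) atTop (𝓝 c) := by
  have key : ∀ {f f' : ℝ → ℝ} {c b : ℝ}, (∀ᶠ t in atTop, HasDerivAt f (f' t) t) →
      Tendsto f' atTop (𝓝 c) → c < b → ∀ᶠ t in atTop, f t / t < b := by
    intro f f' c b hd hf' hb
    obtain ⟨b', h1, h2⟩ := exists_between hb
    obtain ⟨T, hT⟩ := eventually_atTop.1 (hd.and (hf'.eventually_lt_const h1))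
    have hanti : AntitoneOn (fun t => f t - b' * t) (Ici T) :=
      antitoneOn_of_hasDerivAt_nonpos (convex_Ici T) (f' := fun t => f' t - b' * 1)
        (fun t ht => (hT t ht).1.sub ((hasDerivAt_id t).const_mul b'))
        fun t ht => by have := (hT t ht).2; linarith
    filter_upwards [eventually_ge_atTop T, eventually_gt_atTop 0,
      eventually_gt_atTop ((f T - b' * T) / (b - b'))] with t h3 h4 h5
    rw [div_lt_iff₀ (by linarith)] at h5
    rw [div_lt_iff₀ h4]
    have h6 : f t - b' * t ≤ f T - b' * T := hanti (mem_Ici.2 le_rfl) h3 h3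
    linarith
  rw [tendsto_order]
  refine ⟨fun b hb => ?_, fun b hb => key hd hf' hb⟩
  filter_upwards [key (hd.mono fun t ht => ht.neg) hf'.neg (neg_lt_neg hb)] with t ht
  rw [Pi.neg_apply, neg_div] at ht
  linarith

/-- The (asymptotically autonomous) system satisfied in logarithmic time by the rescaled solution
`u` and the rescaled flux `z`. -/
structure LogSystem (N α m δ : ℝ) (u z ε : ℝ → ℝ) : Prop where
  du : ∀ t, HasDerivAt u (δ * u t - z t ^ m) t
  dz : ∀ t, HasDerivAt z ((δ - N) * z t + (α + ε t) * u t - z t ^ m) t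
  u_pos : ∀ t, 0 < u t
  z_pos : ∀ t, 0 < z t
  ε_zero : Tendsto ε atTop (𝓝 0)
  le : ∀ᶠ t in atTop, u t ≤ z t

section
variable {N α m δ : ℝ} {u z ε : ℝ → ℝ}

theorem LogSystem.exists_bound (h : LogSystem N α m δ u z ε) (hm : 1 < m) (hδ : 0 < δ) :
    ∃ M > 0, ∀ᶠ t in atTop, u t ≤ M := by
  obtain ⟨T, hT⟩ := eventually_atTop.1 h.le
  set M := max (u T) (δ ^ (1 / (m - 1)) + 1) with hM
  have hM1 : δ ^ (1 / (m - 1)) < M := by linarith [le_max_right (u T) (δ ^ (1 / (m - 1)) + 1)]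
  have hM0 : 0 < M := (Real.rpow_pos_of_pos hδ _).trans hM1
  refine ⟨M, hM0, eventually_atTop.2 ⟨T, fun t ht => ?_⟩⟩
  have := nonpos_of_barrier (f := fun t => u t - M) (fun t _ => (h.du t).sub_const M)
    (sub_nonpos.2 (le_max_left _ _)) (fun t ht _ h0 => ?_) t ht
  · linarith
  · have hu : u t = M := by linarith
    have h1 : u t ^ m ≤ z t ^ m := Real.rpow_le_rpow (h.u_pos t).le (hT t ht) (by linarith)
    have h2 : δ < M ^ (m - 1) := by
      have := Real.rpow_lt_rpow (Real.rpow_pos_of_pos hδ _).le hM1 (by linarith : 0 < m - 1)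
      rwa [← Real.rpow_mul hδ.le, one_div_mul_cancel (by linarith), Real.rpow_one] at this
    have h3 : M ^ m = M ^ (m - 1) * M := by rw [← Real.rpow_add_one hM0.ne']; ring_nf
    have h4 := mul_lt_mul_of_pos_right h2 hM0
    rw [hu] at h1 ⊢
    linarith

/-- The excess of the flux over the drift, in the original normalisation. -/
theorem LogSystem.hasDerivAt_excess (h : LogSystem N α m δ u z ε) (t : ℝ) :
    HasDerivAt (fun t => (z t - u t) * Real.exp ((N - δ) * t))
      (-((N - α - ε t) * (u t * Real.exp ((N - δ) * t)))) t := by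
  refine (((h.dz t).sub (h.du t)).mul ((hasDerivAt_id t).const_mul (N - δ)).exp).congr_deriv ?_
  simp only [Pi.sub_apply, id]
  ring

theorem LogSystem.eventually_small (h : LogSystem N α m δ u z ε) {b : ℝ} (hb : 0 < b) :
    ∀ᶠ t in atTop, |ε t| < b := by
  have := h.ε_zero.abs
  rw [abs_zero] at this
  exact this.eventually_lt_const hb

theorem LogSystem.exists_excess (h : LogSystem N α m δ u z ε) (hαN : α < N) :
    ∃ T, (∀ t ≥ T, u t < z t) ∧ (∀ t ≥ T, |ε t| < (N - α) / 2) ∧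
      AntitoneOn (fun t => (z t - u t) * Real.exp ((N - δ) * t)) (Ici T) := by
  obtain ⟨T, hT⟩ := eventually_atTop.1 (h.le.and (h.eventually_small (b := (N - α) / 2)
    (by linarith)))
  have hneg : ∀ t ≥ T, -((N - α - ε t) * (u t * Real.exp ((N - δ) * t))) < 0 := fun t ht => by
    have h1 := (abs_lt.1 (hT t ht).2).2
    have h2 : 0 < N - α - ε t := by linarith
    have := h.u_pos t
    have := Real.exp_pos ((N - δ) * t)
    rw [neg_lt_zero]
    positivity
  have hanti : StrictAntiOn (fun t => (z t - u t) * Real.exp ((N - δ) * t)) (Ici T) :=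
    strictAntiOn_of_hasDerivWithinAt_neg (convex_Ici T)
      (fun t _ => (h.hasDerivAt_excess t).continuousAt.continuousWithinAt)
      (fun t _ => (h.hasDerivAt_excess t).hasDerivWithinAt)
      fun t ht => hneg t (interior_subset ht)
  refine ⟨T, fun t ht => ?_, fun t ht => (hT t ht).2, hanti.antitoneOn⟩
  have h1 := hanti ht (mem_Ici.2 (by linarith : T ≤ t + 1)) (by linarith)
  have h2 := (hT (t + 1) (by linarith)).1
  have h3 : 0 ≤ (z (t + 1) - u (t + 1)) * Real.exp ((N - δ) * (t + 1)) :=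
    mul_nonneg (by linarith) (Real.exp_pos _).le
  have h4 := pos_of_mul_pos_left (h3.trans_lt h1) (Real.exp_pos _).le
  linarith

theorem LogSystem.hasDerivAt_defect (h : LogSystem N α m δ u z ε) (k t : ℝ) :
    HasDerivAt (fun t => z t ^ m - k * u t)
      (((δ - N) * z t + (α + ε t) * u t - z t ^ m) * m * z t ^ (m - 1)
        - k * (δ * u t - z t ^ m)) t :=
  ((h.dz t).rpow_const (Or.inl (h.z_pos t).ne')).sub ((h.du t).const_mul k)

theorem LogSystem.tendsto_flux_mul_exp (h : LogSystem N α m δ u z ε) (hm : 1 < m) (hδ : 0 < δ)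
    (hαN : α < N) (hN : N < δ) :
    Tendsto (fun t => z t * Real.exp (-(δ - N) * t)) atTop (𝓝 0) := by
  obtain ⟨T, hT, -, hanti⟩ := h.exists_excess hαN
  obtain ⟨M, hM0, hM⟩ := h.exists_bound hm hδ
  have e : N - δ = -(δ - N) := by ring
  rw [e] at hanti
  obtain ⟨l, hl0, hl, hle⟩ := hanti.exists_tendsto_atTop (b := 0) fun t ht =>
    mul_nonneg (sub_nonneg.2 (hT t ht).le) (Real.exp_pos _).le
  have hexp : Tendsto (fun t => Real.exp (-(δ - N) * t)) atTop (𝓝 0) :=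
    Real.tendsto_exp_atBot.comp (tendsto_id.const_mul_atTop_of_neg (by linarith))
  have hu : Tendsto (fun t => u t * Real.exp (-(δ - N) * t)) atTop (𝓝 0) := by
    have h2 := hexp.const_mul M
    rw [mul_zero] at h2
    refine tendsto_of_tendsto_of_tendsto_of_le_of_le' tendsto_const_nhds h2
      (Eventually.of_forall fun t => mul_nonneg (h.u_pos t).le (Real.exp_pos _).le) ?_
    filter_upwards [hM] with t ht
    gcongr
  have hz := hl.add hu
  rcases hl0.eq_or_lt with h0 | hlp
  · rw [← h0, add_zero] at hz
    exact hz.congr fun t => by ring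
  exfalso
  have hbig : Tendsto (fun t => (l * Real.exp ((δ - N) * t)) ^ m) atTop atTop :=
    (tendsto_rpow_atTop (by linarith)).comp ((Real.tendsto_exp_atTop.comp
      (tendsto_id.const_mul_atTop (by linarith : 0 < δ - N))).const_mul_atTop hlp)
  refine not_bddBelow_of_deriv_le (f := u) (c := 1) (b := 0) one_pos (Eventually.of_forall h.du) ?_
    (Eventually.of_forall fun t => (h.u_pos t).le)
  filter_upwards [hM, hbig.eventually_ge_atTop (δ * M + 1), eventually_ge_atTop T] with t h1 h2 h3
  have h4 := hle t h3
  have h5 : l * Real.exp ((δ - N) * t) ≤ z t := by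
    have h6 := mul_le_mul_of_nonneg_right h4 (Real.exp_pos ((δ - N) * t)).le
    rw [mul_assoc, ← Real.exp_add, show -(δ - N) * t + (δ - N) * t = 0 by ring, Real.exp_zero,
      mul_one] at h6
    linarith [h.u_pos t]
  have h6 : (l * Real.exp ((δ - N) * t)) ^ m ≤ z t ^ m :=
    Real.rpow_le_rpow (by positivity) h5 (by linarith)
  have h7 : δ * u t ≤ δ * M := by gcongr
  linarith

/-- If `u` converges then so does the flux, and the limit is an equilibrium. -/
theorem LogSystem.equilibrium (h : LogSystem N α m δ u z ε) (hm : 1 < m) (hδ : 0 < δ)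
    (hαN : α < N) (hN : N < δ) {l : ℝ} (hu : Tendsto u atTop (𝓝 l)) :
    Tendsto z atTop (𝓝 ((δ - α) * l / (δ - N))) ∧ δ * l = ((δ - α) * l / (δ - N)) ^ m := by
  have hD : 0 < δ - N := by linarith
  have hψ : Tendsto (fun t => (N - α - ε t) * u t) atTop (𝓝 ((N - α) * l)) := by
    have := (h.ε_zero.const_sub (N - α)).mul hu
    rwa [sub_zero] at this
  have hexc : Tendsto (fun t => z t - u t) atTop (𝓝 ((N - α) * l / (δ - N))) := by
    refine tendsto_of_unstable_linear hD (Eventually.of_forall fun t =>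
      ((h.dz t).sub (h.du t)).congr_deriv (by ring)) hψ ?_
    have hexp : Tendsto (fun t => Real.exp (-(δ - N) * t)) atTop (𝓝 0) :=
      Real.tendsto_exp_atBot.comp (tendsto_id.const_mul_atTop_of_neg (by linarith))
    have := (h.tendsto_flux_mul_exp hm hδ hαN hN).sub (hu.mul hexp)
    rw [mul_zero, sub_zero] at this
    exact this.congr fun t => by ring
  have hz : Tendsto z atTop (𝓝 ((δ - α) * l / (δ - N))) := by
    have h1 := hexc.add hu
    have h2 : (N - α) * l / (δ - N) + l = (δ - α) * l / (δ - N) := by field_simp; ring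
    rw [h2] at h1
    exact h1.congr fun t => by ring
  refine ⟨hz, ?_⟩
  have := deriv_limit_eq_zero (Eventually.of_forall h.du) hu
    ((hu.const_mul δ).sub (hz.rpow_const (p := m) (Or.inr (by linarith))))
  linarith

theorem LogSystem.limit_unique (h : LogSystem N α m δ u z ε) (hm : 1 < m) (hδ : 0 < δ)
    (hαN : α < N) (hN : N < δ) {ζ : ℝ} (hζ : 0 < ζ)
    (hζm : (δ - α) * ζ ^ (m - 1) = δ * (δ - N)) {l : ℝ} (hl : 0 < l)
    (hu : Tendsto u atTop (𝓝 l)) : δ * l = ζ ^ m := by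
  have h1 := (h.equilibrium hm hδ hαN hN hu).2
  have hD : 0 < δ - N := by linarith
  have hα : 0 < δ - α := by linarith
  set y := (δ - α) * l / (δ - N) with hy
  have hy0 : 0 < y := by positivity
  have h2 : y ^ m = y ^ (m - 1) * y := by rw [← Real.rpow_add_one hy0.ne']; ring_nf
  have h3 : y * (δ - N) = (δ - α) * l := by rw [hy]; field_simp
  have h4 : (δ - α) * y ^ (m - 1) = δ * (δ - N) := by
    have : ((δ - α) * y ^ (m - 1)) * y = (δ * (δ - N)) * y := by
      rw [mul_assoc, ← h2, ← h1]; linear_combination -δ * h3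
    exact mul_right_cancel₀ hy0.ne' this
  have h5 : y ^ (m - 1) = ζ ^ (m - 1) := mul_left_cancel₀ hα.ne' (h4.trans hζm.symm)
  have h6 : y = ζ := (Real.rpow_left_inj hy0.le hζ.le (by linarith)).1 h5
  rw [h1, h6]

theorem MonotoneOn.exists_tendsto_atTop {f : ℝ → ℝ} {a b : ℝ} (hf : MonotoneOn f (Ici a))
    (hb : ∀ s ≥ a, f s ≤ b) : ∃ l, Tendsto f atTop (𝓝 l) ∧ ∀ s ≥ a, f s ≤ l := by
  obtain ⟨l, -, h1, h2⟩ := hf.neg.exists_tendsto_atTop (b := -b) fun s hs => neg_le_neg (hb s hs)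
  refine ⟨-l, by simpa using h1.neg, fun s hs => ?_⟩
  have : l ≤ -f s := h2 s hs
  linarith

theorem LogSystem.eventually_le (h : LogSystem N α m δ u z ε) (hm : 1 < m) (hδ : 0 < δ)
    (hαN : α < N) (hN : N < δ) {ζ : ℝ} (hζ : 0 < ζ)
    (hζm : (δ - α) * ζ ^ (m - 1) = δ * (δ - N)) {c : ℝ} (hc : ζ ^ m < δ * c) :
    ∀ᶠ t in atTop, u t ≤ c := by
  have hD : 0 < δ - N := by linarith
  have hα : 0 < δ - α := by linarith
  have hm0 : 0 < m := by linarith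
  have hζm0 := Real.rpow_pos_of_pos hζ m
  have hc0 : 0 < c := pos_of_mul_pos_right (hζm0.trans hc) hδ.le
  set ξ := (δ * c) ^ (1 / m) with hξ
  have hξ0 : 0 < ξ := Real.rpow_pos_of_pos (by positivity) _
  have hξm : ξ ^ m = δ * c := by
    rw [hξ, ← Real.rpow_mul (by positivity), one_div_mul_cancel hm0.ne', Real.rpow_one]
  have hζξ : ζ < ξ := (Real.rpow_lt_rpow_iff hζ.le hξ0.le hm0).1 (hξm ▸ hc)
  have hlim : Tendsto (fun t => (δ - α - ε t) * ξ ^ (m - 1)) atTop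
      (𝓝 ((δ - α) * ξ ^ (m - 1))) := by
    have := (h.ε_zero.const_sub (δ - α)).mul_const (ξ ^ (m - 1))
    rwa [sub_zero] at this
  have hgap : δ * (δ - N) < (δ - α) * ξ ^ (m - 1) := by
    rw [← hζm]
    exact mul_lt_mul_of_pos_left (Real.rpow_lt_rpow hζ.le hζξ (by linarith)) hα
  obtain ⟨M, hM0, hM⟩ := h.exists_bound hm hδ
  obtain ⟨T, hT⟩ := eventually_atTop.1 ((hlim.eventually_const_lt hgap).and (hM.and
    (h.eventually_small hα)))
  have hcontra : ∀ l, Tendsto u atTop (𝓝 l) → c ≤ l → False := fun l hl hcl => by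
    have := h.limit_unique hm hδ hαN hN hζ hζm (hc0.trans_le hcl) hl
    have := mul_le_mul_of_nonneg_left hcl hδ.le
    linarith
  have hdec : ∀ t ≥ T, c ≤ u t → δ * u t < z t ^ m := by
    intro t₁ ht₁ hut₁
    by_contra! hneg
    have hmon : ∀ t, (∀ s ∈ Icc t₁ t, z s ^ m - δ * u s ≤ 0) → MonotoneOn u (Icc t₁ t) :=
      fun t ht => monotoneOn_of_hasDerivAt_nonneg (convex_Icc _ _) (fun s _ => h.du s)
        fun s hs => by linarith [ht s hs]
    have hf := nonpos_of_barrier (fun t _ => h.hasDerivAt_defect δ t) (a := t₁) (by linarith)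
      fun t ht hle h0 => by
        have h1 : c ≤ u t := hut₁.trans (hmon t hle (left_mem_Icc.2 ht) (right_mem_Icc.2 ht) ht)
        have hz := h.z_pos t
        have h2 : z t ^ m = δ * u t := by linarith
        have h3 : ξ ≤ z t := by
          rw [← Real.rpow_le_rpow_iff hξ0.le hz.le hm0, hξm, h2]
          exact mul_le_mul_of_nonneg_left h1 hδ.le
        have h4 : ξ ^ (m - 1) ≤ z t ^ (m - 1) := Real.rpow_le_rpow hξ0.le h3 (by linarith)
        have h5 : 0 < δ - α - ε t := by
          linarith [(abs_lt.1 (hT t (ht₁.trans ht)).2.2).2]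
        have h6 : δ * (δ - N) < (δ - α - ε t) * z t ^ (m - 1) :=
          (hT t (ht₁.trans ht)).1.trans_le (mul_le_mul_of_nonneg_left h4 h5.le)
        have h7 : z t ^ m = z t ^ (m - 1) * z t := by rw [← Real.rpow_add_one hz.ne']; ring_nf
        have h8 := mul_lt_mul_of_pos_right h6 hz
        have h9 : (δ - N) * z t + (α + ε t) * u t - z t ^ m < 0 := by
          rw [mul_assoc _ (z t ^ (m - 1)), ← h7, h2] at h8
          rw [h2]
          have : δ * ((δ - N) * z t) < δ * ((δ - α - ε t) * u t) := by linarith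
          linarith [lt_of_mul_lt_mul_left this hδ.le]
        rw [h2, sub_self, mul_zero, sub_zero, mul_assoc]
        rw [h2] at h9
        exact mul_neg_of_neg_of_pos h9 (mul_pos hm0 (Real.rpow_pos_of_pos hz _))
    have hmono : MonotoneOn u (Ici t₁) := monotoneOn_of_hasDerivAt_nonneg (convex_Ici _)
      (fun s _ => h.du s) fun s hs => by linarith [hf s hs]
    obtain ⟨l, hl, hle⟩ := hmono.exists_tendsto_atTop fun s hs => (hT s (ht₁.trans hs)).2.1
    exact hcontra l hl (hut₁.trans (hle t₁ le_rfl))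
  obtain ⟨t₁, ht₁, hut₁⟩ : ∃ t ≥ T, u t ≤ c := by
    by_contra! hcon
    have hanti : AntitoneOn u (Ici T) := antitoneOn_of_hasDerivAt_nonpos (convex_Ici _)
      (fun s _ => h.du s) fun s hs => by linarith [hdec s hs (hcon s hs).le]
    obtain ⟨l, hcl, hl, -⟩ := hanti.exists_tendsto_atTop fun s hs => (hcon s hs).le
    exact hcontra l hl hcl
  filter_upwards [eventually_ge_atTop t₁] with t ht
  have := nonpos_of_barrier (f := fun t => u t - c) (fun t _ => (h.du t).sub_const c)
    (sub_nonpos.2 hut₁) (fun t ht _ h0 => by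
      linarith [hdec t (ht₁.trans ht) (by linarith)]) t ht
  linarith

theorem LogSystem.eventually_ge (h : LogSystem N α m δ u z ε) (hm : 1 < m) (hδ : 0 < δ)
    (hα0 : 0 < α) (hαN : α < N) (hN : N < δ) {ζ : ℝ} (hζ : 0 < ζ)
    (hζm : (δ - α) * ζ ^ (m - 1) = δ * (δ - N)) {c : ℝ} (hc0 : 0 < c) (hc : δ * c < ζ ^ m) :
    ∀ᶠ t in atTop, c ≤ u t := by
  have hD : 0 < δ - N := by linarith
  have hα : 0 < δ - α := by linarith
  have hm0 : 0 < m := by linarith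
  set ξ := (δ * c) ^ (1 / m) with hξ
  have hξ0 : 0 < ξ := Real.rpow_pos_of_pos (by positivity) _
  have hξm : ξ ^ m = δ * c := by
    rw [hξ, ← Real.rpow_mul (by positivity), one_div_mul_cancel hm0.ne', Real.rpow_one]
  have hζξ : ξ < ζ := (Real.rpow_lt_rpow_iff hξ0.le hζ.le hm0).1 (hξm ▸ hc)
  have hlim : Tendsto (fun t => (δ - α - ε t) * ξ ^ (m - 1)) atTop
      (𝓝 ((δ - α) * ξ ^ (m - 1))) := by
    have := (h.ε_zero.const_sub (δ - α)).mul_const (ξ ^ (m - 1))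
    rwa [sub_zero] at this
  have hgap : (δ - α) * ξ ^ (m - 1) < δ * (δ - N) := by
    rw [← hζm]
    exact mul_lt_mul_of_pos_left (Real.rpow_lt_rpow hξ0.le hζξ (by linarith)) hα
  obtain ⟨T, hT⟩ := eventually_atTop.1 ((hlim.eventually_lt_const hgap).and
    ((h.eventually_small hα).and (h.eventually_small hα0)))
  have hcontra : ∀ l, Tendsto u atTop (𝓝 l) → 0 < l → l ≤ c → False := fun l hl h0 hcl => by
    have := h.limit_unique hm hδ hαN hN hζ hζm h0 hl
    have := mul_le_mul_of_nonneg_left hcl hδ.le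
    linarith
  have hinc : ∀ t ≥ T, u t ≤ c → z t ^ m < δ * u t := by
    intro t₁ ht₁ hut₁
    by_contra! hneg
    have hmon : ∀ t, (∀ s ∈ Icc t₁ t, -(z s ^ m - δ * u s) ≤ 0) → AntitoneOn u (Icc t₁ t) :=
      fun t ht => antitoneOn_of_hasDerivAt_nonpos (convex_Icc _ _) (fun s _ => h.du s)
        fun s hs => by linarith [ht s hs]
    have hf := nonpos_of_barrier (f := fun s => -(z s ^ m - δ * u s))
      (fun t _ => (h.hasDerivAt_defect δ t).neg) (a := t₁) (by linarith)
      fun t ht hle h0 => by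
        have h1 : u t ≤ c := (hmon t hle (left_mem_Icc.2 ht) (right_mem_Icc.2 ht) ht).trans hut₁
        have hz := h.z_pos t
        have h2 : z t ^ m = δ * u t := by linarith
        have h3 : z t ≤ ξ := by
          rw [← Real.rpow_le_rpow_iff hz.le hξ0.le hm0, hξm, h2]
          exact mul_le_mul_of_nonneg_left h1 hδ.le
        have h4 : z t ^ (m - 1) ≤ ξ ^ (m - 1) := Real.rpow_le_rpow hz.le h3 (by linarith)
        have h5 : 0 < δ - α - ε t := by
          linarith [(abs_lt.1 (hT t (ht₁.trans ht)).2.1).2]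
        have h6 : (δ - α - ε t) * z t ^ (m - 1) < δ * (δ - N) :=
          (mul_le_mul_of_nonneg_left h4 h5.le).trans_lt (hT t (ht₁.trans ht)).1
        have h7 : z t ^ m = z t ^ (m - 1) * z t := by rw [← Real.rpow_add_one hz.ne']; ring_nf
        have h8 := mul_lt_mul_of_pos_right h6 hz
        have h9 : 0 < (δ - N) * z t + (α + ε t) * u t - z t ^ m := by
          rw [mul_assoc _ (z t ^ (m - 1)), ← h7, h2] at h8
          rw [h2]
          have : δ * ((δ - α - ε t) * u t) < δ * ((δ - N) * z t) := by linarith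
          linarith [lt_of_mul_lt_mul_left this hδ.le]
        rw [h2, sub_self, mul_zero, sub_zero, mul_assoc]
        rw [h2] at h9
        exact neg_lt_zero.2 (mul_pos h9 (mul_pos hm0 (Real.rpow_pos_of_pos hz _)))
    have hanti : AntitoneOn u (Ici t₁) := antitoneOn_of_hasDerivAt_nonpos (convex_Ici _)
      (fun s _ => h.du s) fun s hs => by linarith [hf s hs]
    obtain ⟨l, hl0, hl, hle⟩ := hanti.exists_tendsto_atTop (b := 0) fun s _ => (h.u_pos s).le
    rcases hl0.eq_or_lt with h0 | h0
    · have hz := (h.equilibrium hm hδ hαN hN hl).1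
      rw [← h0, mul_zero, zero_div] at hz
      have hzm : Tendsto (fun t => z t ^ (m - 1)) atTop (𝓝 0) := by
        have := hz.rpow_const (p := m - 1) (Or.inr (by linarith))
        rwa [Real.zero_rpow (by linarith)] at this
      obtain ⟨S, hS⟩ := eventually_atTop.1 ((hzm.eventually_lt_const hD).and
        (eventually_ge_atTop T))
      have hmono : MonotoneOn z (Ici S) := monotoneOn_of_hasDerivAt_nonneg (convex_Ici _)
        (fun s _ => h.dz s) fun s hs => by
          have h1 := (hS s hs).1
          have h2 := h.z_pos s
          have h7 : z s ^ m = z s ^ (m - 1) * z s := by rw [← Real.rpow_add_one h2.ne']; ring_nf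
          have h8 := mul_lt_mul_of_pos_right h1 h2
          have h9 : 0 < α + ε s := by
            linarith [(abs_lt.1 (hT s (hS s hs).2).2.2).1]
          have := mul_pos h9 (h.u_pos s)
          linarith
      have : z S ≤ 0 := ge_of_tendsto hz (by
        filter_upwards [eventually_ge_atTop S] with s hs using hmono (mem_Ici.2 le_rfl) hs hs)
      exact absurd (h.z_pos S) (not_lt.2 this)
    · exact hcontra l hl h0 ((hle t₁ le_rfl).trans hut₁)
  obtain ⟨t₁, ht₁, hut₁⟩ : ∃ t ≥ T, c ≤ u t := by
    by_contra! hcon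
    have hmono : MonotoneOn u (Ici T) := monotoneOn_of_hasDerivAt_nonneg (convex_Ici _)
      (fun s _ => h.du s) fun s hs => by linarith [hinc s hs (hcon s hs).le]
    obtain ⟨l, hl, hle⟩ := hmono.exists_tendsto_atTop fun s hs => (hcon s hs).le
    refine hcontra l hl ((h.u_pos T).trans_le (hle T le_rfl)) (le_of_tendsto hl ?_)
    filter_upwards [eventually_ge_atTop T] with s hs using (hcon s hs).le
  filter_upwards [eventually_ge_atTop t₁] with t ht
  have := nonpos_of_barrier (f := fun t => -(u t - c)) (fun t _ => ((h.du t).sub_const c).neg)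
    (by linarith) (fun t ht _ h0 => by
      linarith [hinc t (ht₁.trans ht) (by linarith)]) t ht
  linarith

/-- Decay of order `δ` when `N < δ`. -/
theorem LogSystem.tendsto_of_dim_lt (h : LogSystem N α m δ u z ε) (hm : 1 < m) (hδ : 0 < δ)
    (hα0 : 0 < α) (hαN : α < N) (hN : N < δ) {ζ : ℝ} (hζ : 0 < ζ)
    (hζm : (δ - α) * ζ ^ (m - 1) = δ * (δ - N)) : Tendsto u atTop (𝓝 (ζ ^ m / δ)) := by
  have hl0 : 0 < ζ ^ m / δ := div_pos (Real.rpow_pos_of_pos hζ m) hδ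
  rw [tendsto_order]
  refine ⟨fun b hb => ?_, fun b hb => ?_⟩
  · obtain ⟨c, h1, h2⟩ := exists_between (max_lt hb hl0)
    rw [lt_div_iff₀' hδ] at h2
    filter_upwards [h.eventually_ge hm hδ hα0 hαN hN hζ hζm ((le_max_right _ _).trans_lt h1) h2]
      with t ht using ((le_max_left _ _).trans_lt h1).trans_le ht
  · obtain ⟨c, h1, h2⟩ := exists_between hb
    rw [div_lt_iff₀' hδ] at h1
    filter_upwards [h.eventually_le hm hδ hαN hN hζ hζm h1] with t ht using ht.trans_lt h2

/-- When `δ ≤ N` the loss term eventually dominates. -/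
theorem LogSystem.eventually_mul_lt (h : LogSystem N α m δ u z ε) (hm : 1 < m) (hδ : 0 < δ)
    (hαN : α < N) (hN : δ ≤ N) : ∀ᶠ t in atTop, N * u t < z t ^ m := by
  have hN0 : 0 < N := hδ.trans_le hN
  obtain ⟨T, hT, hε, -⟩ := h.exists_excess hαN
  filter_upwards [eventually_ge_atTop T] with t₁ ht₁
  by_contra! hneg
  have hf := nonpos_of_barrier (fun t _ => h.hasDerivAt_defect N t) (a := t₁) (by linarith)
    fun t ht _ h0 => by
      have hz := h.z_pos t
      have hu := h.u_pos t
      have h2 : z t ^ m = N * u t := by linarith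
      have h7 : z t ^ m = z t ^ (m - 1) * z t := by rw [← Real.rpow_add_one hz.ne']; ring_nf
      have hε' := (abs_lt.1 (hε t (ht₁.trans ht))).2
      have h3 : 0 < m * z t ^ (m - 1) * (N - α - ε t) * u t :=
        mul_pos (mul_pos (mul_pos (by linarith) (Real.rpow_pos_of_pos hz _)) (by linarith)) hu
      have h4 : 0 ≤ (m - 1) * (N - δ) * (N * u t) :=
        mul_nonneg (mul_nonneg (by linarith) (by linarith)) (by positivity)
      have h5 : z t ^ (m - 1) * z t = N * u t := h7 ▸ h2
      rw [h2]
      linear_combination h3 + h4 - m * (N - δ) * h5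
  refine not_bddBelow_of_deriv_le (f := fun t => (z t - u t) / u t) (c := (N - α) / 2) (b := 0)
    (by linarith) (Eventually.of_forall fun t => ((h.dz t).sub (h.du t)).div (h.du t)
      (h.u_pos t).ne') ?_ ?_
  · filter_upwards [eventually_ge_atTop t₁] with t ht
    have hu := h.u_pos t
    have h1 := hf t ht
    have h2 := hT t (ht₁.trans ht)
    have hε' := (abs_lt.1 (hε t (ht₁.trans ht))).2
    simp only [Pi.sub_apply]
    rw [div_le_iff₀ (by positivity)]
    have h3 := mul_nonneg (sub_pos.2 h2).le (sub_nonneg.2 (by linarith : z t ^ m ≤ N * u t))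
    have h4 : 0 < ((N - α) / 2 - ε t) * u t ^ 2 := mul_pos (by linarith) (by positivity)
    linear_combination h3 + h4
  · filter_upwards [eventually_ge_atTop t₁] with t ht
    exact div_nonneg (sub_pos.2 (hT t (ht₁.trans ht))).le (h.u_pos t).le

theorem LogSystem.exists_antitoneOn (h : LogSystem N α m δ u z ε) (hm : 1 < m) (hδ : 0 < δ)
    (hαN : α < N) (hN : δ ≤ N) :
    ∃ T, AntitoneOn (fun t => u t * Real.exp ((N - δ) * t)) (Ici T) := by
  obtain ⟨T, hT⟩ := eventually_atTop.1 (h.eventually_mul_lt hm hδ hαN hN)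
  refine ⟨T, antitoneOn_of_hasDerivAt_nonpos (convex_Ici T)
    (f' := fun t => (N * u t - z t ^ m) * Real.exp ((N - δ) * t)) (fun t _ =>
      ((h.du t).mul ((hasDerivAt_id t).const_mul (N - δ)).exp).congr_deriv (by simp only [id]; ring))
    fun t ht => mul_nonpos_of_nonpos_of_nonneg (by linarith [hT t ht]) (Real.exp_pos _).le⟩

theorem LogSystem.tendsto_zero (h : LogSystem N α m δ u z ε) (hm : 1 < m) (hδ : 0 < δ)
    (hαN : α < N) (hN : δ ≤ N) : Tendsto u atTop (𝓝 0) := by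
  obtain ⟨T, hanti⟩ := h.exists_antitoneOn hm hδ hαN hN
  obtain ⟨l, hl0, hl, -⟩ := hanti.exists_tendsto_atTop (b := 0) fun t _ =>
    mul_nonneg (h.u_pos t).le (Real.exp_pos _).le
  rcases hN.lt_or_eq with hN | rfl
  · have hexp : Tendsto (fun t => Real.exp (-(N - δ) * t)) atTop (𝓝 0) :=
      Real.tendsto_exp_atBot.comp (tendsto_id.const_mul_atTop_of_neg (by linarith))
    have := hl.mul hexp
    rw [mul_zero] at this
    refine this.congr fun t => ?_
    rw [mul_assoc, ← Real.exp_add, show (N - δ) * t + -(N - δ) * t = 0 by ring, Real.exp_zero,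
      mul_one]
  · simp only [sub_self, zero_mul, Real.exp_zero, mul_one] at hl
    obtain ⟨S, hS, -, hH⟩ := h.exists_excess hαN
    obtain ⟨k, -, hk, -⟩ := hH.exists_tendsto_atTop (b := 0) fun t ht =>
      mul_nonneg (sub_pos.2 (hS t ht)).le (Real.exp_pos _).le
    have hd : Tendsto (fun t => -((δ - α - ε t) * (u t * Real.exp ((δ - δ) * t)))) atTop
        (𝓝 (-((δ - α - 0) * l))) := by
      simp only [sub_self, zero_mul, Real.exp_zero, mul_one]
      exact ((h.ε_zero.const_sub (δ - α)).mul hl).neg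
    have h0 := deriv_limit_eq_zero (Eventually.of_forall h.hasDerivAt_excess) hk hd
    rw [neg_eq_zero, sub_zero] at h0
    rwa [(mul_eq_zero.1 h0).resolve_left (by linarith)] at hl

theorem LogSystem.eventually_mul_le_excess (h : LogSystem N α m δ u z ε) (hm : 1 < m) (hδ : 0 < δ)
    (hαN : α < N) (hN : δ ≤ N) : ∀ᶠ t in atTop, N * u t ≤ 2 ^ m * (z t - u t) ^ m := by
  have hu0 : Tendsto (fun t => 2 ^ m * u t ^ (m - 1)) atTop (𝓝 0) := by
    have := ((h.tendsto_zero hm hδ hαN hN).rpow_const (p := m - 1)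
      (Or.inr (by linarith))).const_mul (2 ^ m)
    rwa [Real.zero_rpow (by linarith), mul_zero] at this
  filter_upwards [h.eventually_mul_lt hm hδ hαN hN, hu0.eventually_lt_const (hδ.trans_le hN)]
    with t h1 h2
  have hu := h.u_pos t
  have h3 : u t ^ m = u t ^ (m - 1) * u t := by rw [← Real.rpow_add_one hu.ne']; ring_nf
  have h4 : (2 * u t) ^ m ≤ z t ^ m := by
    rw [Real.mul_rpow zero_le_two hu.le, h3, ← mul_assoc]
    exact (mul_le_mul_of_nonneg_right h2.le hu.le).trans h1.le
  have h5 : 2 * u t ≤ z t :=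
    (Real.rpow_le_rpow_iff (by positivity) (h.z_pos t).le (by linarith)).1 h4
  rw [← Real.mul_rpow zero_le_two (by linarith)]
  exact h1.le.trans (Real.rpow_le_rpow (h.z_pos t).le (by linarith) (by linarith))

/-- The excess keeps a positive limit when `δ < N`. -/
theorem LogSystem.tendsto_excess (h : LogSystem N α m δ u z ε) (hm : 1 < m) (hδ : 0 < δ)
    (hαN : α < N) (hN : δ < N) :
    (∃ c > 0, Tendsto (fun t => (z t - u t) * Real.exp ((N - δ) * t)) atTop (𝓝 c)) ∧
      Tendsto (fun t => u t * Real.exp ((N - δ) * t)) atTop (𝓝 0) := by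
  have hN0 : 0 < N := hδ.trans hN
  have hκ : 0 < (m - 1) * (N - δ) := mul_pos (by linarith) (by linarith)
  set κ := (m - 1) * (N - δ) with hκdef
  set J : ℝ → ℝ := fun t => (z t - u t) * Real.exp ((N - δ) * t) with hJ
  obtain ⟨T₀, hT₀, hε, hanti⟩ := h.exists_excess hαN
  obtain ⟨T, hT⟩ := eventually_atTop.1 ((eventually_ge_atTop T₀).and
    (h.eventually_mul_le_excess hm hδ hαN hN.le))
  have hT₀T : T₀ ≤ T := (hT T le_rfl).1
  have hJpos : ∀ t ≥ T, 0 < J t := fun t ht =>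
    mul_pos (sub_pos.2 (hT₀ t (hT t ht).1)) (Real.exp_pos _)
  have hJle : ∀ t ≥ T, J t ≤ J T := fun t ht => hanti hT₀T (hT t ht).1 ht
  set C := 2 ^ m * J T ^ (m - 1) / N with hC
  have hC0 : 0 < C := by
    have := Real.rpow_pos_of_pos (hJpos T le_rfl) (m - 1)
    positivity
  have hU : ∀ t ≥ T, u t * Real.exp ((N - δ) * t) ≤ C * Real.exp (-κ * t) * J t := by
    intro t ht
    have hz := sub_pos.2 (hT₀ t (hT t ht).1)
    have h1 : (z t - u t) ^ m * Real.exp ((N - δ) * t) =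
        J t ^ (m - 1) * Real.exp (-κ * t) * J t := by
      have : J t ^ (m - 1) * J t = J t ^ m := by
        rw [← Real.rpow_add_one (hJpos t ht).ne']; ring_nf
      rw [mul_right_comm, this, hJ, Real.mul_rpow hz.le (Real.exp_pos _).le, ← Real.exp_mul,
        mul_assoc, ← Real.exp_add]
      congr 2
      rw [hκdef]
      ring
    have h2 : J t ^ (m - 1) ≤ J T ^ (m - 1) :=
      Real.rpow_le_rpow (hJpos t ht).le (hJle t ht) (by linarith)
    have h3 := mul_le_mul_of_nonneg_right (hT t ht).2 (Real.exp_pos ((N - δ) * t)).le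
    rw [mul_assoc (2 ^ m), h1] at h3
    have h4 : J t ^ (m - 1) * Real.exp (-κ * t) * J t ≤ J T ^ (m - 1) * Real.exp (-κ * t) * J t :=
      mul_le_mul_of_nonneg_right (mul_le_mul_of_nonneg_right h2 (Real.exp_pos _).le)
        (hJpos t ht).le
    have h5 : 2 ^ m * (J t ^ (m - 1) * Real.exp (-κ * t) * J t) ≤
        2 ^ m * (J T ^ (m - 1) * Real.exp (-κ * t) * J t) :=
      mul_le_mul_of_nonneg_left h4 (by positivity)
    have h6 : N * (C * Real.exp (-κ * t) * J t) =
        2 ^ m * (J T ^ (m - 1) * Real.exp (-κ * t) * J t) := by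
      rw [hC]; field_simp
    exact le_of_mul_le_mul_left (by rw [h6]; linarith) hN0
  have hexp : Tendsto (fun t => Real.exp (-κ * t)) atTop (𝓝 0) :=
    Real.tendsto_exp_atBot.comp (tendsto_id.const_mul_atTop_of_neg (by linarith))
  refine ⟨?_, ?_⟩
  · obtain ⟨c, -, hc, -⟩ := hanti.exists_tendsto_atTop (b := 0) fun t ht =>
      mul_nonneg (sub_pos.2 (hT₀ t ht)).le (Real.exp_pos _).le
    set K := 2 * (N - α) * C with hK
    have hK0 : 0 < K := mul_pos (by linarith) hC0
    have hmono : MonotoneOn (fun t => Real.log (J t) - K / κ * Real.exp (-κ * t)) (Ici T) := by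
      refine monotoneOn_of_hasDerivAt_nonneg (convex_Ici T) (fun t ht =>
        ((h.hasDerivAt_excess t).log (hJpos t ht).ne').sub
          (((hasDerivAt_id t).const_mul (-κ)).exp.const_mul (K / κ))) fun t ht => ?_
      have h1 := hU t ht
      have h2 := abs_lt.1 (hε t (hT t ht).1)
      have h3 : (N - α - ε t) * (u t * Real.exp ((N - δ) * t)) ≤
          2 * (N - α) * (C * Real.exp (-κ * t) * J t) :=
        mul_le_mul (by linarith) h1 (mul_pos (h.u_pos t) (Real.exp_pos _)).le (by linarith)
      have h4 : K / κ * (Real.exp (-κ * id t) * (-κ * 1)) = -(K * Real.exp (-κ * t)) := by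
        simp only [id]
        field_simp
      rw [h4, sub_neg_eq_add, neg_div, neg_add_eq_sub, sub_nonneg, div_le_iff₀ (hJpos t ht), hK]
      linarith
    refine ⟨c, ?_, hc⟩
    refine (Real.exp_pos (Real.log (J T) - K / κ * Real.exp (-κ * T))).trans_le
      (ge_of_tendsto hc ?_)
    filter_upwards [eventually_ge_atTop T] with t ht
    rw [← Real.le_log_iff_exp_le (hJpos t ht)]
    have h1 : Real.log (J T) - K / κ * Real.exp (-κ * T) ≤
      Real.log (J t) - K / κ * Real.exp (-κ * t) := hmono (mem_Ici.2 le_rfl) ht ht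
    have h2 : 0 < K / κ * Real.exp (-κ * t) := by positivity
    exact h1.trans (by linarith)
  · have h0 : Tendsto (fun t => C * Real.exp (-κ * t) * J T) atTop (𝓝 0) := by
      have := (hexp.const_mul C).mul_const (J T)
      rwa [mul_zero, zero_mul] at this
    refine tendsto_of_tendsto_of_tendsto_of_le_of_le' tendsto_const_nhds h0
      (Eventually.of_forall fun t => mul_nonneg (h.u_pos t).le (Real.exp_pos _).le) ?_
    filter_upwards [eventually_ge_atTop T] with t ht
    exact (hU t ht).trans (mul_le_mul_of_nonneg_left (hJle t ht) (by positivity))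

/-- Faster exponential decay when `δ < N`. -/
theorem LogSystem.tendsto_of_lt_dim (h : LogSystem N α m δ u z ε) (hm : 1 < m) (hδ : 0 < δ)
    (hαN : α < N) (hN : δ < N) :
    ∃ c > 0, Tendsto (fun t => u t * Real.exp (m * (N - δ) * t)) atTop (𝓝 c) := by
  obtain ⟨⟨c, hc0, hc⟩, hU⟩ := h.tendsto_excess hm hδ hαN hN
  have hη : 0 < δ + m * (N - δ) := add_pos hδ (mul_pos (by linarith) (by linarith))
  have hZ : Tendsto (fun t => (z t * Real.exp ((N - δ) * t)) ^ m) atTop (𝓝 (c ^ m)) := by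
    have := hc.add hU
    rw [add_zero] at this
    exact (this.congr fun t => by ring).rpow_const (Or.inr (by linarith))
  refine ⟨c ^ m / (δ + m * (N - δ)), div_pos (Real.rpow_pos_of_pos hc0 m) hη,
    tendsto_of_unstable_linear hη (Eventually.of_forall fun t => ?_) hZ ?_⟩
  · refine ((h.du t).mul ((hasDerivAt_id t).const_mul (m * (N - δ))).exp).congr_deriv ?_
    rw [Real.mul_rpow (h.z_pos t).le (Real.exp_pos _).le, ← Real.exp_mul,
      show (N - δ) * t * m = m * (N - δ) * t by ring]
    simp only [id]
    ring
  · have hexp : Tendsto (fun t => Real.exp (-δ * t)) atTop (𝓝 0) :=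
      Real.tendsto_exp_atBot.comp (tendsto_id.const_mul_atTop_of_neg (by linarith))
    have := (h.tendsto_zero hm hδ hαN hN.le).mul hexp
    rw [mul_zero] at this
    refine this.congr fun t => ?_
    rw [mul_assoc, ← Real.exp_add]
    congr 2
    ring

/-- Decay with a logarithmic correction when `δ = N`. -/
theorem LogSystem.tendsto_of_eq_dim (h : LogSystem N α m N u z ε) (hm : 1 < m) (hN : 0 < N)
    (hαN : α < N) :
    Tendsto (fun t => t ^ (m / (m - 1)) * u t) atTop
      (𝓝 (1 / N * (N / ((m - 1) * (N - α))) ^ (m / (m - 1)))) := by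
  have hm1 : 0 < m - 1 := by linarith
  obtain ⟨T, hT, -, hanti⟩ := h.exists_excess hαN
  simp only [sub_self, zero_mul, Real.exp_zero, mul_one] at hanti
  have hu := h.tendsto_zero hm hN hαN le_rfl
  set H : ℝ → ℝ := fun t => z t - u t with hH
  have hHpos : ∀ t ≥ T, 0 < H t := fun t ht => sub_pos.2 (hT t ht)
  have hdH : ∀ t, HasDerivAt H (-((N - α - ε t) * u t)) t := fun t =>
    ((h.dz t).sub (h.du t)).congr_deriv (by ring)
  have hH0 : Tendsto H atTop (𝓝 0) := by
    obtain ⟨k, hk0, hk, -⟩ := hanti.exists_tendsto_atTop (b := 0) fun t ht => (hHpos t ht).le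
    have hz : Tendsto z atTop (𝓝 k) := by
      have := hk.add hu
      rw [add_zero] at this
      exact this.congr fun t => by simp only [hH]; ring
    have h1 := deriv_limit_eq_zero (Eventually.of_forall h.du) hu
      ((hu.const_mul N).sub (hz.rpow_const (p := m) (Or.inr (by linarith))))
    rw [mul_zero, zero_sub, neg_eq_zero, Real.rpow_eq_zero hk0 (by linarith)] at h1
    exact h1 ▸ hk
  have hHm : Tendsto (fun t => H t ^ (m - 1)) atTop (𝓝 0) := by
    have := hH0.rpow_const (p := m - 1) (Or.inr hm1.le)
    rwa [Real.zero_rpow hm1.ne'] at this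
  have hrp : ∀ t ≥ T, H t ^ m = H t ^ (m - 1) * H t := fun t ht => by
    rw [← Real.rpow_add_one (hHpos t ht).ne']; ring_nf
  set B := 2 ^ m / N with hB
  set g : ℝ → ℝ := fun t => u t / H t ^ m with hg
  have hgB : ∀ᶠ t in atTop, 0 ≤ g t ∧ g t ≤ B := by
    filter_upwards [h.eventually_mul_le_excess hm hN hαN le_rfl, eventually_ge_atTop T]
      with t h1 h2
    have h3 := Real.rpow_pos_of_pos (hHpos t h2) m
    refine ⟨div_nonneg (h.u_pos t).le h3.le, ?_⟩
    rw [hg, hB]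
    rw [div_le_div_iff₀ h3 hN]
    linarith
  have hgH : Tendsto (fun t => g t * H t ^ (m - 1)) atTop (𝓝 0) := by
    have h0 := hHm.const_mul B
    rw [mul_zero] at h0
    refine tendsto_of_tendsto_of_tendsto_of_le_of_le' tendsto_const_nhds h0 ?_ ?_
    · filter_upwards [hgB, eventually_ge_atTop T] with t h1 h2
      exact mul_nonneg h1.1 (Real.rpow_nonneg (hHpos t h2).le _)
    · filter_upwards [hgB, eventually_ge_atTop T] with t h1 h2
      exact mul_le_mul_of_nonneg_right h1.2 (Real.rpow_nonneg (hHpos t h2).le _)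
  have hgg : Tendsto (fun t => g t * (g t * H t ^ (m - 1))) atTop (𝓝 0) := by
    have h0 := hgH.const_mul B
    rw [mul_zero] at h0
    refine tendsto_of_tendsto_of_tendsto_of_le_of_le' tendsto_const_nhds h0 ?_ ?_
    · filter_upwards [hgB, eventually_ge_atTop T] with t h1 h2
      exact mul_nonneg h1.1 (mul_nonneg h1.1 (Real.rpow_nonneg (hHpos t h2).le _))
    · filter_upwards [hgB, eventually_ge_atTop T] with t h1 h2
      exact mul_le_mul_of_nonneg_right h1.2
        (mul_nonneg h1.1 (Real.rpow_nonneg (hHpos t h2).le _))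
  have hψ : Tendsto (fun t => (1 + g t * H t ^ (m - 1)) ^ m -
      m * (N - α - ε t) * (g t * (g t * H t ^ (m - 1)))) atTop (𝓝 1) := by
    have h1 := (hgH.const_add 1).rpow_const (p := m) (Or.inr (by linarith))
    have h2 := ((h.ε_zero.const_sub (N - α)).const_mul m).mul hgg
    have := h1.sub h2
    simpa using this
  have hglim : Tendsto g atTop (𝓝 (1 / N)) := by
    refine tendsto_of_unstable_linear hN ?_ hψ ?_
    · filter_upwards [eventually_ge_atTop T] with t ht
      have hp := hHpos t ht
      refine ((h.du t).div ((hdH t).rpow_const (p := m) (Or.inl hp.ne'))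
        (Real.rpow_pos_of_pos hp m).ne').congr_deriv ?_
      have hp1 := Real.rpow_pos_of_pos hp (m - 1)
      have h1 : 1 + g t * H t ^ (m - 1) = z t / H t := by
        rw [hg]
        simp only [hrp t ht]
        field_simp
        simp only [hH]
        ring
      rw [h1, Real.div_rpow (h.z_pos t).le hp.le]
      simp only [hg, hrp t ht]
      field_simp
      ring
    · have hexp : Tendsto (fun t => Real.exp (-N * t)) atTop (𝓝 0) :=
        Real.tendsto_exp_atBot.comp (tendsto_id.const_mul_atTop_of_neg (by linarith))
      have h0 := hexp.const_mul B
      rw [mul_zero] at h0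
      refine tendsto_of_tendsto_of_tendsto_of_le_of_le' tendsto_const_nhds h0 ?_ ?_
      · filter_upwards [hgB] with t h1 using mul_nonneg h1.1 (Real.exp_pos _).le
      · filter_upwards [hgB] with t h1 using mul_le_mul_of_nonneg_right h1.2 (Real.exp_pos _).le
  have hF : Tendsto (fun t => H t ^ (1 - m) / t) atTop (𝓝 ((m - 1) * (N - α) * (1 / N))) := by
    have h1 : Tendsto (fun t => (m - 1) * (N - α - ε t) * g t) atTop
        (𝓝 ((m - 1) * (N - α) * (1 / N))) := by
      have := ((h.ε_zero.const_sub (N - α)).const_mul (m - 1)).mul hglim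
      rwa [sub_zero] at this
    refine tendsto_div_of_deriv ?_ h1
    filter_upwards [eventually_ge_atTop T] with t ht
    have hp := hHpos t ht
    refine ((hdH t).rpow_const (p := 1 - m) (Or.inl hp.ne')).congr_deriv ?_
    rw [show 1 - m - 1 = -m by ring, Real.rpow_neg hp.le]
    simp only [hg]
    field_simp
    ring
  have hc : 0 < (m - 1) * (N - α) * (1 / N) :=
    mul_pos (mul_pos hm1 (by linarith)) (by positivity)
  have hlim := hglim.mul ((hF.inv₀ hc.ne').rpow_const (p := m / (m - 1))
    (Or.inr (div_nonneg (by linarith) hm1.le)))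
  have e : ((m - 1) * (N - α) * (1 / N))⁻¹ = N / ((m - 1) * (N - α)) := by
    rw [mul_one_div, inv_div]
  rw [e] at hlim
  refine hlim.congr' ?_
  filter_upwards [eventually_ge_atTop T, eventually_gt_atTop 0] with t ht ht0
  have hp := hHpos t ht
  rw [inv_div, Real.div_rpow ht0.le (Real.rpow_nonneg hp.le _), ← Real.rpow_mul hp.le,
    show (1 - m) * (m / (m - 1)) = -m by field_simp; ring, Real.rpow_neg hp.le, div_inv_eq_mul]
  have := (Real.rpow_pos_of_pos hp m).ne'
  simp only [hg]
  field_simp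

end

/-- Logarithmic time turns a positive radial solution into a `LogSystem`. -/
theorem RadSol.logSystem {n : ℕ} {m q α δ : ℝ} {x y : ℝ → ℝ} (h : RadSol n m q α 1 x y)
    (hq : 1 < q) (hδ : (δ - 1) * m = δ + 1) (hpos : ∀ s > 0, 0 < x s ∧ 0 < y s)
    (hx : Tendsto x atTop (𝓝 0)) (hle : ∀ᶠ s in atTop, s * x s ≤ y s) :
    LogSystem (n + 1) α m δ (fun t => Real.exp (δ * t) * x (Real.exp t))
      (fun t => Real.exp ((δ - 1) * t) * y (Real.exp t)) (fun t => |x (Real.exp t)| ^ (q - 1)) := by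
  have hpow : ∀ t, (Real.exp ((δ - 1) * t) * y (Real.exp t)) ^ m =
      Real.exp (δ * t) * Real.exp t * y (Real.exp t) ^ m := fun t => by
    rw [Real.mul_rpow (Real.exp_pos _).le (hpos _ (Real.exp_pos t)).2.le, ← Real.exp_mul,
      ← Real.exp_add, show (δ - 1) * t * m = δ * t + t by linear_combination t * hδ]
  have hsplit : ∀ t, Real.exp (δ * t) = Real.exp ((δ - 1) * t) * Real.exp t := fun t => by
    rw [← Real.exp_add]; ring_nf
  refine ⟨fun t => ?_, fun t => ?_, fun t => mul_pos (Real.exp_pos _) (hpos _ (Real.exp_pos t)).1,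
    fun t => mul_pos (Real.exp_pos _) (hpos _ (Real.exp_pos t)).2, ?_, ?_⟩
  · refine (((hasDerivAt_id t).const_mul δ).exp.mul
      ((h.dx _ (Real.exp_pos t)).comp t (Real.hasDerivAt_exp t))).congr_deriv ?_
    simp only [hpow, id, Function.comp]
    ring
  · refine (((hasDerivAt_id t).const_mul (δ - 1)).exp.mul
      ((h.dy _ (Real.exp_pos t)).comp t (Real.hasDerivAt_exp t))).congr_deriv ?_
    simp only [hpow, id, Function.comp, reac, hsplit]
    have hx0 := (hpos _ (Real.exp_pos t)).1
    have hxq : x (Real.exp t) ^ q = |x (Real.exp t)| ^ (q - 1) * x (Real.exp t) := by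
      rw [abs_of_pos hx0, ← Real.rpow_add_one hx0.ne']
      ring_nf
    have := (Real.exp_pos t).ne'
    rw [hxq]
    field_simp
    ring
  · have h1 := (hx.comp Real.tendsto_exp_atTop).abs.rpow_const (p := q - 1) (Or.inr (by linarith))
    rwa [abs_zero, Real.zero_rpow (by linarith)] at h1
  · filter_upwards [Real.tendsto_exp_atTop.eventually hle] with t ht
    rw [hsplit, mul_assoc]
    exact mul_le_mul_of_nonneg_left ht (Real.exp_pos _).le

/-- The decay rates of a solution, read off in logarithmic time. -/
theorem LogSystem.radial_decay {N p α : ℝ} {w z ε : ℝ → ℝ} (hp : 1 < p) (hp2 : p < 2)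
    (hα : 0 < α) (hαδ : α < p / (2 - p)) (hαN : α < N)
    (h : LogSystem N α (1 / (p - 1)) (p / (2 - p))
      (fun t => Real.exp (p / (2 - p) * t) * w (Real.exp t)) z ε) :
    Tendsto (fun r => r ^ α * w r) atTop (𝓝 0) ∧
    (2 * N / (N + 1) < p →
      Tendsto (fun r => r ^ (p / (2 - p)) * w r) atTop
        (𝓝 (((p / (2 - p)) ^ (p - 1) *
          ((p / (2 - p) - N) / (p / (2 - p) - α))) ^ (1 / (2 - p))))) ∧
    (p < 2 * N / (N + 1) →
      ∃ c : ℝ, 0 < c ∧ Tendsto (fun r => r ^ ((N - p) / (p - 1)) * w r) atTop (𝓝 c)) ∧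
    (p = 2 * N / (N + 1) →
      Tendsto (fun r => r ^ N * Real.log r ^ ((N + 1) / 2) * w r) atTop
        (𝓝 ((1 / N) * ((N * (N - 1)) / (2 * (N - α))) ^ ((N + 1) / 2)))) := by
  have h1 : 0 < p - 1 := by linarith
  have h2 : 0 < 2 - p := by linarith
  have hN1 : 0 < N + 1 := by linarith
  have hm : 1 < 1 / (p - 1) := by rw [lt_div_iff₀ h1]; linarith
  have hδ : 0 < p / (2 - p) := div_pos (by linarith) h2
  have hpow : ∀ k : ℝ, ∀ r > 0, r ^ k = Real.exp (k * Real.log r) := fun k r hr => by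
    rw [Real.rpow_def_of_pos hr, mul_comm]
  refine ⟨?_, fun hlt => ?_, fun hlt => ?_, fun heq => ?_⟩
  · obtain ⟨M, hM0, hM⟩ := h.exists_bound hm hδ
    have hexp : Tendsto (fun t => Real.exp ((α - p / (2 - p)) * t) * M) atTop (𝓝 0) := by
      have := (Real.tendsto_exp_atBot.comp
        (tendsto_id.const_mul_atTop_of_neg (sub_neg.2 hαδ))).mul_const M
      rwa [zero_mul] at this
    refine tendsto_of_tendsto_of_tendsto_of_le_of_le' tendsto_const_nhds
      (hexp.comp Real.tendsto_log_atTop) ?_ ?_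
    · filter_upwards [eventually_gt_atTop 0] with r hr
      have := h.u_pos (Real.log r)
      rw [Real.exp_log hr] at this
      exact mul_nonneg (Real.rpow_nonneg hr.le _) (pos_of_mul_pos_right this (Real.exp_pos _).le).le
    · filter_upwards [eventually_gt_atTop 0, Real.tendsto_log_atTop.eventually hM] with r hr hMr
      rw [Real.exp_log hr] at hMr
      refine le_of_eq_of_le ?_ (mul_le_mul_of_nonneg_left hMr (Real.exp_pos _).le)
      rw [hpow α r hr, ← mul_assoc, ← Real.exp_add]
      ring_nf
  · rw [div_lt_iff₀ hN1] at hlt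
    have hNδ : N < p / (2 - p) := by rw [lt_div_iff₀ h2]; linarith
    have hD : 0 < (p / (2 - p) - N) / (p / (2 - p) - α) :=
      div_pos (sub_pos.2 hNδ) (sub_pos.2 hαδ)
    have hm1 : 1 / (p - 1) - 1 ≠ 0 := by linarith
    have hX : 0 < p / (2 - p) * ((p / (2 - p) - N) / (p / (2 - p) - α)) := mul_pos hδ hD
    have hlim := h.tendsto_of_dim_lt hm hδ hα hαN hNδ
      (ζ := (p / (2 - p) * ((p / (2 - p) - N) / (p / (2 - p) - α))) ^ (1 / (1 / (p - 1) - 1)))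
      (Real.rpow_pos_of_pos hX _) (by
        rw [← Real.rpow_mul hX.le, one_div_mul_cancel hm1, Real.rpow_one]
        have := (sub_pos.2 hαδ).ne'
        rw [mul_left_comm, mul_div_cancel₀ _ this])
    have e1 : 1 / (1 / (p - 1) - 1) * (1 / (p - 1)) = 1 / (2 - p) := by
      rw [show 1 / (p - 1) - 1 = (2 - p) / (p - 1) by field_simp; ring]
      field_simp
    have e2 : (p - 1) * (1 / (2 - p)) = 1 / (2 - p) - 1 := by field_simp; ring
    rw [← Real.rpow_mul hX.le, e1, Real.mul_rpow hδ.le hD.le, mul_div_right_comm,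
      ← Real.rpow_sub_one hδ.ne', ← e2, Real.rpow_mul hδ.le,
      ← Real.mul_rpow (Real.rpow_nonneg hδ.le _) hD.le] at hlim
    refine (hlim.comp Real.tendsto_log_atTop).congr' ?_
    filter_upwards [eventually_gt_atTop 0] with r hr
    rw [Function.comp, hpow _ r hr, Real.exp_log hr]
  · rw [lt_div_iff₀ hN1] at hlt
    have hNδ : p / (2 - p) < N := by rw [div_lt_iff₀ h2]; linarith
    obtain ⟨c, hc, hlim⟩ := h.tendsto_of_lt_dim hm hδ hαN hNδ
    refine ⟨c, hc, (hlim.comp Real.tendsto_log_atTop).congr' ?_⟩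
    filter_upwards [eventually_gt_atTop 0] with r hr
    rw [Function.comp, hpow _ r hr, Real.exp_log hr, mul_right_comm, ← Real.exp_add]
    congr 2
    field_simp
    ring
  · have hN0 : 0 < N := hα.trans hαN
    have hN1' : 0 < N - 1 := by
      rw [heq, lt_div_iff₀ hN1] at hp
      linarith
    have e1 : p - 1 = (N - 1) / (N + 1) := by rw [heq]; field_simp; ring
    have e2 : 2 - p = 2 / (N + 1) := by rw [heq]; field_simp; ring
    have e3 : p / (2 - p) = N := by rw [e2, heq]; field_simp
    have e4 : 1 / (p - 1) - 1 = 2 / (N - 1) := by rw [e1]; field_simp; ring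
    have e5 : 1 / (p - 1) / (1 / (p - 1) - 1) = (N + 1) / 2 := by rw [e4, e1]; field_simp
    rw [e3] at h
    have hlim := h.tendsto_of_eq_dim hm hN0 hαN
    rw [e5, e4, show N / (2 / (N - 1) * (N - α)) = N * (N - 1) / (2 * (N - α)) by
      have := (sub_pos.2 hαN).ne'
      field_simp] at hlim
    refine (hlim.comp Real.tendsto_log_atTop).congr' ?_
    filter_upwards [eventually_gt_atTop 0] with r hr
    rw [Function.comp, hpow N r hr, Real.exp_log hr]
    ring

/-- Assume (L), `α < N` and `1 < q < q*`. There exists `a > 0` whose global solution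
is nonnegative with `lim r^α w = 0`; for `p > 2` it has compact support; for `p < 2`
it is positive with the precise decay (kil) according to the position of `p`
relative to `p₁ = 2N/(N+1)`. -/
theorem stmt15 (N : ℕ) (hN : 1 ≤ N) (p q α : ℝ) (hp : 1 < p) (hq : 1 < q) (hα : 0 < α)
    (hL : 2 < p ∨ (p < 2 ∧ α < p / (2 - p))) (hαN : α < N)
    (hq2 : p < (N : ℝ) → q < ((N : ℝ) * (p - 1) + p) / ((N : ℝ) - p)) :
    ∃ a : ℝ, 0 < a ∧ ∃ w : ℝ → ℝ, IsGlobalSolution N p q α a w ∧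
      (∀ r ∈ Ici (0 : ℝ), 0 ≤ w r) ∧
      Tendsto (fun r => r ^ α * w r) atTop (𝓝 0) ∧
      (2 < p → ∃ R : ℝ, 0 < R ∧ ∀ r ∈ Ici R, w r = 0) ∧
      (p < 2 →
        (∀ r ∈ Ici (0 : ℝ), 0 < w r) ∧
        (2 * (N : ℝ) / (N + 1) < p →
          Tendsto (fun r => r ^ (p / (2 - p)) * w r) atTop
            (𝓝 (((p / (2 - p)) ^ (p - 1) *
                ((p / (2 - p) - N) / (p / (2 - p) - α))) ^ (1 / (2 - p))))) ∧
        (p < 2 * (N : ℝ) / (N + 1) →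
          ∃ c : ℝ, 0 < c ∧
            Tendsto (fun r => r ^ (((N : ℝ) - p) / (p - 1)) * w r) atTop (𝓝 c)) ∧
        (p = 2 * (N : ℝ) / (N + 1) →
          Tendsto (fun r => r ^ (N : ℝ) * Real.log r ^ (((N : ℝ) + 1) / 2) * w r) atTop
            (𝓝 ((1 / N) * (((N : ℝ) * (N - 1)) / (2 * ((N : ℝ) - α))) ^ (((N : ℝ) + 1) / 2))))) := by
  obtain ⟨n, rfl⟩ : ∃ n, N = n + 1 := ⟨N - 1, by omega⟩
  have hp1 : 0 < p - 1 := by linarith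
  have hm : 0 < 1 / (p - 1) := one_div_pos.2 hp1
  have hsub : 1 < n * (1 / (p - 1)) → q * (n * (1 / (p - 1)) - 1) < n + 1 / (p - 1) + 2 := by
    intro h
    rw [mul_one_div, lt_div_iff₀ hp1, one_mul] at h
    push_cast at hq2
    have h1 := hq2 (by linarith)
    rw [lt_div_iff₀ (by linarith)] at h1
    have e1 : q * (n * (1 / (p - 1)) - 1) = q * (n + 1 - p) / (p - 1) := by field_simp; ring
    have e2 : n + 1 / (p - 1) + 2 = ((n + 1) * (p - 1) + p) / (p - 1) := by field_simp; ring
    rw [e1, e2]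
    exact div_lt_div_of_pos_right h1 hp1
  obtain ⟨θ, hθ, x, y, hx0, hxy, hlt, hgt⟩ :=
    exists_scaled_profile hm hq hα (by exact_mod_cast hαN) hsub
  obtain ⟨a, ha, b, hb, c, hc, habc, hw⟩ := hxy.scale hθ hm hq
  have hw0 : a * x (c * 0) = a := by rw [mul_zero, hx0, mul_one]
  have hsol := hw.isGlobalSolution hm (one_div_mul_cancel hp1.ne') hq
  rw [hw0] at hsol
  have hcr : Tendsto (fun r => c * r) atTop atTop := tendsto_id.const_mul_atTop hc
  refine ⟨a, ha, _, hsol, fun r hr => ?_, ?_⟩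
  · rcases (mem_Ici.1 hr).eq_or_lt with rfl | h
    exacts [hw0.symm ▸ ha.le, hw.x_nonneg r h]
  rcases hL with hp2 | ⟨hp2, hαδ⟩
  · obtain ⟨R, hR, hzero⟩ := hlt (by rw [div_lt_one hp1]; linarith)
    have hz : ∀ r ≥ R / c, a * x (c * r) = 0 := fun r hr => by
      rw [hzero _ ((div_le_iff₀' hc).1 hr), mul_zero]
    refine ⟨tendsto_const_nhds.congr' ?_, fun _ => ⟨R / c, by positivity, hz⟩,
      fun h => absurd hp2 h.not_gt⟩
    filter_upwards [eventually_ge_atTop (R / c)] with r hr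
    rw [hz r hr, mul_zero]
  · obtain ⟨hpos, hxlim, hxle⟩ := hgt (by rw [lt_div_iff₀ hp1]; linarith)
    have h2 : 0 < 2 - p := by linarith
    have hlog := hw.logSystem (δ := p / (2 - p)) hq (by field_simp; ring)
      (fun s hs => ⟨mul_pos ha (hpos _ (by positivity)).1, mul_pos hb (hpos _ (by positivity)).2⟩)
      (by simpa using (hxlim.comp hcr).const_mul a) (by
        filter_upwards [hcr.eventually hxle] with s hs
        have := mul_le_mul_of_nonneg_left hs hb.le
        rw [← habc]
        linarith)
    have hdec := LogSystem.radial_decay (w := fun r => a * x (c * r)) hp hp2 hα hαδ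
      (by exact_mod_cast hαN) hlog
    push_cast
    refine ⟨hdec.1, fun h => absurd hp2 h.not_gt, fun _ => ⟨fun r hr => ?_, hdec.2⟩⟩
    rcases (mem_Ici.1 hr).eq_or_lt with rfl | h
    exacts [hw0.symm ▸ ha, mul_pos ha (hpos _ (by positivity)).1]
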